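/- Let G be a finite group with |cs(G)| ≥ 4 such that exactly two elements of cs(G) are composite numbers, and one of these two composite class sizes is a prime power. Then either G = F_2(G), or every non-identity element of the quotient G/F_2(G) has prime order. -/

import Mathlib

/-- The set of conjugacy class sizes of a group `G`. -/
def csSet (G : Type*) [Group G] : Set ℕ :=
  {n | ∃ g : G, n = (Subgroup.centralizer {g} : Subgroup G).index}

/-- A natural number is composite if it is greater than 1 and not prime. -/
def IsCompositeNat (n : ℕ) : Prop := 1 < n ∧ ¬ n.Prime

/-- The Fitting subgroup of `G`: the subgroup generated by all nilpotent normal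
subgroups of `G` (realised as a normal closure, so that it is normal by construction). -/
def fittingSubgroup (G : Type*) [Group G] : Subgroup G :=
  Subgroup.normalClosure {x : G | ∃ N : Subgroup G, N.Normal ∧ Group.IsNilpotent N ∧ x ∈ N}

instance fittingSubgroup_normal (G : Type*) [Group G] : (fittingSubgroup G).Normal :=
  Subgroup.normalClosure_normal

/-- The second Fitting subgroup of `G`: the preimage in `G` of the Fitting subgroup of
`G / F(G)` under the quotient map. -/
def fitting2 (G : Type*) [Group G] : Subgroup G :=
  (fittingSubgroup (G ⧸ fittingSubgroup G)).comap (QuotientGroup.mk' (fittingSubgroup G))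

instance fitting2_normal (G : Type*) [Group G] : (fitting2 G).Normal :=
  Subgroup.Normal.comap (fittingSubgroup_normal _) _



/-- average of roots of unity that is an algebraic integer -/
theorem avg_roots_unity (N : ℕ) (hN : 0 < N) (Z : Multiset ℂ) (hZ : ∀ z ∈ Z, z ^ N = 1) (d : ℕ)
    (hd : 0 < d) (hc : Multiset.card Z = d) (hint : IsIntegral ℤ (Z.sum / d)) :
    Z.sum = 0 ∨ ∃ ζ : ℂ, ∀ z ∈ Z, z = ζ := by
  by_cases h0 : Z.sum = 0
  · exact Or.inl h0
  right
  have hnorm1 : ∀ z : ℂ, z ^ N = 1 → ‖z‖ = 1 := fun z hz => Complex.norm_eq_one_of_pow_eq_one hz hN.ne'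
  have hsumle : ∀ Y : Multiset ℂ, (∀ z ∈ Y, z ^ N = 1) → ‖Y.sum‖ ≤ Multiset.card Y := by
    intro Y
    induction Y using Multiset.induction_on with
    | empty => simp
    | cons a s ih =>
      intro h
      simp only [Multiset.sum_cons, Multiset.card_cons]
      have := ih (fun z hz => h z (Multiset.mem_cons_of_mem hz))
      have h2 := hnorm1 a (h a (Multiset.mem_cons_self a s))
      have := norm_add_le a s.sum
      push_cast
      linarith
  set α : ℂ := Z.sum / d with hα
  have hd' : (0:ℝ) < d := by exact_mod_cast hd
  have hα0 : α ≠ 0 := div_ne_zero h0 (by exact_mod_cast hd.ne')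
  -- the algebraic closure of Q in C
  let K := algebraicClosure ℚ ℂ
  have hmemK : ∀ z : ℂ, z ^ N = 1 → z ∈ K := by
    intro z hz
    rw [mem_algebraicClosure_iff]
    refine (IsIntegral.isAlgebraic ?_)
    exact ⟨Polynomial.X ^ N - 1, by simpa using Polynomial.monic_X_pow_sub_C (1:ℚ) hN.ne', by simp [hz]⟩
  obtain ⟨Z', hZ'⟩ : ∃ Z' : Multiset K, Z'.map (algebraMap K ℂ) = Z := by
    refine ⟨Z.attach.map (fun z => ⟨z.1, hmemK z.1 (hZ z.1 z.2)⟩), ?_⟩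
    rw [Multiset.map_map]
    exact Multiset.attach_map_val Z
  let a : K := Z'.sum / d
  have ha : algebraMap K ℂ a = α := by
    simp only [a, hα, map_div₀, map_natCast, map_multiset_sum, hZ']
  have hZ'N : ∀ z ∈ Z', z ^ N = 1 := by
    intro z hz
    apply (algebraMap K ℂ).injective
    rw [map_pow, map_one]
    apply hZ
    rw [← hZ']
    exact Multiset.mem_map_of_mem _ hz
  have hcZ' : Multiset.card Z' = d := by rw [← hc, ← hZ', Multiset.card_map]
  have hroot : ∀ β ∈ (minpoly ℚ α).aroots ℂ, ‖β‖ ≤ 1 := by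
    intro β hβ
    have hβ' : β ∈ (minpoly ℚ a).rootSet ℂ := by
      rw [← ha, minpoly.algebraMap_eq (algebraMap K ℂ).injective] at hβ
      rw [Polynomial.rootSet, Finset.mem_coe, Multiset.mem_toFinset]
      exact hβ
    haveI : Algebra.IsAlgebraic ℚ K := algebraicClosure.isAlgebraic ℚ ℂ
    rw [← Algebra.IsAlgebraic.range_eval_eq_rootSet_minpoly] at hβ'
    obtain ⟨ψ, rfl⟩ := hβ'
    simp only [a, map_div₀, map_natCast, map_multiset_sum, norm_div]
    have := hsumle (Z'.map ψ) (by
      intro z hz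
      obtain ⟨y, hy, rfl⟩ := Multiset.mem_map.1 hz
      rw [← map_pow, hZ'N y hy, map_one])
    rw [Multiset.card_map, hcZ'] at this
    rw [div_le_one (by simpa using hd)]
    simpa using this
  have hmi : minpoly ℚ α = (minpoly ℤ α).map (algebraMap ℤ ℚ) :=
    minpoly.isIntegrallyClosed_eq_field_fractions' ℚ hint
  have hmonic : (minpoly ℚ α).Monic := by
    rw [hmi]; exact (minpoly.monic hint).map _
  have hne : minpoly ℚ α ≠ 0 := hmonic.ne_zero
  have hprod : ((minpoly ℚ α).aroots ℂ).prod = (-1) ^ (minpoly ℚ α).natDegree * ((minpoly ℤ α).coeff 0 : ℂ) := by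
    have h1 := (IsAlgClosed.splits ((minpoly ℚ α).map (algebraMap ℚ ℂ))).coeff_zero_eq_prod_roots_of_monic (hmonic.map _)
    rw [Polynomial.coeff_map, Polynomial.natDegree_map] at h1
    have h2 : algebraMap ℚ ℂ ((minpoly ℚ α).coeff 0) = ((minpoly ℤ α).coeff 0 : ℂ) := by
      rw [hmi, Polynomial.coeff_map]; simp
    rw [← h2, h1, ← mul_assoc, ← pow_add, ← two_mul, pow_mul]
    simp [Polynomial.aroots]
  have hc0 : (minpoly ℤ α).coeff 0 ≠ 0 := by
    intro h
    have h2 : (minpoly ℚ α).coeff 0 = 0 := by rw [hmi, Polynomial.coeff_map, h, map_zero]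
    exact minpoly.coeff_zero_ne_zero (hint.tower_top (A := ℚ)) hα0 h2
  have hprodnorm : 1 ≤ ‖((minpoly ℚ α).aroots ℂ).prod‖ := by
    rw [hprod]
    simp only [norm_mul, norm_pow, norm_neg, norm_one, one_pow, one_mul]
    rw [Complex.norm_intCast]
    exact_mod_cast Int.one_le_abs hc0
  have hαmem : α ∈ (minpoly ℚ α).aroots ℂ := by
    rw [Polynomial.mem_aroots]
    exact ⟨hne, minpoly.aeval ℚ α⟩
  have hα1 : 1 ≤ ‖α‖ := by
    obtain ⟨t, ht⟩ := Multiset.exists_cons_of_mem hαmem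
    rw [ht, Multiset.prod_cons, norm_mul] at hprodnorm
    have hle : ∀ Y : Multiset ℂ, (∀ z ∈ Y, ‖z‖ ≤ 1) → ‖Y.prod‖ ≤ 1 := by
      intro Y
      induction Y using Multiset.induction_on with
      | empty => simp
      | cons a s ih =>
        intro h
        rw [Multiset.prod_cons, norm_mul]
        exact mul_le_one₀ (h a (Multiset.mem_cons_self a s)) (norm_nonneg _)
          (ih (fun z hz => h z (Multiset.mem_cons_of_mem hz)))
    have h3 := hle t (fun z hz => hroot z (by rw [ht]; exact Multiset.mem_cons_of_mem hz))
    nlinarith [norm_nonneg α, norm_nonneg t.prod]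
  have hZd : (d:ℝ) ≤ ‖Z.sum‖ := by
    rw [hα, norm_div, Complex.norm_natCast, le_div_iff₀ hd'] at hα1
    linarith
  -- now equality case
  have key : ∀ x y : ℂ, x ∈ Z → y ∈ Z → x = y := by
    intro x y hx hy
    by_contra hxy
    obtain ⟨t, ht⟩ := Multiset.exists_cons_of_mem hx
    have hy' : y ∈ t := by
      rw [ht] at hy
      exact (Multiset.mem_cons.1 hy).resolve_left (fun h => hxy h.symm)
    obtain ⟨t', ht'⟩ := Multiset.exists_cons_of_mem hy'
    have hxn := hnorm1 x (hZ x hx)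
    have hyn := hnorm1 y (hZ y hy)
    have hlt : ‖x + y‖ < 2 := by
      have := (not_sameRay_iff_norm_add_lt (x := x) (y := y)).1 (by
        rw [sameRay_iff_of_norm_eq (hxn.trans hyn.symm)]; exact hxy)
      linarith
    have h4 := hsumle t' (fun z hz => hZ z (by
      rw [ht, ht']; exact Multiset.mem_cons_of_mem (Multiset.mem_cons_of_mem hz)))
    have h5 : (Multiset.card t' : ℝ) + 2 = d := by
      rw [← hc, ht, ht']; simp; ring
    rw [ht, ht', Multiset.sum_cons, Multiset.sum_cons, ← add_assoc] at hZd
    have := norm_add_le (x+y) t'.sum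
    linarith
  have hne : Z ≠ 0 := by rintro rfl; simp at h0
  obtain ⟨ζ, hζ⟩ := Multiset.exists_mem_of_ne_zero hne
  exact ⟨ζ, fun z hz => key z ζ hz hζ⟩


theorem mat_roots_pow (d N : ℕ) (M : Matrix (Fin d) (Fin d) ℂ) (hM : M ^ N = 1) :
    ∀ z ∈ M.charpoly.roots, z ^ N = 1 := by
  intro z hz
  have hz' : z ∈ spectrum ℂ M := by
    rcases d with _ | d
    · simp [Matrix.charpoly] at hz
    exact Matrix.mem_spectrum_of_isRoot_charpoly (Polynomial.isRoot_of_mem_roots hz)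
  have h2 : z ^ N ∈ spectrum ℂ (M ^ N) := spectrum.pow_mem_pow M N hz'
  rw [hM] at h2
  rcases d with _ | d
  · simp [Matrix.charpoly] at hz
  rw [spectrum.one_eq] at h2
  exact h2

theorem mat_trace_integral (d N : ℕ) (hN : 0 < N) (M : Matrix (Fin d) (Fin d) ℂ) (hM : M ^ N = 1) :
    IsIntegral ℤ M.trace := by
  rw [Matrix.trace_eq_sum_roots_charpoly]
  have h := mat_roots_pow d N M hM
  revert h
  generalize M.charpoly.roots = Y
  induction Y using Multiset.induction_on with
  | empty => intro _; simpa using isIntegral_zero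
  | cons a s ih =>
    intro h
    rw [Multiset.sum_cons]
    refine IsIntegral.add ?_ (ih (fun z hz => h z (Multiset.mem_cons_of_mem hz)))
    refine IsIntegral.of_pow hN ?_
    rw [h a (Multiset.mem_cons_self a s)]
    exact isIntegral_one

theorem mat_scalar (d N : ℕ) (hd : 0 < d) (hN : 0 < N) (M : Matrix (Fin d) (Fin d) ℂ) (hM : M ^ N = 1)
    (hint : IsIntegral ℤ (M.trace / d)) :
    M.trace = 0 ∨ ∃ ζ : ℂ, M = algebraMap ℂ _ ζ := by
  have hcard : Multiset.card M.charpoly.roots = d := by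
    have := (IsAlgClosed.splits M.charpoly).natDegree_eq_card_roots
    rw [← this, Matrix.charpoly_natDegree_eq_dim]; simp
  rw [Matrix.trace_eq_sum_roots_charpoly] at hint ⊢
  rcases avg_roots_unity N hN _ (mat_roots_pow d N M hM) d hd hcard hint with h | ⟨ζ, hζ⟩
  · exact Or.inl h
  right
  refine ⟨ζ, ?_⟩
  have : NeZero d := ⟨hd.ne'⟩
  have hch : M.charpoly = (Polynomial.X - Polynomial.C ζ) ^ d := by
    rw [(IsAlgClosed.splits M.charpoly).eq_prod_roots_of_monic M.charpoly_monic]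
    rw [Multiset.eq_replicate.2 ⟨hcard, hζ⟩]
    simp
  have h1 : minpoly ℂ M ∣ (Polynomial.X - Polynomial.C ζ) ^ d := hch ▸ Matrix.minpoly_dvd_charpoly M
  have h2 : minpoly ℂ M ∣ Polynomial.X ^ N - 1 := minpoly.dvd _ _ (by simp [hM])
  have hsep : (Polynomial.X ^ N - 1 : Polynomial ℂ).Separable := by
    have := Polynomial.separable_X_pow_sub_C (1:ℂ) (n := N) (by exact_mod_cast hN.ne') one_ne_zero
    simpa using this
  have hsq : Squarefree (minpoly ℂ M) := hsep.squarefree.squarefree_of_dvd h2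
  have h3 : minpoly ℂ M ∣ Polynomial.X - Polynomial.C ζ := (hsq.dvd_pow_iff_dvd hd.ne').1 h1
  have h4 := Polynomial.aeval_eq_zero_of_dvd_aeval_eq_zero h3 (minpoly.aeval ℂ M)
  simpa [sub_eq_zero] using h4

theorem trace_mulLeft_pi (n : ℕ) (d : Fin n → ℕ) (M : Π i, Matrix (Fin (d i)) (Fin (d i)) ℂ) :
    LinearMap.trace ℂ _ (LinearMap.mulLeft ℂ M) = ∑ i, (d i : ℂ) * (M i).trace := by
  classical
  rw [LinearMap.trace_eq_matrix_trace ℂ (Pi.basis (fun i => Matrix.stdBasis ℂ (Fin (d i)) (Fin (d i))))]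
  rw [Matrix.trace, Fintype.sum_sigma]
  refine Finset.sum_congr rfl fun i _ => ?_
  rw [Fintype.sum_prod_type, Matrix.trace, Finset.mul_sum]
  refine Finset.sum_congr rfl fun a _ => ?_
  have : ∀ b : Fin (d i), ((LinearMap.toMatrix (Pi.basis fun i => Matrix.stdBasis ℂ (Fin (d i)) (Fin (d i)))
      (Pi.basis fun i => Matrix.stdBasis ℂ (Fin (d i)) (Fin (d i)))) (LinearMap.mulLeft ℂ M)).diag ⟨i, (a, b)⟩
        = M i a a := by
    intro b
    rw [Matrix.diag_apply, LinearMap.toMatrix_apply, Pi.basis_repr, Pi.basis_apply]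
    simp only [LinearMap.mulLeft_apply, Pi.mul_apply, Pi.single_eq_same, Matrix.stdBasis_eq_single]
    have h2 : ∀ X : Matrix (Fin (d i)) (Fin (d i)) ℂ, ((Matrix.stdBasis ℂ (Fin (d i)) (Fin (d i))).repr X) (a, b) = X a b := by
      intro X
      rfl
    rw [h2]
    simp
  simp only [this]
  simp

theorem trace_mulLeft_monoidAlgebra (S : Type*) [Group S] [Finite S] (w : S) (hw : w ≠ 1) :
    LinearMap.trace ℂ _ (LinearMap.mulLeft ℂ (MonoidAlgebra.of ℂ S w)) = 0 := by
  classical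
  have := Fintype.ofFinite S
  rw [LinearMap.trace_eq_matrix_trace ℂ (MonoidAlgebra.basis S ℂ)]
  rw [Matrix.trace]
  refine Finset.sum_eq_zero fun s _ => ?_
  rw [Matrix.diag_apply, LinearMap.toMatrix_apply]
  have h : LinearMap.mulLeft ℂ (MonoidAlgebra.of ℂ S w) (MonoidAlgebra.basis S ℂ s)
      = MonoidAlgebra.basis S ℂ (w * s) := by
    simp [MonoidAlgebra.single_mul_single]
  rw [h, Module.Basis.repr_self, Finsupp.single_apply, if_neg (by simpa using hw)]


theorem mat_central (d : ℕ) (E : Matrix (Fin d) (Fin d) ℂ) (h : ∀ X, X * E = E * X) :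
    ∃ c : ℂ, E = algebraMap ℂ _ c := by
  have : E ∈ Set.center (Matrix (Fin d) (Fin d) ℂ) := by
    rw [Semigroup.mem_center_iff]; exact h
  rw [Matrix.center_eq_range] at this
  obtain ⟨c, rfl⟩ := this
  exact ⟨c, rfl⟩

theorem ncard_conj_class {G : Type*} [Group G] (w : G) :
    {y : G | IsConj w y}.ncard = (Subgroup.centralizer {w} : Subgroup G).index := by
  have h := MulAction.index_stabilizer (ConjAct G) w
  rw [ConjAct.orbit_eq_carrier_conjClasses] at h
  have h2 : (Subgroup.centralizer {w} : Subgroup G).index = (MulAction.stabilizer (ConjAct G) w).index := by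
    rw [ConjAct.stabilizer_eq_centralizer]; rfl
  rw [h2, h]
  congr 1

theorem burnside_center (S : Type*) [Group S] [Finite S] [IsSimpleGroup S] (w : S) (hw : w ≠ 1)
    (hZ : ∀ z : S, (∀ s, z * s = s * z) → z = 1)
    (p k : ℕ) (hp : p.Prime) (hidx : (Subgroup.centralizer {w} : Subgroup S).index = p ^ k) : False := by
  classical
  have := Fintype.ofFinite S
  have : NeZero (Nat.card S : ℂ) := ⟨by exact_mod_cast Nat.card_pos.ne'⟩
  have hfd : FiniteDimensional ℂ (MonoidAlgebra ℂ S) := Module.Finite.of_basis (MonoidAlgebra.basis S ℂ)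
  obtain ⟨n, d, hd, ⟨φ⟩⟩ := IsSemisimpleRing.exists_algEquiv_pi_matrix_of_isAlgClosed ℂ (MonoidAlgebra ℂ S)
  let of := MonoidAlgebra.of ℂ S
  -- trace identity
  have htr : ∑ i, (d i : ℂ) * (φ (of w) i).trace = 0 := by
    rw [← trace_mulLeft_pi, ← trace_mulLeft_monoidAlgebra S w hw]
    rw [← LinearMap.trace_conj' (LinearMap.mulLeft ℂ (of w)) φ.toLinearEquiv]
    congr 1
    apply LinearMap.ext
    intro x
    simp only [LinearEquiv.conj_apply_apply, LinearMap.mulLeft_apply, AlgEquiv.toLinearEquiv_apply, map_mul]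
    congr 1
    exact (φ.apply_symm_apply x).symm
  let ρ : ∀ i, MonoidAlgebra ℂ S →ₐ[ℂ] Matrix (Fin (d i)) (Fin (d i)) ℂ :=
    fun i => (Pi.evalAlgHom ℂ _ i).comp φ.toAlgHom
  have hρφ : ∀ i a, ρ i a = φ a i := fun i a => rfl
  have hsurj : ∀ i, Function.Surjective (ρ i) := by
    intro i M
    obtain ⟨a, ha⟩ := φ.surjective (Pi.single i M)
    exact ⟨a, by rw [hρφ, ha, Pi.single_eq_same]⟩
  -- central elements act as scalars
  have hcentral : ∀ e : MonoidAlgebra ℂ S, (∀ s, of s * e = e * of s) → ∀ i, ∃ c : ℂ, ρ i e = algebraMap ℂ _ c := by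
    intro e he i
    apply mat_central
    intro X
    obtain ⟨a, rfl⟩ := hsurj i X
    rw [← map_mul, ← map_mul]
    congr 1
    induction a using MonoidAlgebra.induction_on with
    | of s => exact he s
    | add a b ha hb => rw [add_mul, mul_add, ha, hb]
    | smul r a ha => rw [smul_mul_assoc, mul_smul_comm, ha]
  -- trivial or faithful
  have hdich : ∀ i, (∀ s, ρ i (of s) = 1) ∨ (∀ s, ρ i (of s) = 1 → s = 1) := by
    intro i
    let f : S →* Matrix (Fin (d i)) (Fin (d i)) ℂ := (ρ i : _ →* _).comp of
    rcases (MonoidHom.normal_ker f).eq_bot_or_eq_top with h | h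
    · right
      intro s hs
      have : s ∈ f.ker := hs
      rw [h] at this
      simpa using this
    · left
      intro s
      have : s ∈ f.ker := by rw [h]; trivial
      exact this
  -- a trivial one exists
  obtain ⟨i0, hi0⟩ : ∃ i, ∀ s, ρ i (of s) = 1 := by
    let e : MonoidAlgebra ℂ S := ∑ s, of s
    have he1 : ∀ s, of s * e = e := by
      intro s
      simp only [e, Finset.mul_sum, ← map_mul]
      exact Fintype.sum_equiv (Equiv.mulLeft s) _ _ (fun x => rfl)
    have he2 : ∀ s, e * of s = e := by
      intro s
      simp only [e, Finset.sum_mul, ← map_mul]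
      exact Fintype.sum_equiv (Equiv.mulRight s) _ _ (fun x => rfl)
    have hene : e ≠ 0 := by
      intro h
      have h2 := congrArg (fun a => (MonoidAlgebra.basis S ℂ).repr a 1) h
      have h3 : ∀ s, of s = MonoidAlgebra.basis S ℂ s := fun s => by simp [of]
      simp only [e, h3, map_sum, Module.Basis.repr_self, map_zero, Finsupp.coe_zero, Pi.zero_apply,
        Finsupp.finsetSum_apply, Finsupp.single_apply] at h2
      simp at h2
    have hφe : φ e ≠ 0 := fun h => hene (φ.injective (h.trans (map_zero φ).symm))
    obtain ⟨i, hi⟩ := Function.ne_iff.1 hφe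
    refine ⟨i, fun s => ?_⟩
    obtain ⟨c, hc⟩ := hcentral e (fun s => by rw [he1, he2]) i
    have hc0 : c ≠ 0 := by
      rintro rfl
      apply hi
      rw [← hρφ, hc, map_zero]; rfl
    have h5 : ρ i (of s) * ρ i e = ρ i e := by rw [← map_mul, he1]
    rw [hc, Algebra.algebraMap_eq_smul_one, mul_smul_comm, mul_one] at h5
    exact smul_right_injective _ hc0 h5
  have hd1 : ∀ i, (∀ s, ρ i (of s) = 1) → ∀ a, ∃ c : ℂ, ρ i a = algebraMap ℂ _ c ∧ ∀ j, (∀ s, ρ j (of s) = 1) → ρ j a = algebraMap ℂ _ c := by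
    intro i hi a
    induction a using MonoidAlgebra.induction_on with
    | of s => exact ⟨1, by rw [map_one]; exact hi s, fun j hj => by rw [map_one]; exact hj s⟩
    | add a b ha hb =>
      obtain ⟨c, hc1, hc2⟩ := ha
      obtain ⟨c', hc1', hc2'⟩ := hb
      exact ⟨c + c', by rw [map_add, map_add, hc1, hc1'], fun j hj => by rw [map_add, map_add, hc2 j hj, hc2' j hj]⟩
    | smul r a ha =>
      obtain ⟨c, hc1, hc2⟩ := ha
      exact ⟨r * c, by rw [map_smul, hc1, map_mul, Algebra.smul_def], fun j hj => by rw [map_smul, hc2 j hj, map_mul, Algebra.smul_def]⟩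
  have hd01 : d i0 = 1 := by
    by_contra hne
    have h2 : 2 ≤ d i0 := by have := (hd i0).out; omega
    obtain ⟨a, ha⟩ := hsurj i0 (Matrix.single ⟨0, by omega⟩ ⟨1, by omega⟩ 1)
    obtain ⟨c, hc, -⟩ := hd1 i0 hi0 a
    have h3 := congrFun (congrFun (ha.symm.trans hc) ⟨0, by omega⟩) ⟨1, by omega⟩
    rw [Matrix.single_apply_same, Matrix.algebraMap_matrix_apply, if_neg (by simp)] at h3
    exact one_ne_zero h3
  have huniq : ∀ i, (∀ s, ρ i (of s) = 1) → i = i0 := by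
    intro i hi
    by_contra hne
    obtain ⟨a, ha⟩ := φ.surjective (Pi.single i 1)
    obtain ⟨c, hc1, hc2⟩ := hd1 i hi a
    have h2 := hc2 i0 hi0
    rw [hρφ, ha, Pi.single_eq_same] at hc1
    rw [hρφ, ha, Pi.single_eq_of_ne (fun h => hne h.symm)] at h2
    have hc0 : c = 0 := by
      have := (hd i0)
      have h3 : (algebraMap ℂ (Matrix (Fin (d i0)) (Fin (d i0)) ℂ)) 0 = algebraMap ℂ _ c := by rw [← h2, map_zero]
      exact ((algebraMap ℂ (Matrix (Fin (d i0)) (Fin (d i0)) ℂ)).injective h3).symm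
    rw [hc0, map_zero] at hc1
    have := hd i
    exact one_ne_zero hc1
  -- class sum
  let cls : Finset S := Finset.univ.filter (fun y => IsConj w y)
  have hcls : cls.card = p ^ k := by
    rw [← hidx, ← ncard_conj_class, ← Set.ncard_coe_finset]
    congr 1
    ext y; simp [cls]
  let K : MonoidAlgebra ℂ S := ∑ y ∈ cls, of y
  have hKc : ∀ s, of s * K = K * of s := by
    intro s
    have h1 : of s * K * of s⁻¹ = K := by
      simp only [K, Finset.mul_sum, Finset.sum_mul, ← map_mul]
      refine Finset.sum_equiv (MulAut.conj s).toEquiv ?_ ?_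
      · intro y
        simp only [cls, Finset.mem_filter, Finset.mem_univ, true_and]
        have : IsConj y ((MulAut.conj s).toEquiv y) := isConj_iff.2 ⟨s, rfl⟩
        exact ⟨fun h => h.trans this, fun h => h.trans this.symm⟩
      · intro y _; rfl
    calc of s * K = of s * K * of s⁻¹ * of s := by rw [mul_assoc (of s * K), ← map_mul]; simp
      _ = _ := by rw [h1]
  have hKint : IsIntegral ℤ K := by
    let ψ : MonoidAlgebra ℤ S →ₐ[ℤ] MonoidAlgebra ℂ S := MonoidAlgebra.mapAlgHom S (Algebra.ofId ℤ ℂ)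
    have hf : Module.Finite ℤ (MonoidAlgebra ℤ S) := Module.Finite.of_basis (MonoidAlgebra.basis S ℤ)
    have h1 : IsIntegral ℤ (∑ y ∈ cls, MonoidAlgebra.of ℤ S y) := IsIntegral.of_finite ℤ _
    have h2 := h1.map ψ
    convert h2
    simp [K, ψ, of]
  have hN : 0 < Nat.card S := Nat.card_pos
  have hpow : ∀ i s, ρ i (of s) ^ Nat.card S = 1 := by
    intro i s
    rw [← map_pow, ← map_pow, pow_card_eq_one', map_one, map_one]
  have hint : ∀ i s, IsIntegral ℤ (ρ i (of s)).trace := fun i s =>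
    mat_trace_integral _ _ hN _ (hpow i s)
  have hmain : ∀ i, i ≠ i0 → (ρ i (of w)).trace = 0 ∨ p ∣ d i := by
    intro i hi
    have hdi := hd i
    have hfaith : ∀ s, ρ i (of s) = 1 → s = 1 := (hdich i).resolve_left (fun h => hi (huniq i h))
    by_cases hpd : p ∣ d i
    · exact Or.inr hpd
    left
    obtain ⟨c, hc⟩ := hcentral K hKc i
    have hcint : IsIntegral ℤ c := by
      have h1 : IsIntegral ℤ (ρ i K) := hKint.map ((ρ i).restrictScalars ℤ)
      rw [hc] at h1
      exact (isIntegral_algebraMap_iff (algebraMap ℂ _).injective).1 h1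
    have htrK : (p ^ k : ℂ) * (ρ i (of w)).trace = c * d i := by
      have h1 : (ρ i K).trace = c * d i := by
        rw [hc, Algebra.algebraMap_eq_smul_one, Matrix.trace_smul, Matrix.trace_one]; simp
      have h2 : ∀ y ∈ cls, (ρ i (of y)).trace = (ρ i (of w)).trace := by
        intro y hy
        obtain ⟨s, rfl⟩ := isConj_iff.1 (Finset.mem_filter.1 hy).2
        rw [map_mul, map_mul, Matrix.trace_mul_comm, ← map_mul, ← map_mul]
        congr 3
        group
      rw [← h1]
      simp only [K, map_sum, Matrix.trace_sum]
      rw [Finset.sum_congr rfl h2, Finset.sum_const, hcls]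
      simp
    have hcop : IsCoprime ((p:ℤ) ^ k) (d i : ℤ) := by
      have : Nat.Coprime (p ^ k) (d i) := Nat.Coprime.pow_left _ ((Nat.Prime.coprime_iff_not_dvd hp).2 hpd)
      have := Nat.isCoprime_iff_coprime.2 this
      simpa using this
    obtain ⟨a, b, hab⟩ := hcop
    have hdne : (d i : ℂ) ≠ 0 := by exact_mod_cast hdi.out
    have hav : IsIntegral ℤ ((ρ i (of w)).trace / d i) := by
      have h1 : (ρ i (of w)).trace / d i = (a : ℂ) * c + b * (ρ i (of w)).trace := by
        have hab' : (a : ℂ) * p ^ k + b * d i = 1 := by exact_mod_cast hab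
        rw [div_eq_iff hdne]
        calc (ρ i (of w)).trace = ((a : ℂ) * p ^ k + b * d i) * (ρ i (of w)).trace := by rw [hab', one_mul]
          _ = a * ((p ^ k : ℂ) * (ρ i (of w)).trace) + b * d i * (ρ i (of w)).trace := by ring
          _ = _ := by rw [htrK]; ring
      rw [h1]
      exact (IsIntegral.mul (isIntegral_algebraMap (x := a)) hcint).add
        (IsIntegral.mul (isIntegral_algebraMap (x := b)) (hint i w))
    rcases mat_scalar (d i) _ (Nat.pos_of_ne_zero hdi.out) hN _ (hpow i w) hav with h | ⟨ζ, hζ⟩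
    · exact h
    exfalso
    apply hw
    apply hZ
    intro s
    have h1 : ρ i (of (w * s * w⁻¹ * s⁻¹)) = 1 := by
      have h0 : ρ i (of (w * s)) = ρ i (of (s * w)) := by
        rw [map_mul, map_mul, map_mul, map_mul, hζ, Algebra.commutes]
      have h3 : w * s * w⁻¹ * s⁻¹ = (w * s) * (s * w)⁻¹ := by group
      rw [h3, map_mul, map_mul, h0, ← map_mul, ← map_mul, mul_inv_cancel, map_one, map_one]
    have h2 := hfaith _ h1
    calc w * s = (w * s * w⁻¹ * s⁻¹) * (s * w) := by group
      _ = s * w := by rw [h2, one_mul]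
  -- conclusion
  rw [← Finset.add_sum_erase _ _ (Finset.mem_univ i0)] at htr
  have htr0 : (d i0 : ℂ) * (φ (of w) i0).trace = 1 := by
    rw [← hρφ, hi0 w, Matrix.trace_one, hd01]; simp [hd01]
  rw [htr0] at htr
  have hsum : ∀ F : Finset (Fin n), i0 ∉ F → ∃ t : ℂ, IsIntegral ℤ t ∧ ∑ i ∈ F, (d i : ℂ) * (φ (of w) i).trace = p * t := by
    intro F
    induction F using Finset.induction_on with
    | empty => intro _; exact ⟨0, isIntegral_zero, by simp⟩
    | insert a s ha ih =>
      intro h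
      obtain ⟨t, ht, hs⟩ := ih (fun h' => h (Finset.mem_insert_of_mem h'))
      have hai : a ≠ i0 := fun h' => h (h' ▸ Finset.mem_insert_self a s)
      rw [Finset.sum_insert ha, hs]
      rcases hmain a hai with h1 | ⟨m, hm⟩
      · exact ⟨t, ht, by rw [← hρφ, h1]; ring⟩
      · refine ⟨m * (ρ a (of w)).trace + t, IsIntegral.add (IsIntegral.mul ?_ (hint a w)) ht, ?_⟩
        · exact_mod_cast isIntegral_algebraMap (R := ℤ) (A := ℂ) (x := (m : ℤ))
        · have hm' : (d a : ℂ) = p * m := by exact_mod_cast hm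
          rw [hm', ← hρφ]; ring
  obtain ⟨t, ht, hts⟩ := hsum (Finset.univ.erase i0) (by simp)
  rw [hts] at htr
  have hpne : (p : ℚ) ≠ 0 := by exact_mod_cast hp.ne_zero
  have htq : t = algebraMap ℚ ℂ (-1 / p) := by
    have : (p : ℂ) ≠ 0 := by exact_mod_cast hp.ne_zero
    simp only [map_div₀, map_neg, map_one, map_natCast]
    field_simp
    linear_combination htr
  rw [htq, isIntegral_algebraMap_iff (algebraMap ℚ ℂ).injective] at ht
  obtain ⟨z, hz⟩ := IsIntegrallyClosed.isIntegral_iff.1 ht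
  rw [eq_div_iff hpne] at hz
  have hz' : z * (p:ℤ) = -1 := by
    rw [eq_intCast] at hz
    exact_mod_cast hz
  have : (p : ℤ) ∣ 1 := ⟨-z, by linarith⟩
  have h1 := Int.natAbs_dvd_natAbs.2 this
  simp at h1
  exact hp.one_lt.ne' h1

/-- Burnside -/
theorem burnside_simple (S : Type*) [Group S] [Finite S] [IsSimpleGroup S] (w : S) (hw : w ≠ 1)
    (p k : ℕ) (hp : p.Prime) (hidx : (Subgroup.centralizer {w} : Subgroup S).index = p ^ k) :
    ∀ a b : S, a * b = b * a := by
  by_contra hcon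
  refine burnside_center S w hw ?_ p k hp hidx
  intro z hz
  rcases (inferInstance : (Subgroup.center S).Normal).eq_bot_or_eq_top with h | h
  · have : z ∈ Subgroup.center S := by
      rw [Subgroup.mem_center_iff]; exact fun g => (hz g).symm
    rw [h] at this
    simpa using this
  · exfalso
    apply hcon
    intro a b
    have : b ∈ Subgroup.center S := by rw [h]; trivial
    exact Subgroup.mem_center_iff.1 this a


/-- centralizer of an element -/
def cen {G : Type*} [Group G] (g : G) : Subgroup G := Subgroup.centralizer {g}

/-- class size -/
noncomputable def clz {G : Type*} [Group G] (g : G) : ℕ := (cen g).index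

/-- `g` has prime power class size -/
def PPc {G : Type*} [Group G] (g : G) : Prop := ∃ w k : ℕ, w.Prime ∧ clz g = w ^ k

/-- `g` is a `q`-element -/
def QEl (q : ℕ) {G : Type*} [Group G] (g : G) : Prop := ∃ k : ℕ, g ^ q ^ k = 1

section base
variable {G : Type*} [Group G]

theorem mem_cen {g h : G} : h ∈ cen g ↔ h * g = g * h := by
  rw [cen, Subgroup.mem_centralizer_iff]
  simp only [Set.mem_singleton_iff, forall_eq]
  exact eq_comm

theorem mem_cen_comm {g h : G} : h ∈ cen g ↔ g ∈ cen h := by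
  rw [mem_cen, mem_cen]; exact eq_comm

theorem self_mem_cen (g : G) : g ∈ cen g := mem_cen.2 rfl

theorem mem_cen_conj {g h k : G} : k * h * k⁻¹ ∈ cen (k * g * k⁻¹) ↔ h ∈ cen g := by
  rw [mem_cen, mem_cen]
  have h1 : k * h * k⁻¹ * (k * g * k⁻¹) = k * (h * g) * k⁻¹ := by group
  have h2 : k * g * k⁻¹ * (k * h * k⁻¹) = k * (g * h) * k⁻¹ := by group
  rw [h1, h2]
  constructor
  · intro h; exact mul_left_cancel (mul_right_cancel h)
  · intro h; rw [h]

theorem mem_cen_conj' {g h k : G} : h ∈ cen (k * g * k⁻¹) ↔ k⁻¹ * h * k ∈ cen g := by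
  rw [← mem_cen_conj (k := k) (h := k⁻¹ * h * k)]
  have : k * (k⁻¹ * h * k) * k⁻¹ = h := by group
  rw [this]

theorem cen_le_pow (g : G) (n : ℕ) : cen g ≤ cen (g ^ n) := by
  intro h hh
  rw [mem_cen] at *
  exact ((show Commute h g from hh).pow_right n)

theorem cen_conj (g k : G) : cen (k * g * k⁻¹) = (cen g).map (MulAut.conj k).toMonoidHom := by
  ext h
  rw [mem_cen_conj', Subgroup.mem_map]
  constructor
  · intro hh; exact ⟨_, hh, by simp [MulAut.conj_apply]; group⟩
  · rintro ⟨y, hy, rfl⟩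
    simpa [MulAut.conj_apply, mul_assoc] using hy

theorem clz_conj (g k : G) : clz (k * g * k⁻¹) = clz g := by
  rw [clz, cen_conj, clz]
  exact Subgroup.index_map_equiv (cen g) (MulAut.conj k)

theorem PPc_conj (g k : G) : PPc (k * g * k⁻¹) ↔ PPc g := by
  unfold PPc; rw [clz_conj]

theorem QEl.conj {q : ℕ} {g : G} (h : QEl q g) (k : G) : QEl q (k * g * k⁻¹) := by
  obtain ⟨n, hn⟩ := h
  exact ⟨n, by rw [conj_pow, hn]; group⟩

theorem QEl.map {q : ℕ} {g : G} {H : Type*} [Group H] (h : QEl q g) (f : G →* H) : QEl q (f g) := by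
  obtain ⟨n, hn⟩ := h
  exact ⟨n, by rw [← map_pow, hn, map_one]⟩

theorem QEl.pow {q : ℕ} {g : G} (h : QEl q g) (m : ℕ) : QEl q (g ^ m) := by
  obtain ⟨n, hn⟩ := h
  exact ⟨n, by rw [← pow_mul, mul_comm, pow_mul, hn, one_pow]⟩

theorem QEl.isPGroup {q : ℕ} {g : G} (h : QEl q g) : IsPGroup q (Subgroup.zpowers g) := by
  obtain ⟨n, hn⟩ := h
  rintro ⟨y, hy⟩
  obtain ⟨m, rfl⟩ := Subgroup.mem_zpowers_iff.1 hy
  refine ⟨n, ?_⟩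
  ext
  simp only [Subgroup.coe_pow, Subgroup.coe_one]
  rw [← zpow_natCast, zpow_comm, zpow_natCast, hn, one_zpow]

theorem QEl.of_isPGroup {q : ℕ} {g : G} {P : Subgroup G} (hP : IsPGroup q P) (hg : g ∈ P) : QEl q g := by
  obtain ⟨n, hn⟩ := hP ⟨g, hg⟩
  exact ⟨n, by simpa using congrArg Subtype.val hn⟩

theorem QEl.orderOf_dvd {q : ℕ} {g : G} (h : QEl q g) : ∃ n, orderOf g ∣ q ^ n := by
  obtain ⟨n, hn⟩ := h
  exact ⟨n, orderOf_dvd_of_pow_eq_one hn⟩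

theorem QEl.eq_one {q r : ℕ} (hq : q.Prime) (hr : r.Prime) (hqr : q ≠ r) {g : G} (h1 : QEl q g)
    (h2 : QEl r g) : g = 1 := by
  obtain ⟨n, hn⟩ := h1.orderOf_dvd
  obtain ⟨m, hm⟩ := h2.orderOf_dvd
  have : Nat.Coprime (q ^ n) (r ^ m) := Nat.coprime_pow_primes _ _ hq hr hqr
  exact orderOf_eq_one_iff.1 (Nat.eq_one_of_dvd_coprimes this hn hm)

theorem pow_bezout {g : G} {K : Subgroup G} {a b : ℕ} (hab : Nat.Coprime a b) (ha : g ^ a ∈ K) (hb : g ^ b ∈ K) :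
    g ∈ K := by
  have h := Nat.isCoprime_iff_coprime.2 hab
  obtain ⟨u, v, huv⟩ := h
  have : g = (g ^ a) ^ u * (g ^ b) ^ v := by
    rw [← zpow_natCast, ← zpow_natCast, ← zpow_mul, ← zpow_mul, ← zpow_add, mul_comm (a:ℤ), mul_comm (b:ℤ), huv, zpow_one]
  rw [this]
  exact K.mul_mem (K.zpow_mem ha _) (K.zpow_mem hb _)

/-- centralizer of a product of commuting elements of coprime orders -/
theorem cen_mul {q r : ℕ} (hq : q.Prime) (hr : r.Prime) (hqr : q ≠ r) {a b : G} (ha : QEl q a)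
    (hb : QEl r b) (hab : a ∈ cen b) : cen (a * b) = cen a ⊓ cen b := by
  have hc : Commute a b := mem_cen.1 hab
  apply le_antisymm
  · intro h hh
    obtain ⟨n, hn⟩ := ha
    obtain ⟨m, hm⟩ := hb
    have key : ∀ k : ℕ, (a*b)^k ∈ cen h := fun k => mem_cen_comm.1 (cen_le_pow _ k hh)
    have h1 : b ∈ cen h := by
      have e1 : b ^ q ^ n ∈ cen h := by
        have := key (q ^ n)
        rwa [hc.mul_pow, hn, one_mul] at this
      have e2 : b ^ r ^ m ∈ cen h := by rw [hm]; exact one_mem _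
      exact pow_bezout (Nat.coprime_pow_primes _ _ hq hr hqr) e1 e2
    refine ⟨?_, mem_cen_comm.1 h1⟩
    have h2 : a * b ∈ cen h := by simpa using key 1
    have := (cen h).mul_mem h2 ((cen h).inv_mem h1)
    rw [mul_inv_cancel_right] at this
    exact mem_cen_comm.1 this
  · rintro h ⟨h1, h2⟩
    have e1 := mem_cen_comm.1 h1
    have e2 := mem_cen_comm.1 h2
    exact mem_cen_comm.1 ((cen h).mul_mem e1 e2)

theorem relIndex_ne_zero_fin [Finite G] (H K : Subgroup G) : H.relIndex K ≠ 0 := by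
  unfold Subgroup.relIndex; exact Subgroup.index_ne_zero_of_finite

theorem index_normal_dvd [Finite G] (H K : Subgroup G) [K.Normal] : H.relIndex K ∣ H.index := by
  obtain ⟨m, hm⟩ := Subgroup.relIndex_dvd_index_of_normal K H
  have h1 : H.relIndex K * K.index = (H ⊓ K).index := by
    rw [← Subgroup.inf_relIndex_right]
    exact Subgroup.relIndex_mul_index inf_le_right
  have h2 : K.relIndex H * H.index = (H ⊓ K).index := by
    rw [← Subgroup.inf_relIndex_left]
    exact Subgroup.relIndex_mul_index inf_le_left
  have h0 : K.relIndex H ≠ 0 := relIndex_ne_zero_fin _ _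
  refine ⟨m, ?_⟩
  apply Nat.eq_of_mul_eq_mul_left (Nat.pos_of_ne_zero h0)
  rw [h2, ← h1, hm]; ring

/-- a `t`-subgroup is conjugate into a subgroup of index prime to `t` -/
theorem conj_into [Finite G] {t : ℕ} (ht : t.Prime) (T H : Subgroup G) (hT : IsPGroup t T) (hH : ¬ t ∣ H.index) :
    ∃ g : G, ∀ y ∈ T, g⁻¹ * y * g ∈ H := by
  have := Fact.mk ht
  obtain ⟨c, hc⟩ := hT.nonempty_fixed_point_of_prime_not_dvd_card (G ⧸ H) (by simpa [Subgroup.index] using hH)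
  obtain ⟨g, rfl⟩ := QuotientGroup.mk_surjective c
  refine ⟨g, fun y hy => ?_⟩
  have h1 : (QuotientGroup.mk (y * g) : G ⧸ H) = QuotientGroup.mk g := hc ⟨y, hy⟩
  rw [eq_comm, QuotientGroup.eq] at h1
  simpa [mul_assoc] using h1

theorem conj_cen [Finite G] {t : ℕ} (ht : t.Prime) (T : Subgroup G) (hT : IsPGroup t T) (x : G) (hx : ¬ t ∣ clz x) :
    ∃ g : G, T ≤ cen (g * x * g⁻¹) := by
  obtain ⟨g, hg⟩ := conj_into ht T (cen x) hT hx
  exact ⟨g, fun y hy => mem_cen_conj'.2 (hg y hy)⟩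

theorem conj_cen_el [Finite G] {t : ℕ} (ht : t.Prime) {y : G} (hy : QEl t y) (x : G) (hx : ¬ t ∣ clz x) :
    ∃ g : G, y ∈ cen (g * x * g⁻¹) := by
  obtain ⟨g, hg⟩ := conj_cen ht _ hy.isPGroup x hx
  exact ⟨g, hg (Subgroup.mem_zpowers y)⟩

theorem mem_of_primeparts [Finite G] (N : Subgroup G) : ∀ g : G,
    (∀ q n : ℕ, q.Prime → QEl q (g ^ n) → g ^ n ∈ N) → g ∈ N := by
  have key : ∀ (m : ℕ) (g : G), orderOf g = m → (∀ q n : ℕ, q.Prime → QEl q (g ^ n) → g ^ n ∈ N) → g ∈ N := by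
    intro m
    induction m using Nat.strong_induction_on with
    | _ m ih =>
      intro g hm h
      by_cases hm1 : m = 1
      · rw [hm1, orderOf_eq_one_iff] at hm
        rw [hm]; exact one_mem _
      obtain ⟨q, hq, hqm⟩ := Nat.exists_prime_and_dvd hm1
      have hm0 : m ≠ 0 := by rw [← hm]; exact (orderOf_pos g).ne'
      obtain ⟨k, c, hc, hkc⟩ := Nat.exists_eq_pow_mul_and_not_dvd hm0 q hq.ne_one
      have hco : Nat.Coprime (q ^ k) c := Nat.Coprime.pow_left _ ((Nat.Prime.coprime_iff_not_dvd hq).2 hc)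
      have hk : k ≠ 0 := by
        rintro rfl
        rw [pow_zero, one_mul] at hkc
        rw [hkc] at hqm; exact hc hqm
      have hc1 : g ^ c ∈ N := h q c hq ⟨k, by rw [← pow_mul, mul_comm, ← hkc, ← hm, pow_orderOf_eq_one]⟩
      refine pow_bezout hco ?_ hc1
      have hlt : orderOf (g ^ q ^ k) < m := by
        have hd : orderOf (g ^ q ^ k) ∣ c := by
          apply orderOf_dvd_of_pow_eq_one
          rw [← pow_mul, ← hkc, ← hm, pow_orderOf_eq_one]
        have hcpos : 0 < c := Nat.pos_of_ne_zero (by rintro rfl; simp at hkc; exact hm0 hkc)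
        have h1 := Nat.le_of_dvd hcpos hd
        have h2 : 1 < q ^ k := Nat.one_lt_pow hk hq.one_lt
        have h3 : c * 1 < c * q ^ k := (Nat.mul_lt_mul_left hcpos).2 h2
        rw [hkc, mul_comm]; omega
      refine ih _ hlt (g ^ q ^ k) rfl ?_
      intro r n hr hrn
      rw [← pow_mul] at hrn ⊢
      exact h r _ hr hrn
  exact fun g => key _ g rfl

theorem lift_qel {H : Type*} [Group H] [Finite G] (f : G →* H) {q : ℕ} (hq : q.Prime) (g : G) (h : QEl q (f g)) :
    ∃ m : ℕ, QEl q (g ^ m) ∧ f (g ^ m) = f g := by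
  obtain ⟨n, hn⟩ := h
  have hm0 : orderOf g ≠ 0 := (orderOf_pos g).ne'
  obtain ⟨k, c, hc, hkc⟩ := Nat.exists_eq_pow_mul_and_not_dvd hm0 q hq.ne_one
  have hco : Nat.Coprime c (q ^ n) := (Nat.Coprime.pow_left _ ((Nat.Prime.coprime_iff_not_dvd hq).2 hc)).symm
  obtain ⟨m, hm1, hm2⟩ := Nat.chineseRemainder hco 0 1
  refine ⟨m, ⟨k, ?_⟩, ?_⟩
  · obtain ⟨j, rfl⟩ := (Nat.modEq_zero_iff_dvd).1 hm1
    rw [← pow_mul]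
    have : c * j * q ^ k = orderOf g * j := by rw [hkc]; ring
    rw [this, pow_mul, pow_orderOf_eq_one, one_pow]
  · rw [map_pow]
    have h3 : orderOf (f g) ∣ q ^ n := orderOf_dvd_of_pow_eq_one hn
    have h4 : m ≡ 1 [MOD orderOf (f g)] := hm2.of_dvd h3
    simpa using pow_eq_pow_iff_modEq.2 h4

/-- if all `t`-elements of `D` are in `K`, then the `t`-part of `|D|` divides `|K|` -/
theorem tpart_dvd [Finite G] {t m : ℕ} (ht : t.Prime) (D K : Subgroup G) (hm : t ^ m ∣ Nat.card D)
    (h : ∀ y ∈ D, QEl t y → y ∈ K) : t ^ m ∣ Nat.card K := by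
  have := Fact.mk ht
  obtain ⟨T, hT⟩ := Sylow.exists_subgroup_card_pow_prime t hm
  have hp : IsPGroup t T := IsPGroup.of_card hT
  have h1 : T.map D.subtype ≤ K := by
    rintro _ ⟨y, hy, rfl⟩
    exact h _ y.2 ((QEl.of_isPGroup hp hy).map D.subtype)
  have h2 : Nat.card (T.map D.subtype) = t ^ m := by
    rw [← hT]
    exact Nat.card_congr (T.equivMapOfInjective _ D.subtype_injective).symm.toEquiv
  rw [← h2]
  exact Subgroup.card_dvd_of_le h1

theorem exists_qel_notMem [Finite G] {t : ℕ} (ht : t.Prime) (D : Subgroup G) (hm : t ∣ Nat.card D) :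
    ∃ y ∈ D, QEl t y ∧ y ≠ 1 := by
  by_contra hcon
  push Not at hcon
  have := tpart_dvd (m := 1) ht D ⊥ (by simpa using hm) (fun y hy hq => by rw [hcon y hy hq]; exact one_mem _)
  simp at this
  exact ht.one_lt.ne' this

theorem cop_factor [Finite G] (H K : Subgroup G) (hc : Nat.Coprime H.index K.index) (g : G) :
    ∃ h ∈ H, ∃ k ∈ K, g = h * k := by
  have h1 : H.relIndex K * K.index = (H ⊓ K).index := by
    rw [← Subgroup.inf_relIndex_right]
    exact Subgroup.relIndex_mul_index inf_le_right
  have h2 : K.relIndex H * H.index = (H ⊓ K).index := by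
    rw [← Subgroup.inf_relIndex_left]
    exact Subgroup.relIndex_mul_index inf_le_left
  have h3 : K.index ∣ K.relIndex H := by
    apply hc.symm.dvd_of_dvd_mul_right
    rw [h2, ← h1]; exact Dvd.intro_left _ rfl
  have h4 : K.index ≤ K.relIndex H := Nat.le_of_dvd (Nat.pos_of_ne_zero (relIndex_ne_zero_fin _ _)) h3
  have h5 : MulAction.stabilizer H (QuotientGroup.mk (1:G) : G ⧸ K) = K.subgroupOf H := by
    ext y
    rw [MulAction.mem_stabilizer_iff, Subgroup.mem_subgroupOf]
    have : y • (QuotientGroup.mk (1:G) : G ⧸ K) = QuotientGroup.mk ((y:G) * 1) := rfl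
    rw [this, eq_comm, QuotientGroup.eq]; simp
  have h6 := MulAction.index_stabilizer H (QuotientGroup.mk (1:G) : G ⧸ K)
  rw [h5] at h6
  have h7 : (MulAction.orbit H (QuotientGroup.mk (1:G) : G ⧸ K)) = Set.univ := by
    apply Set.eq_of_subset_of_ncard_le (Set.subset_univ _)
    rw [← h6, Set.ncard_univ]; exact h4
  have h8 : (QuotientGroup.mk g : G ⧸ K) ∈ (MulAction.orbit H (QuotientGroup.mk (1:G) : G ⧸ K)) := by
    rw [h7]; trivial
  obtain ⟨y, hy⟩ := h8
  have hy' : (QuotientGroup.mk ((y:G) * 1) : G ⧸ K) = QuotientGroup.mk g := hy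
  rw [QuotientGroup.eq, mul_one] at hy'
  exact ⟨y, y.2, _, hy', by simp⟩

end base


section base2
variable {G : Type*} [Group G]

/-- all elements of non prime power class size have equal class size -/
def HH1 (G : Type*) [Group G] : Prop := ∀ g h : G, ¬ PPc g → ¬ PPc h → clz g = clz h

theorem clz_dvd_of_le {g h : G} (h1 : cen h ≤ cen g) : clz g ∣ clz h := Subgroup.index_dvd_of_le h1

theorem clz_ne_zero [Finite G] (g : G) : clz g ≠ 0 := Subgroup.index_ne_zero_of_finite

theorem clz_card [Finite G] (g : G) : clz g * Nat.card (cen g) = Nat.card G := by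
  rw [mul_comm]; exact Subgroup.card_mul_index _

theorem cen_eq_of_le [Finite G] {g h : G} (h1 : cen h ≤ cen g) (h2 : clz g = clz h) : cen h = cen g := by
  refine le_antisymm h1 ?_
  have := Subgroup.relIndex_mul_index h1
  have h3 : (cen g).index = (cen h).index := h2
  rw [h3] at this
  have h4 : (cen h).relIndex (cen g) = 1 := by
    have h5 := clz_ne_zero h
    exact Nat.eq_of_mul_eq_mul_right (Nat.pos_of_ne_zero h5) (by rw [one_mul]; exact this)
  exact Subgroup.relIndex_eq_one.1 h4

theorem PPc_of_le {g h : G} (h1 : cen h ≤ cen g) (h2 : PPc h) : PPc g := by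
  obtain ⟨w, k, hw, hk⟩ := h2
  have := clz_dvd_of_le h1
  rw [hk] at this
  obtain ⟨i, -, hi⟩ := (Nat.dvd_prime_pow hw).1 this
  exact ⟨w, i, hw, hi⟩

theorem HH1.eq [Finite G] (H : HH1 G) {g h : G} (hg : ¬ PPc g) (h1 : cen h ≤ cen g) :
    ¬ PPc h ∧ cen h = cen g := by
  have h2 : ¬ PPc h := fun h2 => hg (PPc_of_le h1 h2)
  exact ⟨h2, cen_eq_of_le h1 (H _ _ hg h2)⟩

theorem clz_map_dvd {H : Type*} [Group H] (f : G →* H) (hf : Function.Surjective f) (g : G) :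
    clz (f g) ∣ clz g := by
  have h1 : (cen g).map f ≤ cen (f g) := by
    rintro _ ⟨y, hy, rfl⟩
    rw [mem_cen, ← map_mul, ← map_mul, mem_cen.1 hy]
  exact (Subgroup.index_dvd_of_le h1).trans (Subgroup.index_map_dvd _ hf)

theorem index_inf_cop [Finite G] (H K : Subgroup G) (hc : Nat.Coprime H.index K.index) :
    (H ⊓ K).index = H.index * K.index := by
  apply le_antisymm (Subgroup.index_inf_le)
  apply Nat.le_of_dvd (Nat.pos_of_ne_zero Subgroup.index_ne_zero_of_finite)
  exact hc.mul_dvd_of_dvd_of_dvd (Subgroup.index_dvd_of_le inf_le_left) (Subgroup.index_dvd_of_le inf_le_right)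

theorem exists_max_normal [Finite G] (p : Subgroup G → Prop) (h0 : p ⊥)
    (hs : ∀ M N : Subgroup G, M.Normal → N.Normal → p M → p N → p (M ⊔ N)) :
    ∃ L : Subgroup G, L.Normal ∧ p L ∧ ∀ N : Subgroup G, N.Normal → p N → N ≤ L := by
  obtain ⟨L, hL⟩ := Set.Finite.exists_maximal (Set.toFinite {N : Subgroup G | N.Normal ∧ p N}) ⟨⊥, inferInstance, h0⟩
  refine ⟨L, hL.1.1, hL.1.2, fun N hN hp => ?_⟩
  have hLn := hL.1.1
  have : L ⊔ N ∈ {N : Subgroup G | N.Normal ∧ p N} := ⟨inferInstance, hs _ _ hLn hN hL.1.2 hp⟩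
  exact le_sup_right.trans (hL.2 this le_sup_left)

theorem exists_OQ [Finite G] (q : ℕ) : ∃ O : Subgroup G, O.Normal ∧ IsPGroup q O ∧
    ∀ N : Subgroup G, N.Normal → IsPGroup q N → N ≤ O :=
  exists_max_normal (fun N => IsPGroup q N) IsPGroup.of_bot
    (fun _ _ _ _ hM hN => IsPGroup.to_sup_of_normal_right hM hN)

theorem card_sup_dvd [Finite G] (M N : Subgroup G) [N.Normal] : Nat.card (M ⊔ N : Subgroup G) ∣ Nat.card M * Nat.card N := by
  have h1 := Subgroup.card_mul_index (N.subgroupOf (M ⊔ N))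
  have h2 : Nat.card (N.subgroupOf (M ⊔ N)) = Nat.card N :=
    Nat.card_congr (Subgroup.subgroupOfEquivOfLe le_sup_right).toEquiv
  have h3 : (N.subgroupOf (M ⊔ N)).index = N.relIndex M := by
    have : (N.subgroupOf (M ⊔ N)).index = N.relIndex (M ⊔ N) := rfl
    rw [this, Subgroup.relIndex_sup_right]
  rw [← h1, h2, h3, mul_comm]
  exact mul_dvd_mul (Subgroup.relIndex_dvd_card _ _) dvd_rfl

theorem exists_OQ' [Finite G] {q : ℕ} (hq : q.Prime) : ∃ O : Subgroup G, O.Normal ∧ ¬ q ∣ Nat.card O ∧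
    ∀ N : Subgroup G, N.Normal → ¬ q ∣ Nat.card N → N ≤ O := by
  refine exists_max_normal (fun N => ¬ q ∣ Nat.card N) (by simpa using hq.one_lt.ne') ?_
  intro M N _ _ hM hN h
  rcases (Nat.Prime.dvd_mul hq).1 (h.trans (card_sup_dvd M N)) with h | h
  exacts [hM h, hN h]

theorem solvable_of_map {H : Type*} [Group H] (f : G →* H) (M N : Subgroup G) (hM : Group.IsSolvable (M.map f))
    (hN : Group.IsSolvable N) (hk : ∀ m ∈ M, f m = 1 → m ∈ N) : Group.IsSolvable M := by
  have h1 : Group.IsSolvable (N ⊓ M : Subgroup G) :=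
    Group.isSolvable_of_isSolvable_injective (Subgroup.inclusion_injective (inf_le_left : N ⊓ M ≤ N))
  refine Group.isSolvable_of_ker_le_range (G' := (N ⊓ M : Subgroup G)) (G'' := M.map f)
    (Subgroup.inclusion inf_le_right) (f.subgroupMap M) ?_
  rintro ⟨m, hm⟩ hmk
  have : f m = 1 := by
    have := congrArg Subtype.val (MonoidHom.mem_ker.1 hmk)
    simpa using this
  exact ⟨⟨m, hk m hm this, hm⟩, rfl⟩

theorem exists_rad [Finite G] : ∃ R : Subgroup G, R.Normal ∧ Group.IsSolvable R ∧
    ∀ N : Subgroup G, N.Normal → Group.IsSolvable N → N ≤ R := by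
  refine exists_max_normal (fun N => Group.IsSolvable N) inferInstance ?_
  intro M N _ hNn hM hN
  refine solvable_of_map (QuotientGroup.mk' N) (M ⊔ N) N ?_ hN ?_
  · rw [Subgroup.map_sup]
    have : Subgroup.map (QuotientGroup.mk' N) N = ⊥ := by
      rw [Subgroup.map_eq_bot_iff]; simp
    rw [this, sup_bot_eq]
    exact Group.isSolvable_of_surjective ((QuotientGroup.mk' N).subgroupMap_surjective M)
  · intro m _ h
    simpa using h

/-- Lemma S -/
theorem lemS [Finite G] : ∀ (n : ℕ) (M : Subgroup G), Nat.card M ≤ n → M.Normal → Group.IsSolvable M →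
    (∀ N : Subgroup G, N.Normal → Group.IsNilpotent N → ⁅N, M⁆ = ⊥) → Group.IsNilpotent M := by
  intro n
  induction n with
  | zero =>
    intro M h
    have := Nat.card_pos (α := M)
    omega
  | succ n ih =>
    intro M hc hM hs hcen
    by_cases hbot : M = ⊥
    · subst hbot; infer_instance
    have hlt : ⁅M, M⁆ < M := by
      refine lt_of_le_of_ne M.commutator_le_self ?_
      intro h
      have h0 : Nontrivial M := (Subgroup.nontrivial_iff_ne_bot M).2 hbot
      have h1 := Group.IsSolvable.commutator_lt_top_of_nontrivial M
      have h2 := M.map_subtype_commutator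
      rw [h] at h2
      apply h1.ne
      apply Subgroup.map_injective M.subtype_injective
      rw [h2, ← MonoidHom.range_eq_map, M.range_subtype]
    have hs' : Group.IsSolvable (⁅M, M⁆ : Subgroup G) :=
      Group.isSolvable_of_isSolvable_injective (Subgroup.inclusion_injective hlt.le)
    have hcard : Nat.card (⁅M, M⁆ : Subgroup G) < Nat.card M := by
      by_contra hcon
      exact hlt.ne (Subgroup.eq_of_le_of_card_ge hlt.le (not_lt.1 hcon))
    have h1 := ih ⁅M, M⁆ (by omega) inferInstance hs' (fun N hN hn => by
      have h2 := hcen N hN hn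
      have h3 := Subgroup.commutator_mono (le_refl N) hlt.le
      rw [h2] at h3
      exact le_bot_iff.1 h3)
    have h4 := hcen _ inferInstance h1
    exact Subgroup.isNilpotent_of_lowerCentralSeries_eq_bot (S := M) (n := 2) h4

theorem OQ_of_sylow [Finite G] {q c : ℕ} (hq : q.Prime) {x : G} (hx : QEl q x) (hc : clz x = q ^ c) :
    ∃ N : Subgroup G, N.Normal ∧ IsPGroup q N ∧ x ∈ N := by
  have := Fact.mk hq
  obtain ⟨W, hW⟩ := hx.isPGroup.exists_le_sylow
  refine ⟨Subgroup.normalClosure {x}, inferInstance, ?_, Subgroup.subset_normalClosure rfl⟩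
  refine W.2.to_le ?_
  rw [Subgroup.normalClosure, Subgroup.closure_le]
  intro y hy
  rw [Group.mem_conjugatesOfSet_iff] at hy
  obtain ⟨a, ha, hay⟩ := hy
  rw [Set.mem_singleton_iff] at ha
  subst ha
  obtain ⟨g, rfl⟩ := isConj_iff.1 hay
  have hxW : a ∈ (W : Subgroup G) := hW (Subgroup.mem_zpowers a)
  have hco : Nat.Coprime (W : Subgroup G).index (cen a).index := by
    have h1 : (cen a).index = q ^ c := hc
    rw [h1]
    exact (Nat.Coprime.pow_left _ ((Nat.Prime.coprime_iff_not_dvd hq).2 W.not_dvd_index)).symm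
  obtain ⟨w, hw, k, hk, rfl⟩ := cop_factor (W : Subgroup G) (cen a) hco g
  have : w * k * a * (w * k)⁻¹ = w * a * w⁻¹ := by
    have := mem_cen.1 hk
    rw [mul_assoc w k a, this]; group
  rw [this]
  exact mul_mem (mul_mem hw hxW) (inv_mem hw)

theorem CQ [Finite G] {q c : ℕ} (hq : q.Prime) {x : G} (hc : clz x ∣ q ^ c) (M : Subgroup G) [M.Normal]
    (hM : ¬ q ∣ Nat.card M) : M ≤ cen x := by
  rw [← Subgroup.relIndex_eq_one]
  have h1 : (cen x).relIndex M ∣ q ^ c := (index_normal_dvd _ _).trans hc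
  have h2 : (cen x).relIndex M ∣ Nat.card M := Subgroup.relIndex_dvd_card _ _
  have h3 : Nat.Coprime (q ^ c) (Nat.card M) := Nat.Coprime.pow_left _ ((Nat.Prime.coprime_iff_not_dvd hq).2 hM)
  exact Nat.eq_one_of_dvd_coprimes h3 h1 h2

theorem nil_sylow [Finite G] {q : ℕ} (hq : q.Prime) (N : Subgroup G) [hN : N.Normal] (hn : Group.IsNilpotent N) :
    ∃ P : Subgroup G, P.Normal ∧ IsPGroup q P ∧ P ≤ N ∧ (∀ y ∈ N, QEl q y → y ∈ P) := by
  have := Fact.mk hq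
  obtain ⟨P⟩ : Nonempty (Sylow q N) := inferInstance
  have hPn : (P : Subgroup N).Normal := inferInstance
  have hch : (P : Subgroup N).Characteristic := P.characteristic_of_normal hPn
  refine ⟨(P : Subgroup N).map N.subtype, ConjAct.normal_of_characteristic_of_normal, P.2.map _, ?_, ?_⟩
  · rintro _ ⟨y, _, rfl⟩; exact y.2
  · intro y hy hyq
    have h1 : QEl q (⟨y, hy⟩ : N) := by
      obtain ⟨k, hk⟩ := hyq
      exact ⟨k, by ext; simpa using hk⟩
    have h2 : Subgroup.zpowers (⟨y, hy⟩ : N) ≤ P := by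
      obtain ⟨Q, hQ⟩ := h1.isPGroup.exists_le_sylow
      have : Subsingleton (Sylow q N) := (Sylow.unique_of_normal P hPn).instSubsingleton
      rwa [Subsingleton.elim P Q]
    exact ⟨⟨y, hy⟩, h2 (Subgroup.mem_zpowers _), rfl⟩

end base2


section base3
open scoped commutatorElement
variable {G : Type*} [Group G]

theorem nil_central [Group.IsNilpotent G] (P T : Subgroup G) [P.Normal] (hPT : ¬ P ≤ T) :
    ∃ z ∈ P, z ∉ T ∧ ∀ w : G, ⁅z, w⁆ ∈ T := by
  classical
  obtain ⟨n, hn⟩ := Subgroup.nilpotent_iff_lowerCentralSeries.1 (inferInstance : Group.IsNilpotent G)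
  have hex : ∃ n, P ⊓ (⊤ : Subgroup G).lowerCentralSeries n ≤ T := ⟨n, by rw [hn]; simp⟩
  obtain ⟨i, hi⟩ : ∃ i, Nat.find hex = i := ⟨_, rfl⟩
  have h1 := Nat.find_spec hex
  rw [hi] at h1
  cases i with
  | zero =>
    exfalso; apply hPT
    simpa using h1
  | succ i =>
    have h2 := Nat.find_min hex (m := i) (by omega)
    rw [SetLike.le_def] at h2
    push Not at h2
    obtain ⟨z, hz, hzT⟩ := h2
    refine ⟨z, hz.1, hzT, fun w => h1 ⟨?_, ?_⟩⟩
    · rw [commutatorElement_def]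
      have := (inferInstance : P.Normal).conj_mem _ (inv_mem hz.1) w
      have h3 := mul_mem hz.1 this
      simpa [mul_assoc] using h3
    · rw [Subgroup.lowerCentralSeries_succ]
      exact Subgroup.commutator_mem_commutator hz.2 (Subgroup.mem_top w)

theorem pgroup_cover [Finite G] [Group.IsNilpotent G] (P D : Subgroup G) [P.Normal] (hDP : D ≤ P) (hne : D ≠ P) :
    ∃ u ∈ P, ∀ w : G, w * u * w⁻¹ ∉ D := by
  obtain ⟨T, hT⟩ := Set.Finite.exists_maximal
    (Set.toFinite {N : Subgroup G | N.Normal ∧ N ≤ P ∧ N ⊔ D ≠ P}) ⟨⊥, inferInstance, bot_le, by simpa using hne⟩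
  obtain ⟨⟨hTn, hTP, hTD⟩, hmax⟩ := hT
  have hnot : ¬ P ≤ T := by
    intro h
    apply hTD
    exact le_antisymm (sup_le hTP hDP) (h.trans le_sup_left)
  obtain ⟨z, hzP, hzT, hz⟩ := nil_central P T hnot
  refine ⟨z, hzP, fun w hw => ?_⟩
  have hzn : (T ⊔ Subgroup.zpowers z).Normal := by
    have h1 : (Subgroup.zpowers (QuotientGroup.mk' T z)).Normal := by
      suffices hcz : Subgroup.zpowers (QuotientGroup.mk' T z) ≤ Subgroup.center (G ⧸ T) by
        refine ⟨fun n hn g => ?_⟩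
        rw [Subgroup.mem_center_iff.1 (hcz hn) g, mul_inv_cancel_right]
        exact hn
      rw [Subgroup.zpowers_le, Subgroup.mem_center_iff]
      intro g
      obtain ⟨g, rfl⟩ := QuotientGroup.mk'_surjective T g
      rw [← map_mul, ← map_mul]
      apply Eq.symm
      rw [QuotientGroup.mk'_apply, QuotientGroup.mk'_apply, QuotientGroup.eq]
      have h2 := hTn.conj_mem _ (hz g) (g⁻¹ * z⁻¹)
      have h3 := inv_mem h2
      rw [commutatorElement_def] at h3
      have e : (g⁻¹ * z⁻¹ * (z * g * z⁻¹ * g⁻¹) * (g⁻¹ * z⁻¹)⁻¹)⁻¹ = (z * g)⁻¹ * (g * z) * 1 := by group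
      have e2 : (z * g)⁻¹ * (g * z) = (g⁻¹ * z⁻¹ * (z * g * z⁻¹ * g⁻¹)⁻¹ * (g⁻¹ * z⁻¹)⁻¹) := by group
      rw [e2]
      exact hTn.conj_mem _ (inv_mem (hz g)) _
    have h2 := h1.comap (QuotientGroup.mk' T)
    rw [← MonoidHom.map_zpowers, Subgroup.comap_map_eq, QuotientGroup.ker_mk', sup_comm] at h2
    exact h2
  have hmem : T ⊔ Subgroup.zpowers z ∈ {N : Subgroup G | N.Normal ∧ N ≤ P ∧ N ⊔ D ≠ P} := by
    refine ⟨hzn, sup_le hTP (by simpa using hzP), ?_⟩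
    have hzTD : z ∈ T ⊔ D := by
      have h1 : ⁅z, w⁆ ∈ T := hz w
      have h2 : z = ⁅z, w⁆ * (w * z * w⁻¹) := by rw [commutatorElement_def]; group
      rw [h2]
      exact mul_mem (Subgroup.mem_sup_left h1) (Subgroup.mem_sup_right hw)
    have : T ⊔ Subgroup.zpowers z ⊔ D = T ⊔ D := by
      apply le_antisymm
      · exact sup_le (sup_le le_sup_left (by simpa using hzTD)) le_sup_right
      · exact sup_le (le_sup_left.trans le_sup_left) le_sup_right
    rw [this]; exact hTD
  have := hmax hmem le_sup_left
  exact hzT (this (Subgroup.mem_sup_right (Subgroup.mem_zpowers z)))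

/-- minimal normal, abstract version -/
theorem BEa {Q : Type*} [Group Q] [Finite G] (φ : Q →* MulAut G)
    (hinn : ∀ t : G, ∃ a, ∀ y, φ a y = t * y * t⁻¹)
    (hmin : ∀ L : Subgroup G, (∀ a, ∀ y ∈ L, φ a y ∈ L) → L = ⊥ ∨ L = ⊤)
    (hna : ¬ ∀ a b : G, a * b = b * a) (v : G) (hv : v ≠ 1) : ¬ PPc v := by
  rintro ⟨w, k, hw, hk⟩
  have hnorm : ∀ L : Subgroup G, (∀ a, ∀ y ∈ L, φ a y ∈ L) → L.Normal := by
    intro L hL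
    refine ⟨fun y hy t => ?_⟩
    obtain ⟨a, ha⟩ := hinn t
    rw [← ha]; exact hL a y hy
  have hZ : Subgroup.center G = ⊥ := by
    rcases hmin (Subgroup.center G) (fun a y hy => by
      rw [Subgroup.mem_center_iff] at *
      intro g
      obtain ⟨g, rfl⟩ := (φ a).surjective g
      rw [← map_mul, ← map_mul, hy]) with h | h
    · exact h
    · exfalso; apply hna
      intro a b
      have : b ∈ Subgroup.center G := by rw [h]; trivial
      exact Subgroup.mem_center_iff.1 this a
  have hG1 : (⊤ : Subgroup G) ≠ ⊥ := by
    intro h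
    have : v ∈ (⊤ : Subgroup G) := trivial
    rw [h] at this
    exact hv (Subgroup.mem_bot.1 this)
  obtain ⟨S, ⟨hSn, hS0⟩, hSm⟩ := Set.Finite.exists_minimal
    (Set.toFinite {N : Subgroup G | N.Normal ∧ N ≠ ⊥}) ⟨⊤, inferInstance, hG1⟩
  have hSmin : ∀ L : Subgroup G, L.Normal → L ≤ S → L ≠ ⊥ → L = S := fun L h1 h2 h3 =>
    le_antisymm h2 (hSm ⟨h1, h3⟩ h2)
  have hSC : ¬ (⊤ : Subgroup G) ≤ Subgroup.centralizer (S : Set G) := by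
    intro h
    have : S ≤ Subgroup.center G := by
      intro s hs
      rw [Subgroup.mem_center_iff]
      intro g
      exact ((Subgroup.mem_centralizer_iff.1 (h (Subgroup.mem_top g))) s hs).symm
    rw [hZ] at this
    exact hS0 (le_bot_iff.1 this)
  obtain ⟨a, ha⟩ : ∃ a, φ a v ∉ Subgroup.centralizer (S : Set G) := by
    by_contra hcon
    push Not at hcon
    rcases hmin (⨅ a, (Subgroup.centralizer (S : Set G)).comap (φ a).toMonoidHom) (fun b y hy => by
      rw [Subgroup.mem_iInf] at *
      intro a
      have := hy (a * b)
      rw [Subgroup.mem_comap] at *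
      simpa using this) with h | h
    · apply hv
      rw [← Subgroup.mem_bot, ← h, Subgroup.mem_iInf]
      exact hcon
    · apply hSC
      intro g hg
      rw [← h, Subgroup.mem_iInf] at hg
      simpa using hg 1
  have hsup : S ⊔ Subgroup.centralizer (S : Set G) = ⊤ := by
    rcases hmin (⨆ a, S.map (φ a).toMonoidHom) (fun b => by
      have : (⨆ a, S.map (φ a).toMonoidHom) ≤ (⨆ a, S.map (φ a).toMonoidHom).comap (φ b).toMonoidHom := by
        refine iSup_le fun a => ?_
        rw [← Subgroup.map_le_iff_le_comap, Subgroup.map_map]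
        refine le_trans ?_ (le_iSup _ (b * a))
        rw [map_mul]; exact le_rfl
      exact fun y hy => this hy) with h | h
    · exfalso; apply hS0
      rw [← le_bot_iff, ← h]
      refine le_trans ?_ (le_iSup _ 1)
      intro s hs; exact ⟨s, hs, by simp⟩
    · rw [eq_top_iff, ← h]
      refine iSup_le fun a => ?_
      have hSa : (S.map (φ a).toMonoidHom).Normal := hSn.map _ (φ a).surjective
      by_cases hd : S ⊓ S.map (φ a).toMonoidHom = ⊥
      · refine le_trans ?_ le_sup_right
        rw [← Subgroup.commutator_eq_bot_iff_le_centralizer]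
        exact Subgroup.commutator_eq_bot_of_disjoint (disjoint_iff.2 ((inf_comm _ _).trans hd))
      · refine le_trans ?_ le_sup_left
        have h1 := hSmin _ inferInstance inf_le_left hd
        have h2 : S ≤ S.map (φ a).toMonoidHom := inf_eq_left.1 h1
        have h3 : S = S.map (φ a).toMonoidHom := by
          apply Subgroup.eq_of_le_of_card_ge h2
          exact Nat.card_le_card_of_surjective ((φ a).toMonoidHom.subgroupMap S)
            ((φ a).toMonoidHom.subgroupMap_surjective S)
        exact h3.symm.le
  have hSnt : Nontrivial S := (Subgroup.nontrivial_iff_ne_bot S).2 hS0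
  have hSs : IsSimpleGroup S := by
    refine ⟨fun N hN => ?_⟩
    have hN' : (N.map S.subtype).Normal := by
      rw [← Subgroup.normalizer_eq_top_iff, eq_top_iff, ← hsup]
      refine sup_le ?_ ?_
      · intro s hs
        rw [Subgroup.mem_normalizer_iff]
        have key : ∀ s ∈ S, ∀ y ∈ N.map S.subtype, s * y * s⁻¹ ∈ N.map S.subtype := by
          rintro s hs _ ⟨y, hy, rfl⟩
          exact ⟨⟨s, hs⟩ * y * ⟨s, hs⟩⁻¹, hN.conj_mem _ hy _, by simp⟩
        intro y
        refine ⟨key s hs y, fun h => ?_⟩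
        have := key s⁻¹ (inv_mem hs) _ h
        simpa [mul_assoc] using this
      · intro c hc
        have key : ∀ y ∈ S, c * y * c⁻¹ = y := by
          intro y hy
          rw [← (Subgroup.mem_centralizer_iff.1 hc) y hy]; group
        rw [Subgroup.mem_normalizer_iff]
        intro y
        constructor
        · rintro ⟨y, hy, rfl⟩
          rw [key (S.subtype y) y.2]; exact ⟨y, hy, rfl⟩
        · rintro ⟨z, hz, hzy⟩
          have h1 : y = c⁻¹ * (c * y * c⁻¹) * c := by group
          have h2 : y = z := by
            rw [h1, ← hzy]
            have := key z z.2
            rw [mul_inv_eq_iff_eq_mul] at this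
            rw [mul_assoc, inv_mul_eq_iff_eq_mul]; exact this.symm
          rw [h2]; exact ⟨z, hz, rfl⟩
    by_cases hN0 : N = ⊥
    · exact Or.inl hN0
    · right
      have h1 := hSmin _ hN' (by rintro _ ⟨y, _, rfl⟩; exact y.2) (by
        intro h; apply hN0
        apply Subgroup.map_injective S.subtype_injective
        rw [h]; simp)
      apply Subgroup.map_injective S.subtype_injective
      rw [h1, ← MonoidHom.range_eq_map, S.range_subtype]
  have hclz : clz (φ a v) = w ^ k := by
    rw [← hk]
    have : cen (φ a v) = (cen v).map (φ a).toMonoidHom := by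
      ext y
      obtain ⟨y, rfl⟩ := (φ a).surjective y
      rw [mem_cen, ← map_mul, ← map_mul, Subgroup.mem_map]
      constructor
      · intro h; exact ⟨y, mem_cen.2 ((φ a).injective h), rfl⟩
      · rintro ⟨z, hz, hzy⟩
        have : z = y := (φ a).injective hzy
        rw [← this, mem_cen.1 hz]
    rw [clz, this, clz]
    exact Subgroup.index_map_equiv (cen v) (φ a)
  have hv' : φ a v ∈ S ⊔ Subgroup.centralizer (S : Set G) := by rw [hsup]; trivial
  obtain ⟨s, hs, c, hc, hsc⟩ := Subgroup.mem_sup_of_normal_left.1 hv'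
  have hs1 : (⟨s, hs⟩ : S) ≠ 1 := by
    intro h
    have : s = 1 := congrArg Subtype.val h
    rw [this, one_mul] at hsc
    rw [← hsc] at ha
    exact ha hc
  have hcs : (Subgroup.centralizer {(⟨s, hs⟩ : S)} : Subgroup S) = (cen (φ a v)).subgroupOf S := by
    ext ⟨y, hy⟩
    have h0 : c * y = y * c := ((Subgroup.mem_centralizer_iff.1 hc) y hy).symm
    have h1 : (⟨y, hy⟩ : S) ∈ Subgroup.centralizer {(⟨s, hs⟩ : S)} ↔ y * s = s * y := by
      have := @mem_cen S _ ⟨s, hs⟩ ⟨y, hy⟩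
      rw [cen] at this
      rw [this, Subtype.ext_iff]; rfl
    rw [h1, Subgroup.mem_subgroupOf, mem_cen, ← hsc]
    simp only
    rw [mul_assoc s c y, h0, ← mul_assoc, ← mul_assoc]
    exact mul_left_inj c |>.symm
  have hdvd : (Subgroup.centralizer {(⟨s, hs⟩ : S)} : Subgroup S).index ∣ w ^ k := by
    rw [hcs, ← hclz]
    exact index_normal_dvd _ _
  obtain ⟨j, -, hj⟩ := (Nat.dvd_prime_pow hw).1 hdvd
  have hcomm := burnside_simple S ⟨s, hs⟩ hs1 w j hw hj
  apply hSC
  rw [← hsup]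
  refine sup_le ?_ le_rfl
  intro y hy
  rw [Subgroup.mem_centralizer_iff]
  intro z hz
  exact congrArg Subtype.val (hcomm ⟨z, hz⟩ ⟨y, hy⟩)

theorem BE [Finite G] (E : Subgroup G) [hE : E.Normal] (hmin : ∀ L : Subgroup G, L.Normal → L ≤ E → L = ⊥ ∨ L = E)
    (hna : ¬ ∀ a ∈ E, ∀ b ∈ E, a * b = b * a) (v : G) (hvE : v ∈ E) (hv : v ≠ 1) :
    ¬ ∃ w k, w.Prime ∧ (cen v).relIndex E = w ^ k := by
  have h := BEa (G := E) (Q := G) MulAut.conjNormal (fun t => ⟨t, fun y => by ext; simp⟩) (fun L hL => by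
    have hLn : (L.map E.subtype).Normal := by
      refine ⟨?_⟩
      rintro _ ⟨y, hy, rfl⟩ g
      exact ⟨_, hL g y hy, by simp⟩
    rcases hmin (L.map E.subtype) hLn (by rintro _ ⟨y, _, rfl⟩; exact y.2) with h | h
    · left
      apply Subgroup.map_injective E.subtype_injective
      rw [h]; simp
    · right
      apply Subgroup.map_injective E.subtype_injective
      rw [h, ← MonoidHom.range_eq_map, E.range_subtype]) (fun h => hna (fun a ha b hb =>
        congrArg Subtype.val (h ⟨a, ha⟩ ⟨b, hb⟩))) ⟨v, hvE⟩ (fun h => hv (congrArg Subtype.val h))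
  rintro ⟨w, k, hw, hk⟩
  apply h
  refine ⟨w, k, hw, ?_⟩
  rw [← hk]
  have : cen (⟨v, hvE⟩ : E) = (cen v).subgroupOf E := by
    ext ⟨y, hy⟩
    rw [mem_cen, Subgroup.mem_subgroupOf, mem_cen, Subtype.ext_iff]; rfl
  rw [clz, this]; rfl

end base3


section K
variable {G : Type*} [Group G]
open scoped commutatorElement

theorem U_lemma [Finite G] {q c : ℕ} (hq : q.Prime) (E : Subgroup G) [E.Normal] (x : G) (hc : clz x ∣ q ^ c)
    (hE : ¬ E ≤ cen x) : ∃ u ∈ E, QEl q u ∧ ∀ g : G, g * u * g⁻¹ ∉ cen x := by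
  have := Fact.mk hq
  obtain ⟨W⟩ : Nonempty (Sylow q G) := inferInstance
  have hWE : ¬ (W : Subgroup G) ⊓ E ≤ cen x := by
    intro h
    apply hE
    rw [← Subgroup.relIndex_eq_one]
    have h1 : (cen x).relIndex E ∣ q ^ c := (index_normal_dvd _ _).trans hc
    have h2 : (cen x).relIndex E ∣ (W : Subgroup G).index := by
      refine dvd_trans ?_ (index_normal_dvd (W : Subgroup G) E)
      rw [← Subgroup.inf_relIndex_right (W : Subgroup G) E]
      exact Subgroup.relIndex_dvd_of_le_left _ h
    have h3 : Nat.Coprime (q ^ c) (W : Subgroup G).index :=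
      Nat.Coprime.pow_left _ ((Nat.Prime.coprime_iff_not_dvd hq).2 W.not_dvd_index)
    exact Nat.eq_one_of_dvd_coprimes h3 h1 h2
  have hnil : Group.IsNilpotent (W : Subgroup G) := IsPGroup.isNilpotent W.2
  obtain ⟨⟨u, huW⟩, hu1, hu2⟩ := pgroup_cover (G := (W : Subgroup G)) (E.subgroupOf W) ((cen x ⊓ E).subgroupOf W)
    (by intro y hy; rw [Subgroup.mem_subgroupOf] at *; exact hy.2)
    (by
      intro h
      apply hWE
      rintro y ⟨hy, hyE⟩
      have : (⟨y, hy⟩ : (W : Subgroup G)) ∈ E.subgroupOf W := hyE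
      rw [← h] at this
      exact this.1)
  have huE : u ∈ E := hu1
  refine ⟨u, huE, QEl.of_isPGroup W.2 huW, fun g hg => ?_⟩
  have hco : Nat.Coprime (cen x).index (W : Subgroup G).index :=
    Nat.Coprime.coprime_dvd_left hc
      (Nat.Coprime.pow_left _ ((Nat.Prime.coprime_iff_not_dvd hq).2 W.not_dvd_index))
  obtain ⟨k, hk, w, hw, rfl⟩ := cop_factor (cen x) (W : Subgroup G) hco g
  apply hu2 ⟨w, hw⟩
  rw [Subgroup.mem_subgroupOf]
  refine ⟨?_, (inferInstance : E.Normal).conj_mem _ huE _⟩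
  have h1 := (cen x).mul_mem ((cen x).mul_mem ((cen x).inv_mem hk) hg) hk
  have h2 : k⁻¹ * (k * w * u * (k * w)⁻¹) * k = w * u * w⁻¹ := by group
  rw [h2] at h1
  exact h1

theorem third_prime [Finite G] (E : Subgroup G) {q s : ℕ} (hq : q.Prime) (hs : s.Prime) (hE : E ≠ ⊥)
    (hBE : ∀ v ∈ E, v ≠ 1 → ¬ ∃ w k, w.Prime ∧ (cen v).relIndex E = w ^ k) :
    ∃ t, t.Prime ∧ t ≠ q ∧ t ≠ s ∧ t ∣ Nat.card E := by
  have := Fact.mk hs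
  by_contra hcon
  push Not at hcon
  have hv : ∃ v ∈ E, v ≠ 1 ∧ ¬ s ∣ (cen v).relIndex E := by
    obtain ⟨P⟩ : Nonempty (Sylow s E) := inferInstance
    by_cases hs : s ∣ Nat.card E
    · have hP : Nontrivial P := by
        have := P.ne_bot_of_dvd_card hs
        exact (Subgroup.nontrivial_iff_ne_bot _).2 this
      have hZ := P.2.center_nontrivial
      obtain ⟨z, hz⟩ := exists_ne (1 : Subgroup.center P)
      refine ⟨((z : P) : E), ((z : P) : E).2, ?_, ?_⟩
      · intro h
        apply hz
        ext
        simpa using h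
      · intro h
        apply P.not_dvd_index
        refine h.trans ?_
        apply Subgroup.index_dvd_of_le
        intro y hy
        rw [Subgroup.mem_subgroupOf, mem_cen]
        have := Subgroup.mem_center_iff.1 z.2 ⟨y, hy⟩
        exact congrArg (fun a : P => ((a : E) : G)) this
    · obtain ⟨v, hv1⟩ := Subgroup.ne_bot_iff_exists_ne_one.1 hE
      exact ⟨v, v.2, fun h => hv1 (Subtype.ext h), fun h => hs (h.trans (Subgroup.relIndex_dvd_card _ _))⟩
  obtain ⟨v, hvE, hv1, hvs⟩ := hv
  apply hBE v hvE hv1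
  refine ⟨q, _, hq, Nat.eq_prime_pow_of_unique_prime_dvd (relIndex_ne_zero_fin _ _) ?_⟩
  intro d hd hdv
  by_contra hdq
  refine hcon d hd hdq ?_ (hdv.trans (Subgroup.relIndex_dvd_card _ _))
  rintro rfl
  exact hvs hdv

/-- `x` of `q`-power class size centralizes all normal nilpotent subgroups modulo `O_q` -/
theorem cent_nil [Finite G] {q c : ℕ} (hq : q.Prime) {x : G} (hc : clz x = q ^ c) (O : Subgroup G) [hO : O.Normal]
    (hOp : IsPGroup q O) (hOm : ∀ N : Subgroup G, N.Normal → IsPGroup q N → N ≤ O)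
    (N : Subgroup (G ⧸ O)) [hN : N.Normal] (hn : Group.IsNilpotent N) :
    ⁅N, (Subgroup.normalClosure {x}).map (QuotientGroup.mk' O)⁆ = ⊥ := by
  have hNq : ¬ q ∣ Nat.card N := by
    intro hd
    obtain ⟨y, hy, hyq, hy1⟩ := exists_qel_notMem hq N hd
    obtain ⟨P, hPn, hPp, -, hP⟩ := nil_sylow hq N hn
    have h1 := hOm (P.comap (QuotientGroup.mk' O)) inferInstance
      (hPp.comap_of_ker_isPGroup _ (by rw [QuotientGroup.ker_mk']; exact hOp))
    obtain ⟨y, rfl⟩ := QuotientGroup.mk'_surjective O y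
    apply hy1
    have h2 : y ∈ O := h1 (hP _ hy hyq)
    simpa using h2
  have h1 : N ≤ cen (QuotientGroup.mk' O x) := CQ (c := c) hq
    (by rw [← hc]; exact clz_map_dvd _ (QuotientGroup.mk'_surjective O) x) N hNq
  rw [Subgroup.commutator_comm, Subgroup.commutator_eq_bot_iff_le_centralizer, Subgroup.map_le_iff_le_comap]
  apply Subgroup.normalClosure_le_normal
  rintro y rfl
  show _ ∈ Subgroup.centralizer _
  rw [Subgroup.mem_centralizer_iff]
  intro n hn'
  exact mem_cen.1 (h1 hn')

theorem V_lemma [Finite G] {q c : ℕ} (hq : q.Prime) {x : G} (hc : clz x = q ^ c) (O : Subgroup G) [hO : O.Normal]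
    (hOp : IsPGroup q O) (hOm : ∀ N : Subgroup G, N.Normal → IsPGroup q N → N ≤ O)
    (R Y C : Subgroup G) [R.Normal] [Y.Normal] (hR : Group.IsSolvable R)
    (hYX : Y ≤ Subgroup.normalClosure {x}) (hYC : ⁅C, Y⁆ ≤ R) : ⁅⁅Y, Y⁆, C⁆ ≤ O := by
  have hX := fun N hN hn => cent_nil hq hc O hOp hOm N (hN := hN) hn
  have hYs : Group.IsSolvable ((Y ⊓ R).map (QuotientGroup.mk' O)) := by
    have : Group.IsSolvable (Y ⊓ R : Subgroup G) :=
      Group.isSolvable_of_isSolvable_injective (Subgroup.inclusion_injective inf_le_right)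
    exact Group.isSolvable_of_surjective ((QuotientGroup.mk' O).subgroupMap_surjective _)
  have hYn : ((Y ⊓ R).map (QuotientGroup.mk' O)).Normal :=
    Subgroup.Normal.map inferInstance _ (QuotientGroup.mk'_surjective O)
  have hnil : Group.IsNilpotent ((Y ⊓ R).map (QuotientGroup.mk' O)) := by
    refine lemS _ _ le_rfl hYn hYs (fun N hN hn => ?_)
    rw [← le_bot_iff, ← hX N hN hn]
    exact Subgroup.commutator_mono le_rfl (Subgroup.map_mono (inf_le_left.trans hYX))
  have h1 := hX _ hYn hnil
  have h2 : ⁅⁅C.map (QuotientGroup.mk' O), Y.map (QuotientGroup.mk' O)⁆, Y.map (QuotientGroup.mk' O)⁆ = ⊥ := by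
    rw [← le_bot_iff, ← h1]
    refine Subgroup.commutator_mono ?_ (Subgroup.map_mono hYX)
    rw [← Subgroup.map_commutator]
    exact Subgroup.map_mono (le_inf (Subgroup.commutator_le_right _ _) hYC)
  have h3 : ⁅⁅Y.map (QuotientGroup.mk' O), C.map (QuotientGroup.mk' O)⁆, Y.map (QuotientGroup.mk' O)⁆ = ⊥ := by
    rw [Subgroup.commutator_comm (Y.map _) (C.map _)]; exact h2
  have h4 := Subgroup.commutator_commutator_eq_bot_of_rotate h3 h2
  rw [← Subgroup.map_commutator, ← Subgroup.map_commutator, Subgroup.map_eq_bot_iff, QuotientGroup.ker_mk'] at h4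
  exact h4

theorem sylow_mem_of_cen [Finite G] {s : ℕ} (hs : s.Prime) (S : Sylow s G) {x : G} (hx : QEl s x)
    (h : (S : Subgroup G) ≤ cen x) : x ∈ (S : Subgroup G) := by
  have := Fact.mk hs
  have h1 : Subgroup.zpowers x ≤ Subgroup.normalizer ((S : Subgroup G) : Set G) := by
    rw [Subgroup.zpowers_le, Subgroup.mem_normalizer_iff]
    have key : ∀ y, y ∈ (S : Subgroup G) → x * y * x⁻¹ = y := by
      intro y hy
      have := mem_cen.1 (h hy)
      rw [← this]; group
    intro y
    constructor
    · intro hy; rw [key y hy]; exact hy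
    · intro hy
      have h2 := key _ hy
      have h3 : x * y * x⁻¹ = y := by
        have := mul_left_cancel (mul_right_cancel h2)
        exact this
      rwa [h3] at hy
  have h2 := hx.isPGroup.to_sup_of_normal_right' S.2 h1
  have h3 := S.3 h2 le_sup_right
  rw [← h3]
  exact Subgroup.mem_sup_left (Subgroup.mem_zpowers x)

end K


section K
variable {G : Type*} [Group G]
open scoped commutatorElement

/-- second hypothesis -/
def HH2 (G : Type*) [Group G] : Prop := (∃ g : G, ¬ PPc g) → ∀ (g h : G) (w i j : ℕ), w.Prime → 2 ≤ i → 2 ≤ j →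
  clz g = w ^ i → clz h = w ^ j → i = j

theorem fix_all [Finite G] {q : ℕ} (hq : q.Prime) {u b : G} (hu : QEl q u) (hb : clz b = q) (hub : u ∈ cen b) :
    ∀ g : G, u ∈ cen (g * b * g⁻¹) := by
  have := Fact.mk hq
  have h1 := hu.isPGroup.card_modEq_card_fixedPoints (G ⧸ cen b)
  have h2 : Nat.card (G ⧸ cen b) = q := hb
  have hmem : (QuotientGroup.mk (1 : G) : G ⧸ cen b) ∈
      MulAction.fixedPoints (Subgroup.zpowers u) (G ⧸ cen b) := by
    intro y
    have hy : ((y : G)) ∈ cen b := by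
      have : Subgroup.zpowers u ≤ cen b := by simpa using hub
      exact this y.2
    have h3 : y • (QuotientGroup.mk (1 : G) : G ⧸ cen b) = QuotientGroup.mk ((y : G) * 1) := rfl
    rw [h3, eq_comm, QuotientGroup.eq]; simpa using hy
  have hpos : 0 < Nat.card (MulAction.fixedPoints (Subgroup.zpowers u) (G ⧸ cen b)) :=
    Nat.card_pos_iff.2 ⟨⟨⟨_, hmem⟩⟩, inferInstance⟩
  rw [h2] at h1
  have h3 : q ∣ Nat.card (MulAction.fixedPoints (Subgroup.zpowers u) (G ⧸ cen b)) := by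
    have := (Nat.modEq_zero_iff_dvd.2 (dvd_refl q)).symm.trans h1
    exact (Nat.modEq_zero_iff_dvd).1 this.symm
  have h4 := Nat.le_of_dvd hpos h3
  have h5 : MulAction.fixedPoints (Subgroup.zpowers u) (G ⧸ cen b) = Set.univ := by
    apply Set.eq_of_subset_of_ncard_le (Set.subset_univ _)
    rw [Set.ncard_univ, h2]; exact h4
  intro g
  have h6 : (QuotientGroup.mk g : G ⧸ cen b) ∈ MulAction.fixedPoints (Subgroup.zpowers u) (G ⧸ cen b) := by
    rw [h5]; trivial
  have h7 : (QuotientGroup.mk (u * g) : G ⧸ cen b) = QuotientGroup.mk g := h6 ⟨u, Subgroup.mem_zpowers u⟩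
  rw [eq_comm, QuotientGroup.eq] at h7
  rw [mem_cen_conj']
  simpa [mul_assoc] using h7

/-- endgame of theorem K -/
theorem K_end [Finite G] (H1 : HH1 G) (H2 : HH2 G) {q s t c : ℕ} (hq : q.Prime) (hs : s.Prime) (ht : t.Prime)
    (hsq : s ≠ q) (htq : t ≠ q) (hts : t ≠ s) (hc0 : c ≠ 0) {x u v b : G} (hx : QEl s x) (hxc : clz x = q ^ c)
    (hu : QEl q u) (huP : ¬ PPc u) (hux : ∀ g : G, u ∉ cen (g * x * g⁻¹))
    (hv : QEl t v) (hvP : ¬ PPc v)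
    (hb : QEl t b) (hbu : b ∈ cen u) (hbq : clz b ≠ q) (hb1 : clz b ≠ 1) : False := by
  have hA : ∀ y : G, QEl t y → y ∈ cen u → PPc y := by
    intro y hy hyu
    by_contra hyP
    have e1 : cen (y * u) = cen y ⊓ cen u := cen_mul ht hq htq hy hu hyu
    have e2 := (H1.eq huP (h := y * u) (by rw [e1]; exact inf_le_right)).2
    have e3 : cen u ≤ cen y := by rw [← e2, e1]; exact inf_le_left
    have e4 := (H1.eq hyP e3).2
    obtain ⟨g, hg⟩ := conj_cen_el ht hy x (by
      rw [hxc]; intro h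
      exact htq ((Nat.prime_dvd_prime_iff_eq ht hq).1 (ht.dvd_of_dvd_pow h)))
    have e5 : cen (y * (g * x * g⁻¹)) = cen y ⊓ cen (g * x * g⁻¹) := cen_mul ht hs hts hy (hx.conj g) hg
    have e6 := (H1.eq hyP (h := y * (g * x * g⁻¹)) (by rw [e5]; exact inf_le_left)).2
    have e7 : cen y ≤ cen (g * x * g⁻¹) := by rw [← e6, e5]; exact inf_le_right
    exact hux g (e7 (e3 (self_mem_cen u)))
  have hdq : ∀ {r k : ℕ}, r.Prime → r ≠ q → ¬ r ∣ q ^ k := fun hr hrq h =>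
    hrq ((Nat.prime_dvd_prime_iff_eq hr hq).1 (hr.dvd_of_dvd_pow h))
  have htn : t ∣ clz u := by
    by_contra h
    obtain ⟨g, hg⟩ := conj_cen_el ht hv u h
    rw [mem_cen_conj'] at hg
    have h1 : g⁻¹ * v * g = g⁻¹ * v * g⁻¹⁻¹ := by rw [inv_inv]
    rw [h1] at hg
    exact hvP ((PPc_conj v g⁻¹).1 (hA _ (hv.conj _) hg))
  have hsn : s ∣ clz u := by
    by_contra h
    obtain ⟨g, hg⟩ := conj_cen_el hs hx u h
    rw [mem_cen_conj'] at hg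
    apply hux g⁻¹
    rw [inv_inv]
    exact mem_cen_comm.1 hg
  have hub : cen u ≤ cen b := by
    have e1 : cen (b * u) = cen b ⊓ cen u := cen_mul ht hq htq hb hu hbu
    have e2 := (H1.eq huP (h := b * u) (by rw [e1]; exact inf_le_right)).2
    rw [← e2, e1]; exact inf_le_left
  obtain ⟨w, d, hw, hbd⟩ := hA b hb hbu
  have hd0 : d ≠ 0 := by
    rintro rfl
    exact hb1 (by simpa using hbd)
  by_cases hwq : w = q
  · subst hwq
    have hd2 : 2 ≤ d := by
      rcases d with _ | _ | d
      · exact absurd rfl hd0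
      · exact absurd (by simpa using hbd) hbq
      · omega
    have := Fact.mk hs
    obtain ⟨S⟩ : Nonempty (Sylow s G) := inferInstance
    obtain ⟨g, hg⟩ := conj_cen hs S S.2 b (by rw [hbd]; exact hdq hs hsq)
    obtain ⟨k, hk⟩ := conj_cen hs S S.2 x (by rw [hxc]; exact hdq hs hsq)
    have hxS := sylow_mem_of_cen hs S (hx.conj k) hk
    have hxb := hg hxS
    have e1 := cen_mul hs ht (Ne.symm hts) (hx.conj k) (hb.conj g) hxb
    have hsn' : ¬ s ∣ clz (k * x * k⁻¹ * (g * b * g⁻¹)) := by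
      intro h
      apply S.not_dvd_index
      refine h.trans (Subgroup.index_dvd_of_le ?_)
      rw [e1]; exact le_inf hk hg
    have hle : cen (k * x * k⁻¹ * (g * b * g⁻¹)) ≤ cen (g * b * g⁻¹) := by rw [e1]; exact inf_le_right
    by_cases hP : PPc (k * x * k⁻¹ * (g * b * g⁻¹))
    · obtain ⟨z, e, hz, hze⟩ := hP
      have hdv := clz_dvd_of_le hle
      rw [clz_conj, hbd, hze] at hdv
      have hwz : w = z := by
        have h1 : w ∣ z ^ e := (dvd_pow_self w hd0).trans hdv
        exact (Nat.prime_dvd_prime_iff_eq hw hz).1 (hw.dvd_of_dvd_pow h1)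
      subst hwz
      have hde : d ≤ e := (Nat.pow_dvd_pow_iff_le_right hw.one_lt).1 hdv
      have hee := H2 ⟨u, huP⟩ _ _ w e d hw (by omega) hd2 hze hbd
      have e3 := cen_eq_of_le hle (by rw [clz_conj, hbd, hze, hee])
      have e4 : cen (g * b * g⁻¹) ≤ cen (k * x * k⁻¹) := by rw [← e3, e1]; exact inf_le_left
      have e5 : g * u * g⁻¹ ∈ cen (k * x * k⁻¹) := e4 (mem_cen_conj.2 (hub (self_mem_cen u)))
      apply hux (g⁻¹ * k)
      have e6 : g⁻¹ * k * x * (g⁻¹ * k)⁻¹ = g⁻¹ * (k * x * k⁻¹) * g⁻¹⁻¹ := by group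
      rw [e6, mem_cen_conj', inv_inv]
      exact e5
    · exact hsn' (by rw [H1 _ _ hP huP]; exact hsn)
  · obtain ⟨g, hg⟩ := conj_cen_el ht hb x (by rw [hxc]; exact hdq ht htq)
    have e1 := cen_mul ht hs hts hb (hx.conj g) hg
    have hqw : Nat.Coprime w q := (Nat.coprime_primes hw hq).2 hwq
    have e2 : clz (b * (g * x * g⁻¹)) = w ^ d * q ^ c := by
      have e3 : (cen b).index = w ^ d := hbd
      have e4 : (cen (g * x * g⁻¹)).index = q ^ c := by
        have := clz_conj x g
        rw [hxc] at this; exact this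
      rw [clz, e1, index_inf_cop _ _ (by rw [e3, e4]; exact Nat.Coprime.pow _ _ hqw), e3, e4]
    have hP : ¬ PPc (b * (g * x * g⁻¹)) := by
      rintro ⟨z, e, hz, hze⟩
      rw [e2] at hze
      have h1 : w ∣ z ^ e := by rw [← hze]; exact (dvd_pow_self w hd0).mul_right _
      have h2 : q ∣ z ^ e := by rw [← hze]; exact (dvd_pow_self q hc0).mul_left _
      have h3 := (Nat.prime_dvd_prime_iff_eq hw hz).1 (hw.dvd_of_dvd_pow h1)
      have h4 := (Nat.prime_dvd_prime_iff_eq hq hz).1 (hq.dvd_of_dvd_pow h2)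
      exact hwq (h3.trans h4.symm)
    have e3 := H1 _ _ hP huP
    rw [e2] at e3
    have key : ∀ r : ℕ, r.Prime → r ≠ q → r ∣ clz u → r = w := by
      intro r hr hrq hru
      rw [← e3] at hru
      rcases (Nat.Prime.dvd_mul hr).1 hru with h | h
      · exact (Nat.prime_dvd_prime_iff_eq hr hw).1 (hr.dvd_of_dvd_pow h)
      · exact absurd h (hdq hr hrq)
    exact hts ((key t ht htq htn).trans (key s hs hsq hsn).symm)

end K


section K
variable {G : Type*} [Group G]
open scoped commutatorElement

theorem pgroup_solvable [Finite G] {q : ℕ} (hq : q.Prime) {P : Subgroup G} (hP : IsPGroup q P) : Group.IsSolvable P := by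
  have := Fact.mk hq
  have := IsPGroup.isNilpotent hP
  infer_instance

/-- existence of `b` -/
theorem exists_b [Finite G] (H1 : HH1 G) {q t : ℕ} (hq : q.Prime) (ht : t.Prime) (htq : t ≠ q)
    (O RE : Subgroup G) [RE.Normal] (hOp : IsPGroup q O) {u v : G} (huP : ¬ PPc u) (hvP : ¬ PPc v)
    (hv : QEl t v) (hvR : v ∉ RE) (hvO : ∀ r ∈ RE, ⁅v, r⁆ ∈ O) : ∃ b, QEl t b ∧ b ∈ cen u ∧ b ∉ RE := by
  have := Fact.mk ht
  by_contra hcon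
  push Not at hcon
  obtain ⟨T, hT⟩ := hv.isPGroup.exists_le_sylow
  have hvT : v ∈ (T : Subgroup G) := hT (Subgroup.mem_zpowers v)
  have hTR : (T : Subgroup G) ⊓ RE ≤ (T : Subgroup G) ⊓ cen v := by
    rintro r ⟨hrT, hrR⟩
    refine ⟨hrT, ?_⟩
    have h1 : ⁅v, r⁆ ∈ (T : Subgroup G) := by
      rw [commutatorElement_def]
      exact mul_mem (mul_mem (mul_mem hvT hrT) (inv_mem hvT)) (inv_mem hrT)
    have h2 : ⁅v, r⁆ = 1 := QEl.eq_one ht hq htq (QEl.of_isPGroup T.2 h1) (QEl.of_isPGroup hOp (hvO r hrR))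
    rw [commutatorElement_eq_one_iff_mul_comm] at h2
    exact mem_cen.2 h2.symm
  have hp1 : IsPGroup t ((T : Subgroup G) ⊓ RE : Subgroup G) := T.2.to_le inf_le_left
  have hp2 : IsPGroup t ((T : Subgroup G) ⊓ cen v : Subgroup G) := T.2.to_le inf_le_left
  obtain ⟨m, hm⟩ := IsPGroup.iff_card.1 hp1
  obtain ⟨l, hl⟩ := IsPGroup.iff_card.1 hp2
  have hml : m < l := by
    have h1 : Nat.card ((T : Subgroup G) ⊓ RE : Subgroup G) < Nat.card ((T : Subgroup G) ⊓ cen v : Subgroup G) := by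
      by_contra hle
      have h2 := Subgroup.eq_of_le_of_card_ge hTR (not_lt.1 hle)
      have h3 : v ∈ (T : Subgroup G) ⊓ cen v := ⟨hvT, self_mem_cen v⟩
      rw [← h2] at h3
      exact hvR h3.2
    rw [hm, hl] at h1
    exact (Nat.pow_lt_pow_iff_right ht.one_lt).1 h1
  have hdv : t ^ (m + 1) ∣ Nat.card (cen v) := by
    refine (pow_dvd_pow t hml).trans ?_
    rw [← hl]; exact Subgroup.card_dvd_of_le inf_le_right
  have hcard : Nat.card (cen v) = Nat.card (cen u) := by
    have h1 := clz_card u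
    have h2 := clz_card v
    rw [H1 v u hvP huP] at h2
    exact Nat.eq_of_mul_eq_mul_left (Nat.pos_of_ne_zero (clz_ne_zero u)) (h2.trans h1.symm)
  rw [hcard] at hdv
  have h1 := tpart_dvd ht (cen u) RE hdv (fun y hy hyt => hcon y hyt hy)
  have h2 : Nat.card RE = t ^ m * (T : Subgroup G).relIndex RE := by
    have h3 := Subgroup.card_mul_index ((T : Subgroup G).subgroupOf RE)
    have h4 : Nat.card ((T : Subgroup G).subgroupOf RE) = Nat.card ((T : Subgroup G) ⊓ RE : Subgroup G) := by
      rw [← Subgroup.inf_subgroupOf_right]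
      exact Nat.card_congr (Subgroup.subgroupOfEquivOfLe inf_le_right).toEquiv
    rw [h4, hm] at h3
    exact h3.symm
  rw [h2, pow_succ] at h1
  have h3 := Nat.dvd_of_mul_dvd_mul_left (pow_pos ht.pos m) h1
  exact T.not_dvd_index (h3.trans (index_normal_dvd _ _))

theorem thmK [Finite G] (H1 : HH1 G) (H2 : HH2 G) {q s c : ℕ} (hq : q.Prime) (hs : s.Prime) {x : G} (hx : QEl s x)
    (hxc : clz x = q ^ c) (R : Subgroup G) [hRn : R.Normal] (hRs : Group.IsSolvable R)
    (hRm : ∀ N : Subgroup G, N.Normal → Group.IsSolvable N → N ≤ R) : x ∈ R := by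
  by_cases hsq : s = q
  · subst hsq
    obtain ⟨N, hN, hNp, hxN⟩ := OQ_of_sylow hs hx hxc
    exact hRm N hN (pgroup_solvable hs hNp) hxN
  by_cases hc0 : c = 0
  · subst hc0
    obtain ⟨N, hN, hNp, hxN⟩ := OQ_of_sylow (c := 0) hs hx (by simpa using hxc)
    exact hRm N hN (pgroup_solvable hs hNp) hxN
  by_contra hxR
  obtain ⟨X, hX⟩ : ∃ X, Subgroup.normalClosure {x} = X := ⟨_, rfl⟩
  have hXn : X.Normal := by rw [← hX]; infer_instance
  have hxX : x ∈ X := by rw [← hX]; exact Subgroup.subset_normalClosure rfl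
  obtain ⟨π, hπ⟩ : ∃ π, QuotientGroup.mk' R = π := ⟨_, rfl⟩
  have hπs : Function.Surjective π := by rw [← hπ]; exact QuotientGroup.mk'_surjective R
  have hker : ∀ g, π g = 1 ↔ g ∈ R := by
    intro g; rw [← hπ]; simp
  have hsol : ∀ N : Subgroup (G ⧸ R), N.Normal → Group.IsSolvable N → N = ⊥ := by
    intro N hN hs
    have h1 := hRm (N.comap π) inferInstance (by
      refine solvable_of_map π _ R ?_ hRs (fun m _ h => (hker m).1 h)
      rw [Subgroup.map_comap_eq_self_of_surjective hπs]; exact hs)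
    rw [eq_bot_iff]
    intro n hn
    obtain ⟨g, rfl⟩ := hπs n
    exact (hker g).2 (h1 hn)
  have hXbn : (X.map π).Normal := hXn.map _ hπs
  obtain ⟨E, ⟨hEn, hEX, hE0⟩, hEm⟩ := Set.Finite.exists_minimal
    (Set.toFinite {N : Subgroup (G ⧸ R) | N.Normal ∧ N ≤ X.map π ∧ N ≠ ⊥}) ⟨X.map π, hXbn, le_rfl, by
      intro h
      have : π x ∈ X.map π := ⟨x, hxX, rfl⟩
      rw [h] at this
      exact hxR ((hker x).1 (Subgroup.mem_bot.1 this))⟩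
  have hmin : ∀ L : Subgroup (G ⧸ R), L.Normal → L ≤ E → L = ⊥ ∨ L = E := by
    intro L hL hLE
    by_cases h0 : L = ⊥
    · exact Or.inl h0
    · exact Or.inr (le_antisymm hLE (hEm ⟨hL, hLE.trans hEX, h0⟩ hLE))
  have hna : ¬ ∀ a ∈ E, ∀ b ∈ E, a * b = b * a := by
    intro h
    apply hE0
    apply hsol E hEn
    exact Group.isSolvable_of_comm (fun a b => Subtype.ext (h a a.2 b b.2))
  have hCE : E ⊓ Subgroup.centralizer (E : Set (G ⧸ R)) = ⊥ := by
    rcases hmin _ inferInstance (inf_le_left : E ⊓ Subgroup.centralizer (E : Set (G ⧸ R)) ≤ E) with h | h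
    · exact h
    · exfalso
      apply hna
      intro a ha b hb
      have h2 : E ≤ Subgroup.centralizer (E : Set (G ⧸ R)) := inf_eq_left.1 h
      exact (Subgroup.mem_centralizer_iff.1 (h2 hb)) a ha
  have hEE : ⁅E, E⁆ = E := by
    rcases hmin ⁅E, E⁆ inferInstance E.commutator_le_self with h | h
    · exfalso
      rw [Subgroup.commutator_eq_bot_iff_le_centralizer] at h
      rw [inf_eq_left.2 h] at hCE
      exact hE0 hCE
    · exact h
  have hBE := fun v hvE hv => BE E hmin hna v hvE hv
  have hF1 : ∀ g : G, π g ∈ E → π g ≠ 1 → ¬ PPc g := by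
    rintro g hgE hg1 ⟨w, k, hw, hk⟩
    apply hBE (π g) hgE hg1
    have h1 : (cen (π g)).relIndex E ∣ w ^ k := by
      rw [← hk]
      exact (index_normal_dvd _ _).trans (clz_map_dvd π hπs g)
    obtain ⟨j, -, hj⟩ := (Nat.dvd_prime_pow hw).1 h1
    exact ⟨w, j, hw, hj⟩
  have hF2 : ¬ E ≤ cen (π x) := by
    intro h
    have h1 : X ≤ (Subgroup.centralizer (E : Set (G ⧸ R))).comap π := by
      rw [← hX]
      apply Subgroup.normalClosure_le_normal
      rintro y rfl
      show π y ∈ Subgroup.centralizer (E : Set (G ⧸ R))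
      rw [Subgroup.mem_centralizer_iff]
      intro e he
      exact mem_cen.1 (h he)
    rw [← Subgroup.map_le_iff_le_comap] at h1
    rw [inf_eq_left.2 (hEX.trans h1)] at hCE
    exact hE0 hCE
  obtain ⟨t, ht, htq, hts, htE⟩ := third_prime E hq hs hE0 hBE
  -- the element u
  obtain ⟨u', hu'E, hu'q, hu'⟩ := U_lemma (c := c) hq E (π x) (by rw [← hxc]; exact clz_map_dvd π hπs x) hF2
  obtain ⟨u0, rfl⟩ := hπs u'
  obtain ⟨m, hum, humπ⟩ := lift_qel π hq u0 hu'q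
  obtain ⟨u, hu⟩ : ∃ u, u0 ^ m = u := ⟨_, rfl⟩
  rw [hu] at hum humπ
  rw [← humπ] at hu'E hu'
  have hu1 : π u ≠ 1 := by
    intro h
    apply hu' 1
    rw [h]; simp [one_mem]
  have huP := hF1 u hu'E hu1
  have hux : ∀ g : G, u ∉ cen (g * x * g⁻¹) := by
    intro g hg
    rw [mem_cen_conj', mem_cen] at hg
    apply hu' (π g⁻¹)
    rw [mem_cen]
    have := congrArg π hg
    simpa [map_mul] using this
  -- the element v
  obtain ⟨O, hOn, hOp, hOm⟩ := exists_OQ (G := G) q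
  obtain ⟨RE, hRE⟩ : ∃ RE, (Subgroup.centralizer (E : Set (G ⧸ R))).comap π = RE := ⟨_, rfl⟩
  have hREn : RE.Normal := by rw [← hRE]; infer_instance
  obtain ⟨Y, hY⟩ : ∃ Y, X ⊓ E.comap π = Y := ⟨_, rfl⟩
  have hYn : Y.Normal := by rw [← hY]; infer_instance
  have hYπ : Y.map π = E := by
    apply le_antisymm
    · rw [Subgroup.map_le_iff_le_comap, ← hY]; exact inf_le_right
    · intro e he
      obtain ⟨y, hyX, rfl⟩ := hEX he
      exact ⟨y, by rw [← hY]; exact ⟨hyX, he⟩, rfl⟩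
  have hYR : ⁅RE, Y⁆ ≤ R := by
    rw [Subgroup.commutator_le]
    intro r hr y hy
    rw [← hker, map_commutatorElement, commutatorElement_eq_one_iff_mul_comm]
    rw [← hRE] at hr
    have hyE : π y ∈ E := by rw [← hYπ]; exact ⟨y, hy, rfl⟩
    exact ((Subgroup.mem_centralizer_iff.1 hr) _ hyE).symm
  have hV := V_lemma hq hxc O hOp hOm R Y RE hRs (by rw [hX, ← hY]; exact inf_le_left) hYR
  obtain ⟨v', hv'E, hv't, hv'1⟩ := exists_qel_notMem ht E htE
  have hv'2 : v' ∈ (⁅Y, Y⁆).map π := by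
    rw [Subgroup.map_commutator, hYπ, hEE]; exact hv'E
  obtain ⟨v0, hv0, rfl⟩ := hv'2
  obtain ⟨l, hvl, hvlπ⟩ := lift_qel π ht v0 hv't
  obtain ⟨v, hv⟩ : ∃ v, v0 ^ l = v := ⟨_, rfl⟩
  have hvY : v ∈ ⁅Y, Y⁆ := by rw [← hv]; exact pow_mem hv0 l
  rw [hv] at hvl hvlπ
  rw [← hvlπ] at hv'E hv'1
  have hvP := hF1 v hv'E hv'1
  have hnotRE : ∀ g, π g ∈ E → π g ≠ 1 → g ∉ RE := by
    intro g h1 h2 h3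
    apply h2
    rw [← Subgroup.mem_bot, ← hCE]
    rw [← hRE] at h3
    exact ⟨h1, h3⟩
  obtain ⟨b, hbt, hbu, hbR⟩ := exists_b H1 hq ht htq O RE hOp huP hvP hvl (hnotRE v hv'E hv'1)
    (fun r hr => hV (Subgroup.commutator_mem_commutator hvY hr))
  have hbcomm : ∃ g : G, u ∉ cen (g * b * g⁻¹) := by
    by_contra hcon
    push Not at hcon
    have h1 : b ∈ (Subgroup.centralizer (E : Set (G ⧸ R))).comap π := by
      have hBn : ((Subgroup.normalClosure {b}).map π).Normal :=
        Subgroup.Normal.map inferInstance _ hπs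
      have h2 : π u ∈ Subgroup.centralizer (((Subgroup.normalClosure {b}).map π : Subgroup (G ⧸ R)) : Set (G ⧸ R)) := by
        have h3 : Subgroup.normalClosure {b} ≤ cen u := by
          rw [Subgroup.normalClosure, Subgroup.closure_le]
          intro y hy
          rw [Group.mem_conjugatesOfSet_iff] at hy
          obtain ⟨a, ha, hay⟩ := hy
          rw [Set.mem_singleton_iff] at ha
          subst ha
          obtain ⟨g, rfl⟩ := isConj_iff.1 hay
          exact mem_cen_comm.1 (hcon g)
        rw [Subgroup.mem_centralizer_iff]
        rintro _ ⟨y, hy, rfl⟩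
        have := mem_cen.1 (h3 hy)
        rw [← map_mul, ← map_mul, this]
      rcases hmin (E ⊓ Subgroup.centralizer (((Subgroup.normalClosure {b}).map π : Subgroup (G ⧸ R)) : Set (G ⧸ R)))
        inferInstance inf_le_left with h | h
      · exfalso; apply hu1
        rw [← Subgroup.mem_bot, ← h]
        exact ⟨hu'E, h2⟩
      · have h3 := inf_eq_left.1 h
        show π b ∈ Subgroup.centralizer (E : Set (G ⧸ R))
        rw [Subgroup.mem_centralizer_iff]
        intro e he
        exact ((Subgroup.mem_centralizer_iff.1 (h3 he)) (π b) ⟨b, Subgroup.subset_normalClosure rfl, rfl⟩).symm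
    rw [hRE] at h1
    exact hbR h1
  obtain ⟨g0, hg0⟩ := hbcomm
  refine K_end H1 H2 hq hs ht hsq htq hts hc0 hx hxc hum huP hux hvl hvP hbt hbu ?_ ?_
  · intro hbq
    exact hg0 (fix_all hq hum hbq (mem_cen_comm.1 hbu) g0)
  · intro hb1
    have h1 : cen b = ⊤ := Subgroup.index_eq_one.1 hb1
    have h2 : g0⁻¹ * u * g0 ∈ cen b := by rw [h1]; trivial
    exact hg0 (mem_cen_conj'.2 h2)

end K


section Fit
variable {G : Type*} [Group G]

theorem le_fitting (N : Subgroup G) (hN : N.Normal) (hn : Group.IsNilpotent N) : N ≤ fittingSubgroup G :=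
  fun x hx => Subgroup.subset_normalClosure ⟨N, hN, hn, hx⟩

theorem fit_qel [Finite G] {q : ℕ} (hq : q.Prime) (O : Subgroup G) [hO : O.Normal]
    (hOp : IsPGroup q O) (hOm : ∀ N : Subgroup G, N.Normal → IsPGroup q N → N ≤ O) (y : G)
    (hy : y ∈ fittingSubgroup G) (hyq : QEl q y) : y ∈ O := by
  obtain ⟨L, hLn, hLq, hLm⟩ := exists_OQ' (G := G ⧸ O) hq
  have h1 : fittingSubgroup G ≤ L.comap (QuotientGroup.mk' O) := by
    apply Subgroup.normalClosure_le_normal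
    rintro x ⟨N, hN, hn, hx⟩
    have hNn : (N.map (QuotientGroup.mk' O)).Normal := hN.map _ (QuotientGroup.mk'_surjective O)
    have h2 : N.map (QuotientGroup.mk' O) ≤ L := by
      apply hLm _ hNn
      intro hd
      obtain ⟨z, hz, hzq, hz1⟩ := exists_qel_notMem hq _ hd
      obtain ⟨z0, hz0, rfl⟩ := hz
      obtain ⟨m, hm1, hm2⟩ := lift_qel (QuotientGroup.mk' O) hq z0 hzq
      obtain ⟨P, hPn, hPp, -, hP⟩ := nil_sylow hq N hn
      have h3 := hOm P hPn hPp (hP _ (pow_mem hz0 m) hm1)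
      apply hz1
      rw [← hm2]
      exact (QuotientGroup.eq_one_iff _).2 h3
    exact h2 ⟨x, hx, rfl⟩
  have h2 : QuotientGroup.mk' O y ∈ L := h1 hy
  by_contra hyO
  apply hLq
  obtain ⟨k, hk⟩ := (hyq.map (QuotientGroup.mk' O))
  have h3 : orderOf (QuotientGroup.mk' O y) ∣ q ^ k := orderOf_dvd_of_pow_eq_one hk
  obtain ⟨j, -, hj⟩ := (Nat.dvd_prime_pow hq).1 h3
  have hj0 : j ≠ 0 := by
    rintro rfl
    rw [pow_zero, orderOf_eq_one_iff] at hj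
    apply hyO
    simpa using hj
  have h4 : orderOf (QuotientGroup.mk' O y) ∣ Nat.card L := Subgroup.orderOf_dvd_natCard L h2
  rw [hj] at h4
  exact (dvd_pow_self q hj0).trans h4

theorem fit_nil [Finite G] : Group.IsNilpotent (fittingSubgroup G) := by
  refine (Group.isNilpotent_of_finite_tfae.out 0 3).2 ?_
  intro q hqf P
  have hq := hqf.out
  obtain ⟨O, hOn, hOp, hOm⟩ := exists_OQ (G := G) q
  have hOnil : Group.IsNilpotent O := IsPGroup.isNilpotent hOp
  have hOF := le_fitting O hOn hOnil
  have h1 : (P : Subgroup (fittingSubgroup G)) = O.subgroupOf (fittingSubgroup G) := by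
    apply le_antisymm
    · intro y hy
      rw [Subgroup.mem_subgroupOf]
      exact fit_qel hq O hOp hOm y y.2 ((QEl.of_isPGroup P.2 hy).map (fittingSubgroup G).subtype)
    · have h2 : IsPGroup q (O.subgroupOf (fittingSubgroup G)) :=
        hOp.comap_of_injective _ (fittingSubgroup G).subtype_injective
      exact h2.le_sylow_of_normal P
  rw [h1]; infer_instance

theorem mem_fitting2_of [Finite G] (X O : Subgroup G) [hX : X.Normal] [hO : O.Normal] (hOn : Group.IsNilpotent O)
    (hXn : Group.IsNilpotent (X.map (QuotientGroup.mk' O))) : X ≤ fitting2 G := by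
  have hOF := le_fitting O hO hOn
  have h1 : X.map (QuotientGroup.mk' (fittingSubgroup G)) =
      (X.map (QuotientGroup.mk' O)).map (QuotientGroup.map O (fittingSubgroup G) (MonoidHom.id G) hOF) := by
    rw [Subgroup.map_map]; rfl
  have h2 : Group.IsNilpotent (X.map (QuotientGroup.mk' (fittingSubgroup G))) := by
    rw [h1]
    exact Group.nilpotent_of_surjective _ (MonoidHom.subgroupMap_surjective _ _)
  have h3 : (X.map (QuotientGroup.mk' (fittingSubgroup G))).Normal := hX.map _ (QuotientGroup.mk'_surjective _)
  exact Subgroup.map_le_iff_le_comap.1 (le_fitting _ h3 h2)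

theorem PPc_mem_fitting2 [Finite G] (H1 : HH1 G) (H2 : HH2 G) (g : G) (hg : PPc g) : g ∈ fitting2 G := by
  apply mem_of_primeparts
  intro s n hs hsn
  obtain ⟨x, hx⟩ : ∃ x, g ^ n = x := ⟨_, rfl⟩
  have hP : PPc x := by rw [← hx]; exact PPc_of_le (cen_le_pow g n) hg
  rw [hx] at hsn ⊢
  obtain ⟨q, c, hq, hc⟩ := hP
  obtain ⟨R, hRn, hRs, hRm⟩ := exists_rad (G := G)
  have hxR := thmK H1 H2 hq hs hsn hc R hRs hRm
  obtain ⟨O, hOn, hOp, hOm⟩ := exists_OQ (G := G) q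
  have := Fact.mk hq
  have hOnil : Group.IsNilpotent O := IsPGroup.isNilpotent hOp
  have hXR : Subgroup.normalClosure {x} ≤ R := Subgroup.normalClosure_le_normal (by rintro y rfl; exact hxR)
  refine mem_fitting2_of (Subgroup.normalClosure {x}) O hOnil ?_ (Subgroup.subset_normalClosure rfl)
  have hXs : Group.IsSolvable (Subgroup.normalClosure {x}) :=
    Group.isSolvable_of_isSolvable_injective (Subgroup.inclusion_injective hXR)
  refine lemS _ _ le_rfl (Subgroup.Normal.map inferInstance _ (QuotientGroup.mk'_surjective _)) ?_ ?_
  · exact Group.isSolvable_of_surjective ((QuotientGroup.mk' O).subgroupMap_surjective _)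
  · intro N hN hn
    exact cent_nil hq hc O hOp hOm N hn

theorem fitting2_map : (fitting2 G).map (QuotientGroup.mk' (fittingSubgroup G)) = fittingSubgroup (G ⧸ fittingSubgroup G) :=
  Subgroup.map_comap_eq_self_of_surjective (QuotientGroup.mk'_surjective _) _

theorem fitting_le_fitting2 : fittingSubgroup G ≤ fitting2 G := by
  intro x hx
  show QuotientGroup.mk' (fittingSubgroup G) x ∈ fittingSubgroup (G ⧸ fittingSubgroup G)
  have : QuotientGroup.mk' (fittingSubgroup G) x = 1 := by simpa using hx
  rw [this]; exact one_mem _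

theorem fitting2_solvable [Finite G] : Group.IsSolvable (fitting2 G) := by
  have h1 := fit_nil (G := G)
  have h2 := fit_nil (G := G ⧸ fittingSubgroup G)
  refine solvable_of_map (QuotientGroup.mk' (fittingSubgroup G)) _ (fittingSubgroup G) ?_ inferInstance ?_
  · rw [fitting2_map]; infer_instance
  · intro m _ h; simpa using h

theorem cent_fit [Finite G] (M : Subgroup G) [M.Normal] (hM : Group.IsSolvable M)
    (hc : ⁅fittingSubgroup G, M⁆ = ⊥) : M ≤ fittingSubgroup G := by
  refine le_fitting M inferInstance (lemS _ M le_rfl inferInstance hM (fun N hN hn => ?_))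
  rw [← le_bot_iff, ← hc]
  exact Subgroup.commutator_mono (le_fitting N hN hn) le_rfl

end Fit


section Loc
variable {G : Type*} [Group G]

def MX (N : Subgroup G) : Prop := ∀ g h : G, g ∉ N → cen h ≤ cen g → cen h = cen g
def Gd (N : Subgroup G) (g : G) : Prop := ∀ r : ℕ, r.Prime → g ^ r ∉ N

theorem Gd.notMem {N : Subgroup G} {g : G} (h : Gd N g) : g ∉ N := fun h1 => h 2 Nat.prime_two (pow_mem h1 2)

theorem prime_ind (A : G → Prop) (K : G → Prop) (hA : ∀ h n, A h → A (h ^ n))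
    (hs : ∀ h r, r.Prime → A h → K (h ^ r) → K h) (n : ℕ) : n ≠ 0 → ∀ h, A h → K (h ^ n) → K h := by
  induction n using induction_on_primes with
  | zero => intro h; exact absurd rfl h
  | one => intro _ h _ hk; simpa using hk
  | prime_mul p a hp ih =>
    intro h0 h hh hk
    refine hs h p hp hh (ih (by rintro rfl; simp at h0) _ (hA h p hh) ?_)
    rwa [← pow_mul]

theorem S1 [Finite G] {N : Subgroup G} (hM : MX N) {g : G} (hg : Gd N g) :
    ∀ h ∈ cen g, cen g ≤ cen h := by
  intro h hh
  refine prime_ind (fun h => h ∈ cen g) (fun h => cen g ≤ cen h) (fun h n hh => pow_mem hh n) ?_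
    (orderOf h) (orderOf_pos h).ne' h hh ?_
  · intro h r hr hh hk
    by_cases hN : h ^ r ∈ N
    · have hc : Commute g h := (mem_cen.1 hh).symm
      have e1 : (g * h) ^ r = g ^ r * h ^ r := hc.mul_pow r
      have e2 : (g * h) ^ r ∉ N := by
        rw [e1]; intro h3; exact hg r hr ((Subgroup.mul_mem_cancel_right N hN).1 h3)
      have e3 := hM _ _ e2 (cen_le_pow (g * h) r)
      have e4 : cen g ≤ cen ((g * h) ^ r) := by
        intro x hx
        rw [e1]
        have a1 : Commute x (g ^ r) := Commute.pow_right (mem_cen.1 hx) r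
        have a2 : Commute x (h ^ r) := mem_cen.1 (hk hx)
        exact mem_cen.2 (a1.mul_right a2)
      intro x hx
      have h5 : Commute x (g * h) := mem_cen.1 (by rw [e3]; exact e4 hx)
      have h6 : Commute x g := mem_cen.1 hx
      have h7 : Commute x (g⁻¹ * (g * h)) := h6.inv_right.mul_right h5
      rw [inv_mul_cancel_left] at h7
      exact mem_cen.2 h7
    · rw [hM _ _ hN hk, hM _ _ hN (cen_le_pow h r)]
  · intro x _; rw [mem_cen]; simp [pow_orderOf_eq_one]

theorem S1c [Finite G] {N : Subgroup G} (hM : MX N) {g : G} (hg : Gd N g) {a b : G} (ha : a ∈ cen g) (hb : b ∈ cen g) :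
    Commute a b := mem_cen.1 (S1 hM hg b hb ha)

theorem S2 [Finite G] {N : Subgroup G} (hM : MX N) {g : G} (hg : Gd N g) {a : G} (ha : a ∈ cen g) (haN : a ∉ N) :
    cen a = cen g := (hM _ _ haN (S1 hM hg a ha)).symm

theorem comm_mk (N : Subgroup G) [N.Normal] (a b : G) : a * b * a⁻¹ * b⁻¹ ∈ N ↔ Commute (QuotientGroup.mk' N a) (QuotientGroup.mk' N b) := by
  rw [← QuotientGroup.eq_one_iff (N := N)]
  show QuotientGroup.mk' N (a * b * a⁻¹ * b⁻¹) = 1 ↔ _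
  rw [map_mul, map_mul, map_mul, map_inv, map_inv, mul_inv_eq_one, mul_inv_eq_iff_eq_mul]
  rfl

theorem S3 [Finite G] {N : Subgroup G} [N.Normal] (hM : MX N) {g : G} (hg : Gd N g) {k : G}
    (hk : ∀ a ∈ cen g, k * a * k⁻¹ ∈ cen g) (hkg : Commute (QuotientGroup.mk' N k) (QuotientGroup.mk' N g)) : k ∈ cen g := by
  refine prime_ind (fun k => (∀ a ∈ cen g, k * a * k⁻¹ ∈ cen g) ∧ Commute (QuotientGroup.mk' N k) (QuotientGroup.mk' N g))
    (fun k => k ∈ cen g) ?_ ?_ (orderOf k) (orderOf_pos k).ne' k ⟨hk, hkg⟩ ?_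
  · rintro k n ⟨h1, h2⟩
    refine ⟨?_, by rw [map_pow]; exact h2.pow_left n⟩
    induction n with
    | zero => simp
    | succ n ih =>
      intro a ha
      have := ih _ (h1 a ha)
      rw [pow_succ]; convert this using 1; group
  · rintro k l hl ⟨h1, h2⟩ hkl
    have hy : ∀ m : ℕ, (g * k) ^ m * (k ^ m)⁻¹ ∈ cen g := by
      intro m
      induction m with
      | zero => simp
      | succ m ih =>
        have := mul_mem (self_mem_cen g) (h1 _ ih)
        convert this using 1
        rw [pow_succ' (g * k), pow_succ' k]; group
    have hyN : (g * k) ^ l * (k ^ l)⁻¹ ∉ N := by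
      intro h3
      apply hg l hl
      rw [← QuotientGroup.eq_one_iff (N := N)] at h3 ⊢
      change QuotientGroup.mk' N _ = 1 at h3
      show QuotientGroup.mk' N _ = 1
      rw [map_mul, map_inv, map_pow, map_pow, map_mul, h2.symm.mul_pow, mul_inv_cancel_right] at h3
      rwa [map_pow]
    have h4 := S2 hM hg (hy l) hyN
    have c1 : Commute (g * k) ((g * k) ^ l) := (Commute.refl _).pow_right l
    have c2 : Commute (g * k) (k ^ l) :=
      Commute.mul_left (mem_cen.1 hkl).symm ((Commute.refl _).pow_right l)
    have h5 : g * k ∈ cen g := by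
      rw [← h4]; exact mem_cen.2 (c1.mul_right c2.inv_right)
    exact (Subgroup.mul_mem_cancel_left _ (self_mem_cen g)).1 h5
  · rw [pow_orderOf_eq_one]; exact one_mem _

theorem S3' [Finite G] {N : Subgroup G} [hN : N.Normal] (hM : MX N) {g : G} (hg : Gd N g) {w a : G}
    (ha : a ∈ cen g) (haN : a ∉ N) (hwa : w * a * w⁻¹ ∈ cen g)
    (hkg : Commute (QuotientGroup.mk' N w) (QuotientGroup.mk' N g)) : w ∈ cen g := by
  refine S3 hM hg ?_ hkg
  intro b hb
  have h1 : w * a * w⁻¹ ∉ N := fun h => haN (by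
    have := hN.conj_mem _ h w⁻¹
    simpa [mul_assoc] using this)
  rw [← S2 hM hg hwa h1, mem_cen_conj, S2 hM hg ha haN]; exact hb

theorem mk_eq_one {N : Subgroup G} [N.Normal] {v : G} (hv : v ∈ N) : QuotientGroup.mk' N v = 1 :=
  (QuotientGroup.eq_one_iff _).2 hv

theorem surj_of_fib {X Y : Type*} [Finite X] [Finite Y] (f : X → Y) (c : ℕ) (hc : 0 < c)
    (hf : ∀ x, Nat.card {x' // f x' = f x} ≤ c) (hcard : c * Nat.card Y ≤ Nat.card X) : Function.Surjective f := by
  classical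
  have := Fintype.ofFinite X
  have := Fintype.ofFinite Y
  have h1 := Finset.card_le_mul_card_image (f := f) Finset.univ c (by
    intro a ha
    obtain ⟨x, -, rfl⟩ := Finset.mem_image.1 ha
    have := hf x
    rwa [Nat.card_eq_fintype_card, Fintype.card_subtype] at this)
  rw [Nat.card_eq_fintype_card, Nat.card_eq_fintype_card] at hcard
  have h2 : c * Fintype.card Y ≤ c * (Finset.univ.image f).card := hcard.trans h1
  have h3 := Nat.le_of_mul_le_mul_left h2 hc
  have h4 := Finset.eq_univ_of_card _ (le_antisymm (Finset.card_le_univ _) h3)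
  intro y
  have := Finset.mem_univ y
  rw [← h4] at this
  obtain ⟨x, -, h⟩ := Finset.mem_image.1 this
  exact ⟨x, h⟩

theorem S4 [Finite G] {N : Subgroup G} [hN : N.Normal] (hM : MX N) {g : G} (hg : Gd N g) (V : Subgroup G) [hV : V.Normal]
    (hVN : V ≤ N) {a y : G} (ha : a ∈ cen g) (haN : a ∉ N) (hy : a⁻¹ * y ∈ V) :
    ∃ v ∈ V, ∃ b ∈ V, b ∈ cen g ∧ y = v * (a * b) * v⁻¹ := by
  let f : V × (cen g ⊓ V : Subgroup G) → V := fun p => ⟨a⁻¹ * (p.1 * (a * p.2) * (p.1 : G)⁻¹), by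
    have h1 := hV.conj_mem _ p.1.2 a⁻¹
    have h2 := mul_mem (mul_mem h1 p.2.2.2) (inv_mem p.1.2)
    convert h2 using 1; group⟩
  have hs : Function.Surjective f := by
    refine surj_of_fib f (Nat.card (cen g ⊓ V : Subgroup G)) Nat.card_pos ?_ ?_
    · rintro ⟨v, b⟩
      refine Nat.card_le_card_of_injective (fun p : {x' // f x' = f (v, b)} => (⟨(p.1.1 : G)⁻¹ * v, ?_, ?_⟩ : (cen g ⊓ V : Subgroup G))) ?_
      · obtain ⟨⟨v', b'⟩, h⟩ := p
        have h1 := congrArg Subtype.val h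
        simp only [f, mul_right_inj] at h1
        have hb : a * (b : G) ∉ N := fun h => haN ((Subgroup.mul_mem_cancel_right N (hVN b.2.2)).1 h)
        refine S3' hM hg (mul_mem ha b.2.1) hb ?_ ?_
        · have : (v' : G)⁻¹ * v * (a * b) * ((v' : G)⁻¹ * v)⁻¹ = (v' : G)⁻¹ * (v * (a * b) * (v : G)⁻¹) * v' := by group
          rw [this, ← h1]
          have : (v' : G)⁻¹ * (v' * (a * b') * (v' : G)⁻¹) * v' = a * b' := by group
          rw [this]
          exact mul_mem ha b'.2.1
        · rw [mk_eq_one (mul_mem (inv_mem (hVN v'.2)) (hVN v.2))]; exact Commute.one_left _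
      · exact V.mul_mem (V.inv_mem p.1.1.2) v.2
      · rintro ⟨⟨v1, b1⟩, h1⟩ ⟨⟨v2, b2⟩, h2⟩ h
        have e1 := congrArg Subtype.val h
        simp only [mul_left_inj, inv_inj] at e1
        have e2 := congrArg Subtype.val (h1.trans h2.symm)
        simp only [f, mul_right_inj] at e2
        rw [e1] at e2
        simp only [mul_left_inj, mul_right_inj] at e2
        ext <;> simp [e1, e2]
    · rw [Nat.card_prod, mul_comm]
  obtain ⟨⟨v, b⟩, h⟩ := hs ⟨_, hy⟩
  have h1 := congrArg Subtype.val h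
  simp only [f, mul_right_inj] at h1
  exact ⟨v, v.2, b, b.2.2, b.2.1, h1.symm⟩

theorem TI [Finite G] {N : Subgroup G} [hN : N.Normal] (hM : MX N) {g : G} (hg : Gd N g) {x : G} (hx : x ∈ cen g ⊔ N) (hxN : x ∉ N) :
    ∃ n ∈ N, ∃ a ∈ cen g, a ∉ N ∧ x = n * a * n⁻¹ := by
  obtain ⟨a, ha, m, hm, rfl⟩ := Subgroup.mem_sup_of_normal_right.1 hx
  have haN : a ∉ N := fun h => hxN (mul_mem h hm)
  obtain ⟨v, hv, b, hb, hbg, e⟩ := S4 hM hg N le_rfl ha haN (y := a * m) (by simpa using hm)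
  exact ⟨v, hv, a * b, mul_mem ha hbg, fun h => haN ((Subgroup.mul_mem_cancel_right N hb).1 h), e⟩

/-- conjugation taking an element of A minus N into AN -/
theorem S7 [Finite G] {N : Subgroup G} [hN : N.Normal] (hM : MX N) {g : G} (hg : Gd N g) {a y : G} (ha : a ∈ cen g) (haN : a ∉ N)
    (hy : y * a * y⁻¹ ∈ cen g ⊔ N) : ∃ v ∈ N, ∃ w, y = v * w ∧ w * a * w⁻¹ ∈ cen g ∧ ∀ b, w * b * w⁻¹ ∈ cen g ↔ b ∈ cen g := by
  have h1 : y * a * y⁻¹ ∉ N := fun h => haN (by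
    have := hN.conj_mem _ h y⁻¹
    simpa [mul_assoc] using this)
  obtain ⟨v, hv, c, hc, hcN, e⟩ := TI hM hg hy h1
  have e2 : (v⁻¹ * y) * a * (v⁻¹ * y)⁻¹ = c := by
    have : (v⁻¹ * y) * a * (v⁻¹ * y)⁻¹ = v⁻¹ * (y * a * y⁻¹) * v := by group
    rw [this, e]; group
  refine ⟨v, hv, v⁻¹ * y, by group, by rw [e2]; exact hc, fun b => ?_⟩
  rw [← S2 hM hg hc hcN]
  nth_rw 1 [← e2]
  rw [mem_cen_conj, S2 hM hg ha haN, S2 hM hg hc hcN]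

theorem CG [Finite G] {N : Subgroup G} [hN : N.Normal] (hM : MX N) {g : G} (hg : Gd N g) {y : G}
    (hy : Commute (QuotientGroup.mk' N y) (QuotientGroup.mk' N g)) : y ∈ cen g ⊔ N := by
  have h1 : y * g * y⁻¹ * g⁻¹ ∈ N := (comm_mk N y g).2 hy
  have h2 : y * g * y⁻¹ ∈ cen g ⊔ N := by
    have := mul_mem (Subgroup.mem_sup_right (S := cen g) h1) (Subgroup.mem_sup_left (T := N) (self_mem_cen g))
    simpa using this
  obtain ⟨v, hv, w, rfl, hw, hw2⟩ := S7 hM hg (self_mem_cen g) hg.notMem h2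
  refine mul_mem (Subgroup.mem_sup_right hv) (Subgroup.mem_sup_left (S3 hM hg (fun a ha => (hw2 a).2 ha) ?_))
  rwa [map_mul, mk_eq_one hv, one_mul] at hy

end Loc


section Loc2
variable {G : Type*} [Group G]

theorem S5 [Finite G] {N : Subgroup G} [hN : N.Normal] (hM : MX N) {g : G} (hg : Gd N g) {r : ℕ} (hr : r.Prime) {a : G}
    (ha : a ∈ cen g) (haN : a ∉ N) (har : QEl r a) : ¬ r ∣ (cen g).relIndex (cen g ⊔ N) := by
  have := Fact.mk hr
  set Γ := cen g ⊔ N with hΓ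
  have haΓ : a ∈ Γ := Subgroup.mem_sup_left ha
  let a' : Γ := ⟨a, haΓ⟩
  have hp : IsPGroup r (Subgroup.zpowers a') := by
    apply QEl.isPGroup
    obtain ⟨n, hn⟩ := har
    exact ⟨n, Subtype.ext (by simpa [a'] using hn)⟩
  have h1 := hp.card_modEq_card_fixedPoints (Γ ⧸ (cen g).subgroupOf Γ)
  have hcg : ∀ x ∈ Γ, Commute (QuotientGroup.mk' N x) (QuotientGroup.mk' N g) := by
    intro x hx
    obtain ⟨b, hb, n, hn, rfl⟩ := Subgroup.mem_sup_of_normal_right.1 hx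
    rw [map_mul, mk_eq_one hn, mul_one]
    exact Commute.map (mem_cen.1 hb) _
  have h2 : ∀ y ∈ MulAction.fixedPoints (Subgroup.zpowers a') (Γ ⧸ (cen g).subgroupOf Γ), y = ((1 : Γ) : Γ ⧸ (cen g).subgroupOf Γ) := by
    intro y hy
    obtain ⟨x, rfl⟩ := QuotientGroup.mk_surjective y
    have h3 := hy ⟨a', Subgroup.mem_zpowers a'⟩
    change ((a' * x : Γ) : Γ ⧸ (cen g).subgroupOf Γ) = x at h3
    rw [eq_comm, QuotientGroup.eq, Subgroup.mem_subgroupOf] at h3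
    have h4 : (x : G)⁻¹ ∈ cen g := by
      refine S3' hM hg ha haN ?_ (hcg _ (inv_mem x.2))
      simpa [a', mul_assoc] using h3
    rw [QuotientGroup.eq, Subgroup.mem_subgroupOf]
    simpa using h4
  have h3 : Nat.card (MulAction.fixedPoints (Subgroup.zpowers a') (Γ ⧸ (cen g).subgroupOf Γ)) ≤ 1 := by
    rw [Finite.card_le_one_iff_subsingleton]
    exact ⟨fun x y => Subtype.ext ((h2 x x.2).trans (h2 y y.2).symm)⟩
  have h4 : 0 < Nat.card (MulAction.fixedPoints (Subgroup.zpowers a') (Γ ⧸ (cen g).subgroupOf Γ)) := by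
    have : Nonempty (MulAction.fixedPoints (Subgroup.zpowers a') (Γ ⧸ (cen g).subgroupOf Γ)) := by
      refine ⟨⟨((1 : Γ) : Γ ⧸ (cen g).subgroupOf Γ), ?_⟩⟩
      rintro ⟨z, hz⟩
      change ((z * 1 : Γ) : Γ ⧸ (cen g).subgroupOf Γ) = ((1 : Γ) : Γ ⧸ (cen g).subgroupOf Γ)
      rw [eq_comm, QuotientGroup.eq, Subgroup.mem_subgroupOf]
      obtain ⟨n, rfl⟩ := Subgroup.mem_zpowers_iff.1 hz
      simpa [a'] using zpow_mem ha n
    exact Nat.card_pos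
  intro h5
  have h6 : Nat.card (Γ ⧸ (cen g).subgroupOf Γ) = (cen g).relIndex Γ := rfl
  rw [h6] at h1
  have h7 : Nat.card (MulAction.fixedPoints (Subgroup.zpowers a') (Γ ⧸ (cen g).subgroupOf Γ)) = 1 := le_antisymm h3 h4
  rw [h7] at h1
  have h8 := (Nat.modEq_zero_iff_dvd.2 h5).symm.trans h1
  have := (Nat.modEq_zero_iff_dvd.1 h8.symm)
  exact hr.one_lt.ne' (Nat.dvd_one.1 this)

theorem card_mul_relIdx {H K : Subgroup G} (h : H ≤ K) : Nat.card H * H.relIndex K = Nat.card K := by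
  rw [← Subgroup.card_mul_index (H.subgroupOf K), Nat.card_congr (Subgroup.subgroupOfEquivOfLe h).toEquiv]
  rfl

/-- image of the centralizer -/
def bar (N : Subgroup G) [N.Normal] (g : G) : Subgroup (G ⧸ N) := (cen g).map (QuotientGroup.mk' N)

theorem card_bar [Finite G] (N D : Subgroup G) [N.Normal] :
    Nat.card (D ⊔ N : Subgroup G) = Nat.card N * Nat.card (D.map (QuotientGroup.mk' N)) := by
  have h1 : Nat.card (D.map (QuotientGroup.mk' N)) = N.relIndex D := by
    rw [← Subgroup.relIndex_ker, QuotientGroup.ker_mk']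
  rw [h1, ← Subgroup.relIndex_sup_right]
  exact (card_mul_relIdx le_sup_right).symm

theorem fac_bar [Finite G] {N : Subgroup G} [hN : N.Normal] (hM : MX N) {g : G} (hg : Gd N g) {r : ℕ} (hr : r.Prime) {a : G}
    (ha : a ∈ cen g) (haN : a ∉ N) (har : QEl r a) :
    (Nat.card (cen g)).factorization r = (Nat.card N).factorization r + (Nat.card (bar N g)).factorization r := by
  have h1 := S5 hM hg hr ha haN har
  have h2 := card_bar N (cen g)
  have h3 : Nat.card (cen g) * (cen g).relIndex (cen g ⊔ N) = Nat.card (cen g ⊔ N : Subgroup G) :=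
    card_mul_relIdx le_sup_left
  rw [h2] at h3
  have h4 : (cen g).relIndex (cen g ⊔ N) ≠ 0 := fun h => by simp [h] at h1
  have h5 := congrArg (fun n => n.factorization r) h3
  rw [Nat.factorization_mul Nat.card_pos.ne' h4, Nat.factorization_mul Nat.card_pos.ne' Nat.card_pos.ne'] at h5
  simp only [Finsupp.add_apply, Nat.factorization_eq_zero_of_not_dvd h1, add_zero] at h5
  exact h5

theorem el_of_fac [Finite G] (N D : Subgroup G) {r : ℕ} (hr : r.Prime)
    (h : (Nat.card N).factorization r < (Nat.card D).factorization r) : ∃ d ∈ D, QEl r d ∧ d ∉ N := by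
  by_contra hcon
  push Not at hcon
  have := tpart_dvd hr D N (Nat.ordProj_dvd (Nat.card D) r) hcon
  have := (hr.pow_dvd_iff_le_factorization Nat.card_pos.ne').1 this
  omega

theorem qel_dvd [Finite G] {r : ℕ} (hr : r.Prime) (D : Subgroup G) {a : G} (ha : a ∈ D) (ha1 : a ≠ 1) (har : QEl r a) :
    r ∣ Nat.card D := by
  obtain ⟨n, hn⟩ := har.orderOf_dvd
  obtain ⟨m, -, hm⟩ := (Nat.dvd_prime_pow hr).1 hn
  have h1 : orderOf a ∣ Nat.card D := by
    have := orderOf_dvd_natCard (⟨a, ha⟩ : D)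
    rwa [Subgroup.orderOf_mk] at this
  refine dvd_trans ?_ h1
  rw [hm]
  refine dvd_pow_self r ?_
  rintro rfl
  exact ha1 (orderOf_eq_one_iff.1 (by simpa using hm))

theorem bar_dvd [Finite G] {N : Subgroup G} [hN : N.Normal] {g : G} {r : ℕ} (hr : r.Prime) :
    r ∣ Nat.card (bar N g) ↔ ∃ a ∈ cen g, a ∉ N ∧ QEl r a := by
  constructor
  · intro h
    obtain ⟨z, hz, hzr, hz1⟩ := exists_qel_notMem hr _ h
    obtain ⟨z0, hz0, rfl⟩ := hz
    obtain ⟨m, hm1, hm2⟩ := lift_qel (QuotientGroup.mk' N) hr z0 hzr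
    refine ⟨z0 ^ m, pow_mem hz0 m, ?_, hm1⟩
    intro h
    exact hz1 (by rw [← hm2]; exact mk_eq_one h)
  · rintro ⟨a, ha, haN, har⟩
    exact qel_dvd hr (bar N g) ⟨a, ha, rfl⟩ (fun h => haN ((QuotientGroup.eq_one_iff a).1 h)) (har.map _)

theorem bar_fac [Finite G] {N : Subgroup G} [hN : N.Normal] (hM : MX N) {g : G} (hg : Gd N g) {r : ℕ} (hr : r.Prime) :
    (Nat.card (bar N g)).factorization r = (Nat.card (cen g)).factorization r - (Nat.card N).factorization r := by
  by_cases h : r ∣ Nat.card (bar N g)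
  · obtain ⟨a, ha, haN, har⟩ := (bar_dvd hr).1 h
    rw [fac_bar hM hg hr ha haN har]; omega
  · rw [Nat.factorization_eq_zero_of_not_dvd h]
    by_contra hne
    obtain ⟨d, hd, hdr, hdN⟩ := el_of_fac N (cen g) hr (by omega)
    exact h ((bar_dvd hr).2 ⟨d, hd, hdN, hdr⟩)

theorem bar_card_eq [Finite G] {N : Subgroup G} [hN : N.Normal] (hM : MX N) {g g' : G} (hg : Gd N g) (hg' : Gd N g')
    (hc : Nat.card (cen g) = Nat.card (cen g')) : Nat.card (bar N g) = Nat.card (bar N g') := by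
  refine Nat.eq_of_factorization_eq Nat.card_pos.ne' Nat.card_pos.ne' (fun r => ?_)
  by_cases hr : r.Prime
  · rw [bar_fac hM hg hr, bar_fac hM hg' hr, hc]
  · rw [Nat.factorization_eq_zero_of_not_prime _ hr, Nat.factorization_eq_zero_of_not_prime _ hr]

theorem Gd_mul {N : Subgroup G} {y d : G} {k r : ℕ} (hk : k.Prime) (hr : r.Prime) (hrk : r ≠ k) (hy : QEl k y) (hd : QEl r d)
    (hyN : y ∉ N) (hdN : d ∉ N) (hc : Commute y d) : Gd N (y * d) := by
  have key : ∀ (k r : ℕ) (y d : G), k.Prime → r.Prime → r ≠ k → QEl k y → QEl r d → y ∉ N → Commute y d →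
      ∀ p : ℕ, p.Prime → p ≠ k → (y * d) ^ p ∉ N := by
    intro k r y d hk hr hrk hy hd hyN hc p hp hpk h
    obtain ⟨i, hi⟩ := hy
    obtain ⟨j, hj⟩ := hd
    apply hyN
    refine pow_bezout (a := p * r ^ j) (b := k ^ i) ?_ ?_ (by rw [hi]; exact one_mem _)
    · refine Nat.Coprime.pow_right i (Nat.Coprime.mul_left ?_ (Nat.Coprime.pow_left j ?_))
      · exact (Nat.coprime_primes hp hk).2 hpk
      · exact (Nat.coprime_primes hr hk).2 hrk
    · have h1 := pow_mem h (r ^ j)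
      rw [← pow_mul, hc.mul_pow, mul_comm p, pow_mul d, hj, one_pow, mul_one, mul_comm] at h1
      exact h1
  intro p hp
  by_cases hpk : p = k
  · rw [hc.eq]
    exact key r k d y hr hk hrk.symm hd hy hdN hc.symm p hp (by rw [hpk]; exact hrk.symm)
  · exact key k r y d hk hr hrk hy hd hyN hc p hp hpk

theorem LemX [Finite G] {N : Subgroup G} [hN : N.Normal] (hM : MX N) {y : G} {k r : ℕ} (hk : k.Prime) (hr : r.Prime) (hrk : r ≠ k)
    (hy : QEl k y) (hyN : y ∉ N) (h : (Nat.card N).factorization r < (Nat.card (cen y)).factorization r) :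
    ∃ g, Gd N g ∧ cen g = cen y := by
  obtain ⟨d, hd, hdr, hdN⟩ := el_of_fac N (cen y) hr h
  have hc : Commute y d := (mem_cen.1 hd).symm
  refine ⟨y * d, Gd_mul hk hr hrk hy hdr hyN hdN hc, hM _ _ hyN ?_⟩
  rw [cen_mul hk hr hrk.symm hy hdr (mem_cen.2 hc)]
  exact inf_le_left

end Loc2


theorem prod_arith (S : Finset ℕ) (f a : ℕ → ℕ) (h : ∀ r ∈ S, ∀ k ∈ S, k ≠ r → f r < a r * a k)
    (h2 : ∃ r ∈ S, ∃ k ∈ S, k ≠ r) : ∏ r ∈ S, f r < (∏ r ∈ S, a r) ^ 2 := by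
  obtain ⟨r1, hr1, k1, hk1, hne1⟩ := h2
  obtain ⟨r0, hr0, hmin⟩ := S.exists_min_image a ⟨r1, hr1⟩
  obtain ⟨k, hk, hne⟩ : ∃ k ∈ S, k ≠ r0 := by
    by_cases e : k1 = r0
    · exact ⟨r1, hr1, fun e2 => hne1 (e.trans e2.symm)⟩
    · exact ⟨k1, hk1, e⟩
  have hpos : ∀ r ∈ S, 0 < a r := by
    intro r hr
    obtain ⟨k', hk', hne'⟩ : ∃ k' ∈ S, k' ≠ r := by
      by_cases e : r = r0
      · exact ⟨k, hk, e ▸ hne⟩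
      · exact ⟨r0, hr0, fun h => e h.symm⟩
    have := h r hr k' hk' hne'
    rcases Nat.eq_zero_or_pos (a r) with h0 | h0
    · simp [h0] at this
    · exact h0
  have hk' : k ∈ S.erase r0 := Finset.mem_erase.2 ⟨hne, hk⟩
  rw [← Finset.mul_prod_erase S f hr0, ← Finset.mul_prod_erase S a hr0,
    ← Finset.mul_prod_erase _ f hk', ← Finset.mul_prod_erase _ a hk']
  have h3 : ∏ r ∈ (S.erase r0).erase k, f r ≤ (∏ r ∈ (S.erase r0).erase k, a r) ^ 2 := by
    rw [← Finset.prod_pow]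
    refine Finset.prod_le_prod' (fun r hr => ?_)
    have hr2 := Finset.mem_of_mem_erase hr
    have hr3 := Finset.mem_of_mem_erase hr2
    have := h r hr3 r0 hr0 (Finset.ne_of_mem_erase hr2).symm
    have := Nat.mul_le_mul_left (a r) (hmin r hr3)
    rw [pow_two]; omega
  have h4 : 0 < ∏ r ∈ (S.erase r0).erase k, a r :=
    Finset.prod_pos (fun r hr => hpos r (Finset.mem_of_mem_erase (Finset.mem_of_mem_erase hr)))
  have h5 := h r0 hr0 k hk hne
  have h6 := h k hk r0 hr0 hne.symm
  have h7 : f r0 * f k < (a r0 * a k) * (a k * a r0) := Nat.mul_lt_mul'' h5 h6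
  calc f r0 * (f k * ∏ r ∈ (S.erase r0).erase k, f r) = (f r0 * f k) * ∏ r ∈ (S.erase r0).erase k, f r := by ring
    _ ≤ (f r0 * f k) * (∏ r ∈ (S.erase r0).erase k, a r) ^ 2 := Nat.mul_le_mul_left _ h3
    _ < (a r0 * a k) * (a k * a r0) * (∏ r ∈ (S.erase r0).erase k, a r) ^ 2 :=
        Nat.mul_lt_mul_of_pos_right h7 (by positivity)
    _ = _ := by ring

theorem arith2 (m α : ℕ) (hm : m ≠ 0) (hα : α ≠ 0) (hd : ∀ r, r.Prime → r ∣ m → r ∣ α)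
    (h : ∀ r k, r.Prime → k.Prime → r ∣ m → k ∣ m → k ≠ r →
      r ^ m.factorization r < r ^ α.factorization r * k ^ α.factorization k)
    (h2 : ∃ r k, r.Prime ∧ k.Prime ∧ r ∣ m ∧ k ∣ m ∧ k ≠ r) : m < α ^ 2 := by
  have key := prod_arith m.primeFactors (fun r => r ^ m.factorization r) (fun r => r ^ α.factorization r)
    (fun r hr k hk hne => h r k (Nat.prime_of_mem_primeFactors hr) (Nat.prime_of_mem_primeFactors hk)
      (Nat.dvd_of_mem_primeFactors hr) (Nat.dvd_of_mem_primeFactors hk) hne) (by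
      obtain ⟨r, k, h1, h2, h3, h4, h5⟩ := h2
      exact ⟨r, Nat.mem_primeFactors.2 ⟨h1, h3, hm⟩, k, Nat.mem_primeFactors.2 ⟨h2, h4, hm⟩, h5⟩)
  have e1 : ∏ r ∈ m.primeFactors, r ^ m.factorization r = m := by
    have := Nat.prod_factorization_pow_eq_self hm
    rwa [Finsupp.prod, Nat.support_factorization] at this
  have e2 : ∏ r ∈ α.primeFactors, r ^ α.factorization r = α := by
    have := Nat.prod_factorization_pow_eq_self hα
    rwa [Finsupp.prod, Nat.support_factorization] at this
  have hsub : m.primeFactors ⊆ α.primeFactors := by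
    intro r hr
    obtain ⟨h1, h3, -⟩ := Nat.mem_primeFactors.1 hr
    exact Nat.mem_primeFactors.2 ⟨h1, hd r h1 h3, hα⟩
  have h3 := Finset.prod_dvd_prod_of_subset _ _ (fun r => r ^ α.factorization r) hsub
  rw [e2] at h3
  rw [e1] at key
  exact key.trans_le (Nat.pow_le_pow_left (Nat.le_of_dvd (Nat.pos_of_ne_zero hα) h3) 2)

section Part
variable {Γ : Type*} [Group Γ]

/-- number of k-elements in an abelian subgroup -/
theorem abel_count [Finite Γ] (A : Subgroup Γ) (hA : ∀ x ∈ A, ∀ y ∈ A, Commute x y) {k : ℕ} (hk : k.Prime) :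
    Nat.card {y : Γ // y ∈ A ∧ QEl k y} ≤ k ^ (Nat.card A).factorization k := by
  have := Fact.mk hk
  let P : Sylow k A := default
  rw [← P.card_eq_multiplicity]
  have hn : (P : Subgroup A).Normal := ⟨fun n hn g => by
    have : g * n * g⁻¹ = n := by
      have h1 : Commute (g : Γ) n := hA _ g.2 _ n.2
      ext; simp [h1.eq]
    rw [this]; exact hn⟩
  have hs := Sylow.unique_of_normal P hn
  have hmem : ∀ y : Γ, ∀ h : y ∈ A, QEl k y → (⟨y, h⟩ : A) ∈ P := by
    intro y h hy
    have hq : QEl k (⟨y, h⟩ : A) := by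
      obtain ⟨n, hn⟩ := hy
      exact ⟨n, Subtype.ext (by simpa using hn)⟩
    obtain ⟨Q, hQ⟩ := hq.isPGroup.exists_le_sylow
    have e : Q = P := Subsingleton.elim _ _
    rw [← e]; exact hQ (Subgroup.mem_zpowers _)
  refine Nat.card_le_card_of_injective (fun y : {y : Γ // y ∈ A ∧ QEl k y} => (⟨⟨y.1, y.2.1⟩, hmem _ _ y.2.2⟩ : P)) ?_
  intro y z h
  have := congrArg (fun t : P => ((t : A) : Γ)) h
  exact Subtype.ext this

theorem fib_le {X Y : Type*} [Finite X] [Finite Y] (f : X → Y) (c : ℕ)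
    (hf : ∀ x, Nat.card {x' // f x' = f x} ≤ c) : Nat.card X ≤ c * Nat.card Y := by
  classical
  have := Fintype.ofFinite X
  have := Fintype.ofFinite Y
  have h1 := Finset.card_le_mul_card_image (f := f) Finset.univ c (by
    intro a ha
    obtain ⟨x, -, rfl⟩ := Finset.mem_image.1 ha
    have := hf x
    rwa [Nat.card_eq_fintype_card, Fintype.card_subtype] at this)
  rw [Nat.card_eq_fintype_card, Nat.card_eq_fintype_card]
  exact h1.trans (Nat.mul_le_mul_left c (Finset.card_le_univ _))

theorem PART [Finite Γ] (C : Set (Subgroup Γ)) (α : ℕ) (p1 : ∀ x : Γ, x ≠ 1 → ∃ A ∈ C, x ∈ A)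
    (p2 : ∀ A ∈ C, ∀ B ∈ C, ∀ x, x ≠ 1 → x ∈ A → x ∈ B → A = B)
    (p3 : ∀ A ∈ C, ∀ k : Γ, ∃ B ∈ C, ∀ x ∈ A, k * x * k⁻¹ ∈ B)
    (p4 : ∀ A ∈ C, ∀ x ∈ A, ∀ y ∈ A, Commute x y)
    (p5 : ∀ A ∈ C, Nat.card A = α) (p6 : ∀ r, r.Prime → r ∣ Nat.card Γ → r ∣ α)
    (p7 : ∃ r k, r.Prime ∧ k.Prime ∧ r ∣ Nat.card Γ ∧ k ∣ Nat.card Γ ∧ k ≠ r) : ∀ A ∈ C, A = ⊤ := by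
  -- coprime commuting elements lie in the same component
  have hcop : ∀ A ∈ C, ∀ (r k : ℕ) (u b : Γ), r.Prime → k.Prime → k ≠ r → QEl r u → QEl k b → b ≠ 1 → b ∈ A → Commute u b → u ∈ A := by
    intro A hA r k u b hr hk hkr hu hb hb1 hbA hc
    have e : ∀ K : Subgroup Γ, u * b ∈ K → b ∈ K ∧ u ∈ K := by
      intro K hK
      obtain ⟨i, hi⟩ := hu
      obtain ⟨j, hj⟩ := hb
      have hbK : b ∈ K := by
        refine pow_bezout (a := r ^ i) (b := k ^ j) (Nat.Coprime.pow _ _ ((Nat.coprime_primes hr hk).2 hkr.symm)) ?_ (by rw [hj]; exact one_mem _)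
        have := pow_mem hK (r ^ i)
        rwa [hc.mul_pow, hi, one_mul] at this
      exact ⟨hbK, (Subgroup.mul_mem_cancel_right K hbK).1 hK⟩
    have h1 : u * b ≠ 1 := by
      intro h
      have := (e ⊥ (by rw [h]; exact one_mem _)).1
      exact hb1 (Subgroup.mem_bot.1 this)
    obtain ⟨B, hB, hBm⟩ := p1 _ h1
    obtain ⟨h2, h3⟩ := e B hBm
    rw [p2 A hA B hB b hb1 hbA h2]; exact h3
  have hlt : Nat.card Γ < α ^ 2 := by
    have p7c := p7
    obtain ⟨r0, _, hr0, _, hr0d, _⟩ := p7c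
    have hα : α ≠ 0 := by
      obtain ⟨y, _, _, hy⟩ := exists_qel_notMem hr0 (⊤ : Subgroup Γ) (by rwa [Subgroup.card_top])
      obtain ⟨A, hA, -⟩ := p1 y hy
      rw [← p5 A hA]; exact Nat.card_pos.ne'
    refine arith2 _ _ Nat.card_pos.ne' hα p6 ?_ p7
    intro r k hr hk hrd hkd hkr
    have := Fact.mk hr
    let L : Sylow r Γ := default
    have hLc : Nat.card L = r ^ (Nat.card Γ).factorization r := L.card_eq_multiplicity
    have hLnt : Nontrivial L := by
      rw [← Finite.one_lt_card_iff_nontrivial, hLc]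
      refine Nat.one_lt_pow ?_ hr.one_lt
      exact (hr.factorization_pos_of_dvd Nat.card_pos.ne' hrd).ne'
    have hZ := L.isPGroup'.center_nontrivial
    obtain ⟨z, hz⟩ := exists_ne (1 : Subgroup.center L)
    have hz1 : ((z : L) : Γ) ≠ 1 := by
      intro h; apply hz; ext; simpa using h
    have hzc : ∀ u ∈ L, u * ((z : L) : Γ) * u⁻¹ = ((z : L) : Γ) := by
      intro u hu
      have := Subgroup.mem_center_iff.1 z.2 ⟨u, hu⟩
      have := congrArg Subtype.val this
      simp only [Subgroup.coe_mul] at this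
      rw [mul_inv_eq_iff_eq_mul]; exact this
    obtain ⟨A, hA, hzA⟩ := p1 _ hz1
    have hnorm : ∀ u ∈ L, ∀ x ∈ A, u * x * u⁻¹ ∈ A := by
      intro u hu
      obtain ⟨B, hB, h⟩ := p3 A hA u
      have h1 := h _ hzA
      rw [hzc u hu] at h1
      rw [p2 A hA B hB _ hz1 hzA h1]
      rw [p2 A hA B hB _ hz1 hzA h1] at h
      exact h
    obtain ⟨b, hbA, hbk, hb1⟩ := exists_qel_notMem hk A (by rw [p5 A hA]; exact p6 k hk hkd)
    let T := {y : {y : Γ // y ∈ A ∧ QEl k y} // y.1 ≠ 1}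
    let f : L → T := fun u => ⟨⟨u * b * (u : Γ)⁻¹, hnorm u u.2 b hbA, hbk.conj u⟩, by
      intro h; apply hb1
      have h' : (u : Γ) * b * (u : Γ)⁻¹ = 1 := h
      simpa using h'⟩
    have h1 : Nat.card L ≤ r ^ α.factorization r * Nat.card T := by
      refine fib_le f _ (fun u => ?_)
      refine le_trans (Nat.card_le_card_of_injective (fun p : {u' // f u' = f u} =>
        (⟨((p.1 : Γ))⁻¹ * u, ?_, ?_⟩ : {y : Γ // y ∈ A ∧ QEl r y})) ?_) (p5 A hA ▸ abel_count A (p4 A hA) hr)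
      · obtain ⟨u', h⟩ := p
        have h2 : (u' : Γ) * b * (u' : Γ)⁻¹ = u * b * (u : Γ)⁻¹ := congrArg (fun t : T => t.1.1) h
        refine hcop A hA r k _ b hr hk hkr (QEl.of_isPGroup L.isPGroup' (mul_mem (inv_mem u'.2) u.2)) hbk hb1 hbA ?_
        show (u' : Γ)⁻¹ * u * b = b * ((u' : Γ)⁻¹ * u)
        have h3 : (u : Γ) * b = u' * b * (u' : Γ)⁻¹ * u := by rw [h2]; group
        rw [mul_assoc, h3]; group
      · exact QEl.of_isPGroup L.isPGroup' (mul_mem (inv_mem p.1.2) u.2)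
      · rintro ⟨u1, h1⟩ ⟨u2, h2⟩ h
        have := congrArg Subtype.val h
        simp only [mul_left_inj, inv_inj] at this
        exact Subtype.ext (Subtype.ext this)
    have h2 : Nat.card T < k ^ α.factorization k := by
      refine lt_of_lt_of_le ?_ (p5 A hA ▸ abel_count A (p4 A hA) hk)
      exact Finite.card_subtype_lt (x := ⟨1, one_mem _, 0, by simp⟩) (by simp)
    rw [← hLc]
    exact h1.trans_lt (Nat.mul_lt_mul_of_pos_left h2 (pow_pos hr.pos _))
  have heq : ∀ A ∈ C, ∀ B ∈ C, A = B := by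
    intro A hA B hB
    by_contra hne
    have h1 : Nat.card (A × B) ≤ Nat.card Γ := by
      refine Nat.card_le_card_of_injective (fun p : A × B => (p.1 : Γ) * p.2) ?_
      rintro ⟨a, b⟩ ⟨a', b'⟩ h
      have h' : (a : Γ) * b = a' * b' := h
      have h2 : (a' : Γ)⁻¹ * a = b' * (b : Γ)⁻¹ := by
        rw [inv_mul_eq_iff_eq_mul, ← mul_assoc, ← h']; group
      have h3 : (a' : Γ)⁻¹ * a = 1 := by
        by_contra h4
        exact hne (p2 A hA B hB _ h4 (mul_mem (inv_mem a'.2) a.2) (by rw [h2]; exact mul_mem b'.2 (inv_mem b.2)))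
      have h4 : (a : Γ) = a' := (inv_mul_eq_one.1 h3).symm
      rw [h3] at h2
      have h5 : (b' : Γ) = b := mul_inv_eq_one.1 h2.symm
      ext
      · exact h4
      · exact h5.symm
    rw [Nat.card_prod, p5 A hA, p5 B hB, ← pow_two] at h1
    omega
  intro A hA
  rw [eq_top_iff]
  intro x _
  by_cases hx : x = 1
  · rw [hx]; exact one_mem _
  · obtain ⟨B, hB, h⟩ := p1 x hx
    rw [heq A hA B hB]; exact h

end Part


section Loc3
variable {G : Type*} [Group G]

theorem mem_bar {N : Subgroup G} [hN : N.Normal] {g x : G} : QuotientGroup.mk' N x ∈ bar N g ↔ x ∈ cen g ⊔ N := by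
  have : (bar N g).comap (QuotientGroup.mk' N) = cen g ⊔ N := by
    rw [bar, Subgroup.comap_map_eq, QuotientGroup.ker_mk']
  rw [← this, Subgroup.mem_comap]

theorem Gd_conj {N : Subgroup G} [hN : N.Normal] {g : G} (hg : Gd N g) (k : G) : Gd N (k * g * k⁻¹) := by
  intro r hr h
  rw [conj_pow] at h
  have := hN.conj_mem _ h k⁻¹
  exact hg r hr (by simpa [mul_assoc] using this)

theorem bar_le [Finite G] {N : Subgroup G} [hN : N.Normal] (hM : MX N) {g g' : G} (hg : Gd N g) (hg' : Gd N g') {x : G}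
    (h1 : x ∈ cen g ⊔ N) (h2 : x ∈ cen g' ⊔ N) (hx : x ∉ N) : bar N g ≤ bar N g' := by
  obtain ⟨n, hn, a, ha, haN, e⟩ := TI hM hg h1 hx
  obtain ⟨n', hn', a', ha', haN', e'⟩ := TI hM hg' h2 hx
  rintro _ ⟨b, hb, rfl⟩
  have h3 : n * b * n⁻¹ ∈ cen x := by
    rw [e, mem_cen_conj, S2 hM hg ha haN]; exact hb
  rw [e', mem_cen_conj', S2 hM hg' ha' haN'] at h3
  have h4 : QuotientGroup.mk' N (n'⁻¹ * (n * b * n⁻¹) * n') = QuotientGroup.mk' N b := by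
    simp only [map_mul, map_inv, mk_eq_one hn, mk_eq_one hn']; simp
  rw [← h4]; exact ⟨_, h3, rfl⟩

theorem bar_pos [Finite G] {N : Subgroup G} [hN : N.Normal] (hM : MX N) {g : G} (hg : Gd N g) {r : ℕ} (hr : r.Prime) :
    r ∣ Nat.card (bar N g) ↔ (Nat.card N).factorization r < (Nat.card (cen g)).factorization r := by
  have h := bar_fac hM hg hr
  constructor
  · intro h1
    have := hr.factorization_pos_of_dvd Nat.card_pos.ne' h1
    omega
  · intro h1
    by_contra h2
    rw [Nat.factorization_eq_zero_of_not_dvd h2] at h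
    omega

theorem bar_prime [Finite G] {N : Subgroup G} [hN : N.Normal] {g : G} (hg : g ∉ N) :
    ∃ r, r.Prime ∧ r ∣ Nat.card (bar N g) := by
  refine Nat.exists_prime_and_dvd (fun h => ?_)
  have h1 := Subgroup.eq_bot_of_card_eq _ h
  have h2 : QuotientGroup.mk' N g ∈ bar N g := ⟨g, self_mem_cen g, rfl⟩
  rw [h1, Subgroup.mem_bot] at h2
  exact hg ((QuotientGroup.eq_one_iff g).1 h2)

theorem caseA [Finite G] {N : Subgroup G} [hN : N.Normal] (hM : MX N) (hc : ∀ g h, g ∉ N → h ∉ N → Nat.card (cen g) = Nat.card (cen h))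
    {g : G} (hg : Gd N g)
    (p7 : ∃ r k, r.Prime ∧ k.Prime ∧ r ∣ Nat.card (G ⧸ N) ∧ k ∣ Nat.card (G ⧸ N) ∧ k ≠ r) : bar N g = ⊤ := by
  have hp : ∀ k, k.Prime → k ∣ Nat.card (G ⧸ N) → (Nat.card N).factorization k < (Nat.card (cen g)).factorization k := by
    obtain ⟨r0, hr0, hr0d⟩ := bar_prime (N := N) hg.notMem
    have h0 := (bar_pos hM hg hr0).1 hr0d
    intro k hk hkd
    by_cases e : r0 = k
    · rwa [← e]
    obtain ⟨z, -, hzk, hz1⟩ := exists_qel_notMem hk (⊤ : Subgroup (G ⧸ N)) (by rwa [Subgroup.card_top])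
    obtain ⟨z0, rfl⟩ := QuotientGroup.mk'_surjective N z
    obtain ⟨m, hm1, hm2⟩ := lift_qel (QuotientGroup.mk' N) hk z0 hzk
    have hyN : z0 ^ m ∉ N := fun h => hz1 (by rw [← hm2]; exact mk_eq_one h)
    obtain ⟨g', hg', e'⟩ := LemX hM hk hr0 e hm1 hyN (by rw [hc _ g hyN hg.notMem]; exact h0)
    have h1 : k ∣ Nat.card (bar N g') := (bar_dvd hk).2 ⟨z0 ^ m, by rw [e']; exact self_mem_cen _, hyN, hm1⟩
    rw [hc g g' hg.notMem hg'.notMem]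
    exact (bar_pos hM hg' hk).1 h1
  refine PART {A | ∃ g', Gd N g' ∧ A = bar N g'} (Nat.card (bar N g)) ?_ ?_ ?_ ?_ ?_ ?_ p7 _ ⟨g, hg, rfl⟩
  · intro x hx
    obtain ⟨h, rfl⟩ := QuotientGroup.mk'_surjective N x
    have hhN : h ∉ N := fun h1 => hx (mk_eq_one h1)
    obtain ⟨q, n, hq, hqn, hnN⟩ : ∃ q n : ℕ, q.Prime ∧ QEl q (h ^ n) ∧ h ^ n ∉ N := by
      by_contra hcon
      push Not at hcon
      exact hhN (mem_of_primeparts N h (fun q n hq h1 => hcon q n hq h1))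
    obtain ⟨r, hr, hrd, hrq⟩ : ∃ r, r.Prime ∧ r ∣ Nat.card (G ⧸ N) ∧ r ≠ q := by
      obtain ⟨r, k, h1, h2, h3, h4, h5⟩ := p7
      by_cases e : r = q
      · exact ⟨k, h2, h4, e ▸ h5⟩
      · exact ⟨r, h1, h3, e⟩
    obtain ⟨g', hg', e'⟩ := LemX hM hq hr hrq hqn hnN (by rw [hc _ g hnN hg.notMem]; exact hp r hr hrd)
    refine ⟨bar N g', ⟨g', hg', rfl⟩, h, ?_, rfl⟩
    rw [e']
    exact mem_cen.2 ((Commute.refl h).pow_right n)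
  · rintro _ ⟨g1, hg1, rfl⟩ _ ⟨g2, hg2, rfl⟩ x hx h1 h2
    obtain ⟨h, rfl⟩ := QuotientGroup.mk'_surjective N x
    have hhN : h ∉ N := fun h1 => hx (mk_eq_one h1)
    rw [mem_bar] at h1 h2
    exact le_antisymm (bar_le hM hg1 hg2 h1 h2 hhN) (bar_le hM hg2 hg1 h2 h1 hhN)
  · rintro _ ⟨g1, hg1, rfl⟩ k
    obtain ⟨k0, rfl⟩ := QuotientGroup.mk'_surjective N k
    refine ⟨bar N (k0 * g1 * k0⁻¹), ⟨_, Gd_conj hg1 k0, rfl⟩, ?_⟩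
    rintro _ ⟨x, hx, rfl⟩
    exact ⟨k0 * x * k0⁻¹, mem_cen_conj.2 hx, by simp only [map_mul, map_inv]⟩
  · rintro _ ⟨g1, hg1, rfl⟩ _ ⟨x, hx, rfl⟩ _ ⟨y, hy, rfl⟩
    exact (S1c hM hg1 hx hy).map _
  · rintro _ ⟨g1, hg1, rfl⟩
    exact bar_card_eq hM hg1 hg (hc _ _ hg1.notMem hg.notMem)
  · intro r hr hrd
    exact (bar_pos hM hg hr).2 (hp r hr hrd)

theorem caseB_normal [Finite G] {N : Subgroup G} [hN : N.Normal] (hM : MX N) {g : G} (hg : Gd N g) {r : ℕ} (hr : r.Prime)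
    (hp : IsPGroup r (G ⧸ N)) : (cen g ⊔ N).Normal := by
  have := Fact.mk hr
  have hnt : Nontrivial (G ⧸ N) := ⟨QuotientGroup.mk' N g, 1, fun h => hg.notMem ((QuotientGroup.eq_one_iff g).1 h)⟩
  have hZ := hp.center_nontrivial
  obtain ⟨⟨z, hzc⟩, hz⟩ := exists_ne (1 : Subgroup.center (G ⧸ N))
  have hz1 : z ≠ 1 := fun h => hz (Subtype.ext h)
  obtain ⟨z0, rfl⟩ := QuotientGroup.mk'_surjective N z
  have hz0 : z0 ∉ N := fun h => hz1 (mk_eq_one h)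
  have hcz := Subgroup.mem_center_iff.1 hzc
  obtain ⟨n, hn, a, ha, haN, e⟩ := TI hM hg (CG hM hg (hcz (QuotientGroup.mk' N g)).symm) hz0
  have e2 : QuotientGroup.mk' N a = QuotientGroup.mk' N z0 := by
    rw [e]; simp only [map_mul, map_inv, mk_eq_one hn]; simp
  refine ⟨fun x hx y => ?_⟩
  have h1 : y * a * y⁻¹ ∈ cen g ⊔ N := by
    rw [← mem_bar, map_mul, map_mul, map_inv, e2, hcz, mul_inv_cancel_right, ← e2]
    exact ⟨a, ha, rfl⟩
  obtain ⟨v, hv, w, rfl, -, hw⟩ := S7 hM hg ha haN h1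
  rw [← mem_bar] at hx ⊢
  obtain ⟨b, hb, hbx⟩ := hx
  simp only [map_mul, mul_inv_rev, mk_eq_one hv, map_inv]
  rw [← hbx]
  refine ⟨w * b * w⁻¹, (hw b).2 hb, ?_⟩
  simp only [map_mul, map_inv]; simp

theorem card_pgroup {Γ : Type*} [Group Γ] [Finite Γ] {r : ℕ} (hr : r.Prime) (hp : IsPGroup r Γ) (D : Subgroup Γ) :
    Nat.card D = r ^ (Nat.card D).factorization r := by
  have := Fact.mk hr
  obtain ⟨n, hn⟩ := IsPGroup.iff_card.1 (hp.to_subgroup D)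
  rw [hn, hr.factorization_pow]; simp

theorem caseB_D [Finite G] {N : Subgroup G} [hN : N.Normal] (hM : MX N) {g : G} (hg : Gd N g) {r : ℕ} (hr : r.Prime)
    (hp : IsPGroup r (G ⧸ N)) (D : Subgroup G) (hD : r ^ (Nat.card (cen g)).factorization r ∣ Nat.card D) :
    ∃ d ∈ D, d ∈ cen g ⊔ N ∧ d ∉ N := by
  have hn := caseB_normal hM hg hr hp
  by_contra hcon
  push Not at hcon
  let D' := D.map (QuotientGroup.mk' N)
  have h1 : Nat.card (bar N g) ≤ Nat.card D' := by
    rw [card_pgroup hr hp (bar N g), card_pgroup hr hp D']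
    refine Nat.pow_le_pow_right hr.pos ?_
    rw [bar_fac hM hg hr]
    have h2 := card_bar N D
    have h3 : r ^ (Nat.card (cen g)).factorization r ∣ Nat.card (D ⊔ N : Subgroup G) :=
      hD.trans (Subgroup.card_dvd_of_le le_sup_left)
    rw [hr.pow_dvd_iff_le_factorization Nat.card_pos.ne', h2, Nat.factorization_mul Nat.card_pos.ne' Nat.card_pos.ne',
      Finsupp.add_apply] at h3
    have : (Nat.card D').factorization r = (Nat.card (D.map (QuotientGroup.mk' N))).factorization r := rfl
    omega
  let γ := QuotientGroup.mk' N g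
  have hγ : γ ≠ 1 := fun h => hg.notMem ((QuotientGroup.eq_one_iff g).1 h)
  let f : D' → {t : bar N g // (t : G ⧸ N) ≠ 1} := fun t => ⟨⟨t * γ * (t : G ⧸ N)⁻¹, by
    obtain ⟨t, ht⟩ := t
    obtain ⟨y, rfl⟩ := QuotientGroup.mk'_surjective N t
    show QuotientGroup.mk' N y * QuotientGroup.mk' N g * (QuotientGroup.mk' N y)⁻¹ ∈ bar N g
    rw [← map_inv, ← map_mul, ← map_mul, mem_bar]
    exact hn.conj_mem _ (Subgroup.mem_sup_left (self_mem_cen g)) y⟩, by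
    intro h
    have h' : (t : G ⧸ N) * γ * (t : G ⧸ N)⁻¹ = 1 := h
    exact hγ (by simpa using h')⟩
  have hf : Function.Injective f := by
    rintro ⟨t, ht⟩ ⟨u, hu⟩ h
    have h2 : t * γ * t⁻¹ = u * γ * u⁻¹ := congrArg (fun x => x.1.1) h
    have h3 : u⁻¹ * t ∈ D' := mul_mem (inv_mem hu) ht
    have h4 : Commute (u⁻¹ * t) γ := by
      show u⁻¹ * t * γ = γ * (u⁻¹ * t)
      have : t * γ = u * γ * u⁻¹ * t := by rw [← h2]; group
      rw [mul_assoc, this]; group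
    obtain ⟨d, hd, hde⟩ := h3
    rw [← hde] at h4
    have h5 := hcon d hd (CG hM hg h4)
    rw [mk_eq_one h5] at hde
    exact Subtype.ext (inv_mul_eq_one.1 hde.symm).symm
  have h2 := Nat.card_le_card_of_injective f hf
  have h3 : Nat.card {t : bar N g // (t : G ⧸ N) ≠ 1} < Nat.card (bar N g) :=
    Finite.card_subtype_lt (x := 1) (by simp)
  omega

theorem STR [Finite G] {N : Subgroup G} [hN : N.Normal] (hM : MX N) (hc : ∀ g h, g ∉ N → h ∉ N → Nat.card (cen g) = Nat.card (cen h))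
    (hs : Group.IsSolvable N) {g : G} (hg : Gd N g) :
    Group.IsSolvable G ∧ ∀ r, r.Prime → r ∣ Nat.card (bar N g) → ∀ D : Subgroup G,
      r ^ (Nat.card (cen g)).factorization r ∣ Nat.card D → ∃ d ∈ D, d ∈ cen g ⊔ N ∧ d ∉ N := by
  have hsol : Group.IsSolvable (G ⧸ N) → Group.IsSolvable G := by
    intro h
    have h2 : Group.IsSolvable (⊤ : Subgroup G) := by
      refine solvable_of_map (QuotientGroup.mk' N) ⊤ N inferInstance hs ?_
      intro m _ h; exact (QuotientGroup.eq_one_iff m).1 h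
    exact Group.isSolvable_of_surjective (f := (Subgroup.topEquiv (G := G)).toMonoidHom) (Subgroup.topEquiv (G := G)).surjective
  by_cases p7 : ∃ r k, r.Prime ∧ k.Prime ∧ r ∣ Nat.card (G ⧸ N) ∧ k ∣ Nat.card (G ⧸ N) ∧ k ≠ r
  · have ht := caseA hM hc hg p7
    constructor
    · apply hsol
      refine Group.isSolvable_of_comm (fun x y => ?_)
      have hx : x ∈ bar N g := by rw [ht]; trivial
      have hy : y ∈ bar N g := by rw [ht]; trivial
      obtain ⟨x, hx, rfl⟩ := hx
      obtain ⟨y, hy, rfl⟩ := hy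
      exact (S1c hM hg hx hy).map (QuotientGroup.mk' N)
    · intro r hr hrd D hD
      obtain ⟨d, hd, -, hdN⟩ := el_of_fac N D hr
        (lt_of_lt_of_le ((bar_pos hM hg hr).1 hrd) ((hr.pow_dvd_iff_le_factorization Nat.card_pos.ne').1 hD))
      exact ⟨d, hd, by rw [← mem_bar, ht]; trivial, hdN⟩
  · push Not at p7
    obtain ⟨r0, hr0, hr0d⟩ := bar_prime (N := N) hg.notMem
    have hr0d' := hr0d.trans (Subgroup.card_subgroup_dvd_card (bar N g))
    have hp : IsPGroup r0 (G ⧸ N) :=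
      IsPGroup.of_card (Nat.eq_prime_pow_of_unique_prime_dvd Nat.card_pos.ne' (fun {d} h1 h2 => p7 r0 d hr0 h1 hr0d' h2))
    constructor
    · apply hsol
      have := Fact.mk hr0
      have := IsPGroup.isNilpotent hp
      infer_instance
    · intro r hr hrd D hD
      have e := p7 r0 r hr0 hr hr0d' (hrd.trans (Subgroup.card_subgroup_dvd_card (bar N g)))
      subst e
      exact caseB_D hM hg hr hp D hD

end Loc3


section Fin
variable {G : Type*} [Group G]

theorem claimR [Finite G] {N : Subgroup G} [hN : N.Normal] (hM : MX N) {g : G} (hg : Gd N g) {h : G} (hh : h ∈ N)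
    (hd : ∃ d ∈ cen h, d ∈ cen g ⊔ N ∧ d ∉ N) : ∃ n ∈ N, n⁻¹ * h * n ∈ cen g := by
  obtain ⟨d, hd1, hd2, hd3⟩ := hd
  obtain ⟨n, hn, a, ha, haN, rfl⟩ := TI hM hg hd2 hd3
  refine ⟨n, hn, ?_⟩
  have := mem_cen_comm.1 hd1
  rwa [mem_cen_conj', S2 hM hg ha haN] at this

theorem claimW [Finite G] (hM : MX (fitting2 G)) {g : G} (hg : Gd (fitting2 G) g) {h : G} (hh : h ∈ fitting2 G)
    {w k : ℕ} (hw : w.Prime) (hwd : w ∣ Nat.card (bar (fitting2 G) g)) (hk : clz h = w ^ k) :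
    ∃ v ∈ fittingSubgroup G, v⁻¹ * h ∈ cen g := by
  have hF := fit_nil (G := G)
  have hNs := fitting2_solvable (G := G)
  obtain ⟨a, ha, haN, haw⟩ := (bar_dvd hw).1 hwd
  have h5 := S5 hM hg hw ha haN haw
  set N := fitting2 G with hNdef
  set F := fittingSubgroup G with hFdef
  have hFN : F ≤ N := fitting_le_fitting2
  set c := h * g * h⁻¹ * g⁻¹ with hc
  have hcN : c ∈ N := by
    have h1 := mul_mem hh ((inferInstance : N.Normal).conj_mem _ (inv_mem hh) g)
    convert h1 using 1; rw [hc]; group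
  have hcF : ∀ x ∈ F, x ∈ cen c := by
    intro x hx
    refine mem_of_primeparts (cen c) x (fun q n hq hqn => ?_)
    have hxF := pow_mem hx n
    obtain ⟨P, hPn, hPq, hPF, hP⟩ := nil_sylow hq F hF
    have hxP := hP _ hxF hqn
    by_cases e : q = w
    · subst e
      have hPA : P ≤ cen g := by
        obtain ⟨γ, hγ⟩ := conj_into (G := (cen g ⊔ N : Subgroup G)) hq (P.subgroupOf (cen g ⊔ N)) ((cen g).subgroupOf (cen g ⊔ N))
          (hPq.comap_of_injective _ (Subgroup.subtype_injective _)) h5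
        intro y hy
        have h1 := hPn.conj_mem _ hy γ
        have h2 := hγ ⟨γ * y * (γ : G)⁻¹, Subgroup.mem_sup_right (hFN (hPF h1))⟩ h1
        rw [Subgroup.mem_subgroupOf] at h2
        simpa [mul_assoc] using h2
      have c1 : Commute (x ^ n) g := mem_cen.1 (hPA hxP)
      have c2 : Commute (x ^ n) (h * g * h⁻¹) := by
        have h1 := hPn.conj_mem _ hxP h⁻¹
        rw [inv_inv] at h1
        exact mem_cen.1 (mem_cen_conj'.2 (hPA h1))
      exact mem_cen.2 (c2.mul_right c1.inv_right)
    · have hPw : ¬ w ∣ Nat.card P := by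
        intro hd
        obtain ⟨y, hy, hyw, hy1⟩ := exists_qel_notMem hw P hd
        exact hy1 (QEl.eq_one hq hw e (QEl.of_isPGroup hPq hy) hyw)
      have hPh : P ≤ cen h := CQ hw (dvd_of_eq hk) P hPw
      have c1 : Commute (x ^ n) h := mem_cen.1 (hPh hxP)
      have c2 : Commute (x ^ n) (g * h * g⁻¹) := by
        have h1 := hPn.conj_mem _ hxP g⁻¹
        rw [inv_inv] at h1
        exact mem_cen.1 (mem_cen_conj'.2 (hPh h1))
      have c3 := c1.mul_right c2.inv_right
      have e3 : h * (g * h * g⁻¹)⁻¹ = c := by rw [hc]; group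
      rw [e3] at c3
      exact mem_cen.2 c3
  have hcF2 : c ∈ F := by
    let Z := Subgroup.centralizer (F : Set G) ⊓ N
    have hZs : Group.IsSolvable Z := Group.isSolvable_of_isSolvable_injective (Subgroup.inclusion_injective (inf_le_right : Z ≤ N))
    have hZF : Z ≤ F := by
      refine cent_fit Z hZs ?_
      rw [Subgroup.commutator_comm, Subgroup.commutator_eq_bot_iff_le_centralizer]
      exact inf_le_left
    refine hZF (Subgroup.mem_inf.2 ⟨?_, hcN⟩)
    rw [Subgroup.mem_centralizer_iff]
    intro x hx
    exact mem_cen.1 (hcF x hx)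
  obtain ⟨v, hv, b, hb, hbg, e⟩ := S4 hM hg F hFN (self_mem_cen g) hg.notMem (y := h * g * h⁻¹) (by
    have := (inferInstance : F.Normal).conj_mem _ hcF2 g⁻¹
    convert this using 1; rw [hc]; group)
  refine ⟨v, hv, S3' hM hg (self_mem_cen g) hg.notMem (w := v⁻¹ * h) ?_ ?_⟩
  · have e2 : v⁻¹ * h * g * (v⁻¹ * h)⁻¹ = v⁻¹ * (h * g * h⁻¹) * v := by group
    rw [e2, e]
    have e3 : v⁻¹ * (v * (g * b) * v⁻¹) * v = g * b := by group
    rw [e3]; exact mul_mem (self_mem_cen g) hbg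
  · rw [mk_eq_one (mul_mem (inv_mem (hFN hv)) hh)]; exact Commute.one_left _

theorem no_good [Finite G] (H1 : HH1 G) (H2 : HH2 G) (g : G) (hg : Gd (fitting2 G) g) : False := by
  have hP : ∀ x : G, x ∉ fitting2 G → ¬ PPc x := fun x hx h => hx (PPc_mem_fitting2 H1 H2 x h)
  have hM : MX (fitting2 G) := fun x y hx hxy => (H1.eq (hP x hx) hxy).2
  have hce : ∀ x y : G, ¬ PPc x → ¬ PPc y → Nat.card (cen x) = Nat.card (cen y) := by
    intro x y hx hy
    have h1 := clz_card x
    rw [← clz_card y, H1 x y hx hy] at h1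
    exact Nat.eq_of_mul_eq_mul_left (Nat.pos_of_ne_zero (clz_ne_zero y)) h1
  have hc : ∀ x y : G, x ∉ fitting2 G → y ∉ fitting2 G → Nat.card (cen x) = Nat.card (cen y) :=
    fun x y hx hy => hce x y (hP x hx) (hP y hy)
  obtain ⟨hGs, hD⟩ := STR hM hc fitting2_solvable hg
  have claim : ∀ h ∈ fitting2 G, ∃ n ∈ fitting2 G, ∃ a ∈ cen g, ∃ f ∈ fittingSubgroup G, n⁻¹ * h * n = a * f := by
    intro h hh
    have hR : (∃ d ∈ cen h, d ∈ cen g ⊔ fitting2 G ∧ d ∉ fitting2 G) →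
        ∃ n ∈ fitting2 G, ∃ a ∈ cen g, ∃ f ∈ fittingSubgroup G, n⁻¹ * h * n = a * f := by
      intro hd
      obtain ⟨n, hn, h1⟩ := claimR hM hg hh hd
      exact ⟨n, hn, _, h1, 1, one_mem _, (mul_one _).symm⟩
    by_cases hPh : PPc h
    · obtain ⟨w, k, hw, hk⟩ := hPh
      by_cases hex : ∃ r, r.Prime ∧ r ∣ Nat.card (bar (fitting2 G) g) ∧ r ≠ w
      · obtain ⟨r, hr, hrd, hrw⟩ := hex
        refine hR (hD r hr hrd _ ?_)
        have h1 : r ^ (Nat.card (cen g)).factorization r ∣ w ^ k * Nat.card (cen h) := by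
          rw [← hk, clz_card]
          exact (Nat.ordProj_dvd _ _).trans (Subgroup.card_subgroup_dvd_card _)
        exact Nat.Coprime.dvd_of_dvd_mul_left (Nat.Coprime.pow _ _ ((Nat.coprime_primes hr hw).2 hrw)) h1
      · push Not at hex
        obtain ⟨r, hr, hrd⟩ := bar_prime (N := fitting2 G) hg.notMem
        have e := hex r hr hrd
        subst e
        obtain ⟨v, hv, h1⟩ := claimW hM hg hh hr hrd hk
        refine ⟨1, one_mem _, v⁻¹ * h, h1, h⁻¹ * v * h, ?_, by group⟩
        have := (inferInstance : (fittingSubgroup G).Normal).conj_mem _ hv h⁻¹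
        simpa using this
    · obtain ⟨r, hr, hrd⟩ := bar_prime (N := fitting2 G) hg.notMem
      refine hR (hD r hr hrd _ ?_)
      rw [hce g h (hP g hg.notMem) hPh]
      exact Nat.ordProj_dvd _ _
  have hQn := fit_nil (G := G ⧸ fittingSubgroup G)
  let π := QuotientGroup.mk' (fittingSubgroup G)
  let D : Subgroup (fittingSubgroup (G ⧸ fittingSubgroup G)) := ((cen g).map π).subgroupOf _
  have hDt : D = ⊤ := by
    by_contra hne
    obtain ⟨u, -, hu⟩ := pgroup_cover ⊤ D le_top hne
    obtain ⟨u, huQ⟩ := u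
    obtain ⟨h, rfl⟩ := QuotientGroup.mk'_surjective _ u
    have hh : h ∈ fitting2 G := huQ
    obtain ⟨n, hn, a, ha, f, hf, e⟩ := claim h hh
    have hnQ : π n⁻¹ ∈ fittingSubgroup (G ⧸ fittingSubgroup G) := by
      have := inv_mem hn
      exact this
    apply hu ⟨π n⁻¹, hnQ⟩
    rw [Subgroup.mem_subgroupOf]
    refine ⟨a, ha, ?_⟩
    show π a = π n⁻¹ * π h * (π n⁻¹)⁻¹
    rw [← map_inv, inv_inv, ← map_mul, ← map_mul, e, map_mul, mk_eq_one hf, mul_one]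
  have hQle : fittingSubgroup (G ⧸ fittingSubgroup G) ≤ (cen g).map π := Subgroup.subgroupOf_eq_top.1 hDt
  have hQs : Group.IsSolvable (G ⧸ fittingSubgroup G) := Group.isSolvable_of_surjective (QuotientGroup.mk'_surjective _)
  let M := Subgroup.centralizer (fittingSubgroup (G ⧸ fittingSubgroup G) : Set (G ⧸ fittingSubgroup G))
  have hMF : M ≤ fittingSubgroup (G ⧸ fittingSubgroup G) := by
    refine cent_fit M inferInstance ?_
    rw [Subgroup.commutator_comm, Subgroup.commutator_eq_bot_iff_le_centralizer]
  have hgM : π g ∈ M := by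
    rw [Subgroup.mem_centralizer_iff]
    intro x hx
    obtain ⟨a, ha, rfl⟩ := hQle hx
    have : Commute a g := mem_cen.1 ha
    exact this.map π
  exact hg.notMem (hMF hgM)

end Fin

theorem stmt_7 (G : Type*) [Group G] [Finite G] (hcard : 4 ≤ (csSet G).ncard)
    (hcomp : {n ∈ csSet G | IsCompositeNat n}.ncard = 2)
    (hpp : ∃ m ∈ csSet G, IsCompositeNat m ∧ IsPrimePow m) :
    fitting2 G = ⊤ ∨ ∀ x : G ⧸ fitting2 G, x ≠ 1 → (orderOf x).Prime := by
  right
  obtain ⟨m, hm, hmc, hmp⟩ := hpp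
  obtain ⟨n1, n2, hne, hset⟩ := Set.ncard_eq_two.1 hcomp
  -- the other composite class size
  obtain ⟨n, hn⟩ : ∃ n, ∀ k ∈ csSet G, IsCompositeNat k → k = m ∨ k = n := by
    have h1 : m ∈ ({n1, n2} : Set ℕ) := by rw [← hset]; exact ⟨hm, hmc⟩
    have h2 : ∀ k ∈ csSet G, IsCompositeNat k → k = n1 ∨ k = n2 := by
      intro k hk hkc
      have : k ∈ ({n1, n2} : Set ℕ) := by rw [← hset]; exact ⟨hk, hkc⟩
      simpa using this
    rcases h1 with h1 | h1
    · exact ⟨n2, fun k hk hkc => h1 ▸ h2 k hk hkc⟩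
    · rw [Set.mem_singleton_iff] at h1
      exact ⟨n1, fun k hk hkc => h1 ▸ (h2 k hk hkc).symm⟩
  have hmem : ∀ g : G, clz g ∈ csSet G := fun g => ⟨g, rfl⟩
  obtain ⟨p, a, hp, ha, hpa⟩ := hmp
  have hp' : p.Prime := hp.nat_prime
  have hnon : ∀ g : G, ¬ PPc g → clz g = n := by
    intro g hg
    have hc : IsCompositeNat (clz g) := by
      constructor
      · have h0 := clz_ne_zero g
        have h1 : clz g ≠ 1 := fun h => hg ⟨2, 0, Nat.prime_two, by simpa using h⟩
        omega
      · intro h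
        exact hg ⟨_, 1, h, (pow_one _).symm⟩
    rcases hn _ (hmem g) hc with h | h
    · exact absurd ⟨p, a, hp', by rw [h, hpa]⟩ hg
    · exact h
  have H1 : HH1 G := fun g h hg hh => (hnon g hg).trans (hnon h hh).symm
  have H2 : HH2 G := by
    rintro ⟨g0, hg0⟩ g h w i j hw hi hj hgi hhj
    have key : ∀ (g : G) (i : ℕ), 2 ≤ i → clz g = w ^ i → clz g = m := by
      intro g i hi hgi
      have hc : IsCompositeNat (clz g) := by
        rw [hgi]
        exact ⟨Nat.one_lt_pow (by omega) hw.one_lt, Nat.Prime.not_prime_pow hi⟩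
      rcases hn _ (hmem g) hc with h | h
      · exact h
      · exact absurd ⟨w, i, hw, by rw [hnon g0 hg0, ← h, hgi]⟩ hg0
    have e : w ^ i = w ^ j := by rw [← hgi, ← hhj, key g i hi hgi, key h j hj hhj]
    exact Nat.pow_right_injective hw.two_le e
  intro x hx
  by_contra hnp
  obtain ⟨g, rfl⟩ := QuotientGroup.mk'_surjective _ x
  refine no_good H1 H2 g (fun r hr h => hnp ?_)
  have h1 : QuotientGroup.mk' (fitting2 G) g ^ r = 1 := by rw [← map_pow]; exact mk_eq_one h
  have h2 := orderOf_dvd_of_pow_eq_one h1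
  rcases (Nat.dvd_prime hr).1 h2 with h3 | h3
  · exact absurd (orderOf_eq_one_iff.1 h3) hx
  · rw [h3]; exact hr
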